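/- arXiv:1805.11320 — 2 statements merged into one kernel-verified Lean document; each statement's English description precedes it below -/
import Mathlib

section
/- (Dyn'kin's almost-analytic extension theorem) Let (M_j)_{j≥0} be a regular weight sequence and let K ⊂ ℝⁿ be a compact convex set equal to the closure of its interior. A function f : K → ℂ is the restriction to K of a smooth function on a neighbourhood of K satisfying, for some constants C, h > 0, the bounds |D^α f(x)| ≤ C·h^{|α|}·M_{|α|} for all multi-indices α and all x ∈ K, if and only if there exists a compactly supported smooth function F : ℂⁿ → ℂ (ℂⁿ identified with ℝ^{2n}) with F|_K = f and constants C, Q > 0 such that |∂̄_j F(z)| ≤ C·h_M(Q·dist(z,K)) for all z ∈ ℂⁿ \ K and all j = 1, …, n, where ∂̄_j = (1/2)(∂/∂x_j + i·∂/∂y_j). -/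
open scoped Topology
open Filter

/-- `m_j = M_j / j!`. -/
noncomputable def mseq (M : ℕ → ℝ) (j : ℕ) : ℝ := M j / (Nat.factorial j : ℝ)

/-- A weight sequence: positive, normalized `M 0 = 1`, log-convex. -/
structure IsWeightSeq (M : ℕ → ℝ) : Prop where
  pos : ∀ j, 0 < M j
  one : M 0 = 1
  logConvex : ∀ j : ℕ, 1 ≤ j → (M j) ^ 2 ≤ M (j - 1) * M (j + 1)

/-- Condition (M2): `sup_k (m_{k+1}/m_k)^(1/k) < ∞`. -/
def CondM2 (M : ℕ → ℝ) : Prop :=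
  ∃ C : ℝ, ∀ k : ℕ, 1 ≤ k → (mseq M (k + 1) / mseq M k) ^ ((1 : ℝ) / k) ≤ C

/-- Condition (M3): log-convexity of `m_k`. -/
def CondM3 (M : ℕ → ℝ) : Prop :=
  ∀ k : ℕ, 1 ≤ k → (mseq M k) ^ 2 ≤ mseq M (k - 1) * mseq M (k + 1)

/-- Condition (M4): `m_k^(1/k) → ∞`. -/
def CondM4 (M : ℕ → ℝ) : Prop :=
  Filter.Tendsto (fun k : ℕ => (mseq M k) ^ ((1 : ℝ) / k)) Filter.atTop Filter.atTop

/-- A regular weight sequence. -/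
structure IsRegularWeightSeq (M : ℕ → ℝ) extends IsWeightSeq M : Prop where
  m_one : mseq M 1 = 1
  cond2 : CondM2 M
  cond3 : CondM3 M
  cond4 : CondM4 M

/-- The associated weight `h_M(t) = inf_k t^k m_k`. -/
noncomputable def weight_h (M : ℕ → ℝ) (t : ℝ) : ℝ := ⨅ k : ℕ, t ^ k * mseq M k

/-- The associated weight function `ω_M(t) = sup_j log (t^j / M_j)`. -/
noncomputable def weight_omega (M : ℕ → ℝ) (t : ℝ) : ℝ := ⨆ j : ℕ, Real.log (t ^ j / M j)

/-- Membership in the Denjoy-Carleman class `E_M(Ω)`: smooth on `Ω` and on every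
compact `K ⊆ Ω` the iterated derivatives satisfy `‖D^k f‖ ≤ C h^k M_k`. -/
def MemDC (M : ℕ → ℝ) {n : ℕ} {E : Type*} [NormedAddCommGroup E] [NormedSpace ℝ E]
    (Ω : Set (Fin n → ℝ)) (f : (Fin n → ℝ) → E) : Prop :=
  ContDiffOn ℝ (⊤ : ℕ∞) f Ω ∧
  ∀ K : Set (Fin n → ℝ), K ⊆ Ω → IsCompact K →
    ∃ C > 0, ∃ h > 0, ∀ k : ℕ, ∀ x ∈ K,
      ‖iteratedFDerivWithin ℝ k f Ω x‖ ≤ C * h ^ k * M k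

/-- The embedding `ℝⁿ ↪ ℂⁿ`. -/
def embRC {n : ℕ} (x : Fin n → ℝ) : Fin n → ℂ := fun j => (x j : ℂ)

/-- `∂̄_j F = (1/2)(∂F/∂x_j + i ∂F/∂y_j)` on `ℂⁿ`. -/
noncomputable def dbar {n : ℕ} (j : Fin n) (F : (Fin n → ℂ) → ℂ) (z : Fin n → ℂ) : ℂ :=
  (1 / 2) * (fderiv ℝ F z (Pi.single j 1) + Complex.I * fderiv ℝ F z (Pi.single j Complex.I))

/-! ### Weight sequences -/

namespace IsRegularWeightSeq

variable {M : ℕ → ℝ}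

lemma mseq_pos (hM : IsRegularWeightSeq M) (k : ℕ) : 0 < mseq M k :=
  div_pos (hM.pos k) (by positivity)

lemma mseq_zero (hM : IsRegularWeightSeq M) : mseq M 0 = 1 := by
  simp [mseq, hM.one]

lemma eq_factorial_mul (M : ℕ → ℝ) (k : ℕ) : M k = k.factorial * mseq M k := by
  have : (k.factorial : ℝ) ≠ 0 := by positivity
  rw [mseq]; field_simp

lemma bddBelow (hM : IsRegularWeightSeq M) {t : ℝ} (ht : 0 ≤ t) :
    BddBelow (Set.range fun k : ℕ => t ^ k * mseq M k) := by
  refine ⟨0, ?_⟩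
  rintro _ ⟨k, rfl⟩
  have := hM.mseq_pos k
  positivity

lemma weight_h_le (hM : IsRegularWeightSeq M) {t : ℝ} (ht : 0 ≤ t) (k : ℕ) :
    weight_h M t ≤ t ^ k * mseq M k :=
  ciInf_le (hM.bddBelow ht) k

lemma weight_h_nonneg (hM : IsRegularWeightSeq M) {t : ℝ} (ht : 0 ≤ t) : 0 ≤ weight_h M t :=
  le_ciInf fun k => mul_nonneg (pow_nonneg ht k) (hM.mseq_pos k).le

lemma weight_h_mono (hM : IsRegularWeightSeq M) {s t : ℝ} (hs : 0 ≤ s) (hst : s ≤ t) :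
    weight_h M s ≤ weight_h M t :=
  ciInf_mono (hM.bddBelow hs) fun k =>
    mul_le_mul_of_nonneg_right (pow_le_pow_left₀ hs hst k) (hM.mseq_pos k).le

lemma exists_mseq_succ_le (hM : IsRegularWeightSeq M) :
    ∃ A : ℝ, 1 ≤ A ∧ ∀ k, mseq M (k + 1) ≤ A ^ k * mseq M k := by
  obtain ⟨C, hC⟩ := hM.cond2
  refine ⟨max C 1, le_max_right _ _, fun k => ?_⟩
  rcases Nat.eq_zero_or_pos k with rfl | hk
  · simp [hM.m_one, hM.mseq_zero]
  · have h := hC k hk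
    have hpos : 0 ≤ mseq M (k + 1) / mseq M k := (div_pos (hM.mseq_pos _) (hM.mseq_pos _)).le
    have hk' : (k : ℝ) ≠ 0 := by positivity
    have h2 := Real.rpow_le_rpow (Real.rpow_nonneg hpos _) (h.trans (le_max_left C 1))
      (Nat.cast_nonneg k)
    rw [← Real.rpow_mul hpos, one_div_mul_cancel hk', Real.rpow_one, Real.rpow_natCast,
      div_le_iff₀ (hM.mseq_pos k)] at h2
    exact h2

lemma exists_lt_mul_succ (hM : IsRegularWeightSeq M) {t : ℝ} (ht : 0 < t) :
    ∃ N, mseq M N < t * mseq M (N + 1) := by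
  by_contra! h
  have h1 : ∀ N, t ^ N * mseq M N ≤ 1 := by
    intro N
    induction N with
    | zero => simp [hM.mseq_zero]
    | succ N ih =>
      refine le_trans ?_ ih
      rw [pow_succ, mul_assoc]
      exact mul_le_mul_of_nonneg_left (h N) (by positivity)
  obtain ⟨k, hk1, hk2⟩ := ((hM.cond4.eventually_gt_atTop t⁻¹).and
    (eventually_ge_atTop 1)).exists
  have hk' : (k : ℝ) ≠ 0 := by positivity
  have h2 := Real.rpow_lt_rpow (by positivity) hk1 (show (0 : ℝ) < k by positivity)
  rw [← Real.rpow_mul (hM.mseq_pos k).le, one_div_mul_cancel hk', Real.rpow_one,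
    Real.rpow_natCast, inv_pow, inv_lt_iff_one_lt_mul₀ (by positivity)] at h2
  linarith [h1 k]

end IsRegularWeightSeq

/-- The smallest index minimising `t ^ k * m_k`. -/
noncomputable def optOrder (M : ℕ → ℝ) (t : ℝ) : ℕ :=
  sInf {N | mseq M N < t * mseq M (N + 1)}

namespace IsRegularWeightSeq

variable {M : ℕ → ℝ}

lemma optOrder_spec (hM : IsRegularWeightSeq M) {t : ℝ} (ht : 0 < t) :
    mseq M (optOrder M t) < t * mseq M (optOrder M t + 1) :=
  Nat.sInf_mem (hM.exists_lt_mul_succ ht)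

lemma mul_succ_le_of_lt_optOrder {t : ℝ} {k : ℕ} (hk : k < optOrder M t) :
    t * mseq M (k + 1) ≤ mseq M k := by
  by_contra! h
  exact (Nat.notMem_of_lt_sInf hk) h

lemma le_optOrder (hM : IsRegularWeightSeq M) {t : ℝ} (ht : 0 < t) {J : ℕ}
    (h : ∀ k < J, t * mseq M (k + 1) ≤ mseq M k) : J ≤ optOrder M t := by
  by_contra! hlt
  exact absurd (hM.optOrder_spec ht) (not_lt.mpr (h _ hlt))

lemma optOrder_anti (hM : IsRegularWeightSeq M) {s t : ℝ} (hs : 0 < s) (hst : s ≤ t) :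
    optOrder M t ≤ optOrder M s :=
  Nat.sInf_le ((hM.optOrder_spec hs).trans_le
    (mul_le_mul_of_nonneg_right hst (hM.mseq_pos _).le))

lemma lt_mul_succ_of_optOrder_le (hM : IsRegularWeightSeq M) {t : ℝ} (ht : 0 < t) {k : ℕ}
    (hk : optOrder M t ≤ k) : mseq M k < t * mseq M (k + 1) := by
  induction k, hk using Nat.le_induction with
  | base => exact hM.optOrder_spec ht
  | succ k _ ih =>
    have h := hM.cond3 (k + 1) (by omega)
    simp only [Nat.add_sub_cancel] at h
    have h0 := hM.mseq_pos k
    have h1 := hM.mseq_pos (k + 1)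
    have h2 := hM.mseq_pos (k + 2)
    have : mseq M (k + 1) * mseq M (k + 1) < (t * mseq M (k + 2)) * mseq M (k + 1) := by
      nlinarith
    exact lt_of_mul_lt_mul_right this h1.le

lemma pow_optOrder_mul_le (hM : IsRegularWeightSeq M) {t : ℝ} (ht : 0 < t) :
    t ^ optOrder M t * mseq M (optOrder M t) ≤ weight_h M t := by
  refine le_ciInf fun k => ?_
  rcases le_total (optOrder M t) k with hk | hk
  · induction k, hk using Nat.le_induction with
    | base => exact le_rfl
    | succ k hk ih =>
      refine ih.trans ?_
      rw [pow_succ, mul_assoc]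
      exact mul_le_mul_of_nonneg_left (hM.lt_mul_succ_of_optOrder_le ht hk).le (by positivity)
  · induction hk using Nat.decreasingInduction with
    | self => exact le_rfl
    | of_succ k hk ih =>
      refine ih.trans ?_
      rw [pow_succ, mul_assoc]
      exact mul_le_mul_of_nonneg_left (mul_succ_le_of_lt_optOrder hk) (by positivity)

lemma weight_h_pos (hM : IsRegularWeightSeq M) {t : ℝ} (ht : 0 < t) : 0 < weight_h M t :=
  lt_of_lt_of_le (mul_pos (pow_pos ht _) (hM.mseq_pos _)) (hM.pow_optOrder_mul_le ht)

lemma eventually_le_optOrder (hM : IsRegularWeightSeq M) (J : ℕ) :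
    ∀ᶠ t in 𝓝[>] (0 : ℝ), J ≤ optOrder M t := by
  have h : ∀ᶠ t in 𝓝[>] (0 : ℝ), ∀ k ∈ Finset.range J, t * mseq M (k + 1) ≤ mseq M k := by
    rw [Filter.eventually_all_finset]
    intro k _
    have h0 : Tendsto (fun t : ℝ => t * mseq M (k + 1)) (𝓝[>] 0) (𝓝 (0 * mseq M (k + 1))) :=
      ((continuous_id.mul continuous_const).tendsto 0).mono_left nhdsWithin_le_nhds
    rw [zero_mul] at h0
    exact (h0.eventually_lt_const (hM.mseq_pos k)).mono fun _ h => h.le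
  filter_upwards [h, self_mem_nhdsWithin] with t h1 ht
  exact hM.le_optOrder ht fun k hk => h1 k (Finset.mem_range.mpr hk)

end IsRegularWeightSeq

/-! ### Complexified Taylor polynomials -/

section Taylor

variable {n : ℕ}

/-- The directional derivative of `g` along the constant field `v`. -/
noncomputable def dirD (v : Fin n → ℝ) (g : (Fin n → ℝ) → ℂ) : (Fin n → ℝ) → ℂ :=
  fun p => fderiv ℝ g p v

/-- The homogeneous part `D^k g(p)(w, …, w)`, extended to complex vectors `w`. -/
noncomputable def taylorHom : ℕ → ((Fin n → ℝ) → ℂ) → (Fin n → ℝ) → (Fin n → ℂ) → ℂ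
  | 0, g, p, _ => g p
  | k + 1, g, p, w => ∑ j, w j * taylorHom k (dirD (Pi.single j 1) g) p w

/-- The Taylor polynomial of `g` at `p` of order `N`, evaluated at the complex point `z`. -/
noncomputable def taylorPoly (N : ℕ) (g : (Fin n → ℝ) → ℂ) (p : Fin n → ℝ)
    (z : Fin n → ℂ) : ℂ :=
  ∑ k ∈ Finset.range (N + 1), taylorHom k g p (z - embRC p) / (k.factorial : ℂ)

variable {g g₁ g₂ : (Fin n → ℝ) → ℂ}

lemma contDiff_dirD (hg : ContDiff ℝ (⊤ : ℕ∞) g) (v : Fin n → ℝ) :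
    ContDiff ℝ (⊤ : ℕ∞) (dirD v g) :=
  (hg.fderiv_right (m := (⊤ : ℕ∞)) (by simp)).clm_apply contDiff_const

lemma dirD_comm (hg : ContDiff ℝ (⊤ : ℕ∞) g) (v w : Fin n → ℝ) :
    dirD v (dirD w g) = dirD w (dirD v g) := by
  have hd : Differentiable ℝ (fderiv ℝ g) :=
    (hg.fderiv_right (m := (⊤ : ℕ∞)) (by simp)).differentiable (by simp)
  have key : ∀ a b : Fin n → ℝ, ∀ p, dirD a (dirD b g) p = fderiv ℝ (fderiv ℝ g) p a b := by
    intro a b p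
    change fderiv ℝ (fun q => fderiv ℝ g q b) p a = _
    rw [fderiv_clm_apply (hd p) (differentiableAt_const b)]
    simp
  funext p
  rw [key, key]
  have hs : IsSymmSndFDerivAt ℝ g p := (hg.contDiffAt).isSymmSndFDerivAt (by
    simpa using (WithTop.coe_le_coe.mpr (le_top : (2 : ℕ∞) ≤ ⊤)))
  exact hs v w

lemma dirD_sum {ι : Type*} (s : Finset ι) (c : ι → ℂ) (G : ι → (Fin n → ℝ) → ℂ)
    (hG : ∀ i ∈ s, ContDiff ℝ (⊤ : ℕ∞) (G i)) (v : Fin n → ℝ) :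
    dirD v (fun p => ∑ i ∈ s, c i * G i p) = fun p => ∑ i ∈ s, c i * dirD v (G i) p := by
  funext p
  have hd : ∀ i ∈ s, HasFDerivAt (fun p => c i * G i p) (c i • fderiv ℝ (G i) p) p :=
    fun i hi => (((hG i hi).differentiable (by simp)) p).hasFDerivAt.const_mul (c i)
  have := (HasFDerivAt.fun_sum hd).fderiv
  simp only [dirD]
  rw [this]
  simp

lemma taylorHom_sum (k : ℕ) {ι : Type*} (s : Finset ι) (c : ι → ℂ) (G : ι → (Fin n → ℝ) → ℂ)
    (hG : ∀ i ∈ s, ContDiff ℝ (⊤ : ℕ∞) (G i)) (p : Fin n → ℝ) (w : Fin n → ℂ) :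
    taylorHom k (fun p => ∑ i ∈ s, c i * G i p) p w = ∑ i ∈ s, c i * taylorHom k (G i) p w := by
  induction k generalizing G with
  | zero => rfl
  | succ k ih =>
    simp only [taylorHom]
    simp_rw [dirD_sum s c G hG, ih _ (fun i hi => contDiff_dirD (hG i hi) _), Finset.mul_sum]
    rw [Finset.sum_comm]
    refine Finset.sum_congr rfl fun i _ => Finset.sum_congr rfl fun j _ => by ring

lemma dirD_eq_sum (g : (Fin n → ℝ) → ℂ) (v : Fin n → ℝ) :
    dirD v g = fun p => ∑ j, (v j : ℂ) * dirD (Pi.single j 1) g p := by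
  funext p
  simp only [dirD]
  conv_lhs => rw [pi_eq_sum_univ' v]
  simp [map_sum]

lemma taylorHom_dirD (hg : ContDiff ℝ (⊤ : ℕ∞) g) (k : ℕ) (v p : Fin n → ℝ) (w : Fin n → ℂ) :
    taylorHom k (dirD v g) p w = ∑ j, (v j : ℂ) * taylorHom k (dirD (Pi.single j 1) g) p w := by
  rw [dirD_eq_sum, taylorHom_sum k _ _ _ fun i _ => contDiff_dirD hg _]

lemma continuous_taylorHom (hg : ContDiff ℝ (⊤ : ℕ∞) g) (k : ℕ) :
    Continuous fun q : (Fin n → ℝ) × (Fin n → ℂ) => taylorHom k g q.1 q.2 := by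
  induction k generalizing g with
  | zero => exact hg.continuous.comp continuous_fst
  | succ k ih =>
    refine continuous_finsetSum _ fun j _ => ?_
    exact ((continuous_apply j).comp continuous_snd).mul (ih (contDiff_dirD hg _))

lemma contDiff_taylorHom (g : (Fin n → ℝ) → ℂ) (k : ℕ) (p : Fin n → ℝ) :
    ContDiff ℂ (⊤ : ℕ∞) (taylorHom k g p) := by
  induction k generalizing g with
  | zero => exact contDiff_const
  | succ k ih =>
    refine ContDiff.sum fun j _ => ?_
    exact (contDiff_apply ℂ ℂ j).mul (ih _)

lemma contDiff_taylorPoly (g : (Fin n → ℝ) → ℂ) (N : ℕ) (p : Fin n → ℝ) :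
    ContDiff ℂ (⊤ : ℕ∞) (taylorPoly N g p) := by
  refine ContDiff.sum fun k _ => ?_
  exact ((contDiff_taylorHom g k p).comp (contDiff_id.sub contDiff_const)).div_const _

lemma differentiable_taylorPoly (g : (Fin n → ℝ) → ℂ) (N : ℕ) (p : Fin n → ℝ) :
    Differentiable ℂ (taylorPoly N g p) :=
  (contDiff_taylorPoly g N p).differentiable (by simp)

lemma continuous_embRC : Continuous (embRC : (Fin n → ℝ) → (Fin n → ℂ)) :=
  continuous_pi fun j => Complex.continuous_ofReal.comp (continuous_apply j)

lemma embRC_sub (x y : Fin n → ℝ) : embRC (x - y) = embRC x - embRC y := by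
  funext j; simp [embRC]

lemma norm_embRC (x : Fin n → ℝ) : ‖embRC x‖ = ‖x‖ := by
  simp [Pi.norm_def, embRC]

lemma continuous_taylorPoly (hg : ContDiff ℝ (⊤ : ℕ∞) g) (N : ℕ) :
    Continuous fun q : (Fin n → ℝ) × (Fin n → ℂ) => taylorPoly N g q.1 q.2 := by
  refine continuous_finsetSum _ fun k _ => Continuous.div_const ?_ _
  exact (continuous_taylorHom hg k).comp
    (continuous_fst.prodMk (continuous_snd.sub (continuous_embRC.comp continuous_fst)))

lemma norm_iteratedFDeriv_dirD_le (hg : ContDiff ℝ (⊤ : ℕ∞) g) (v p : Fin n → ℝ) (k : ℕ) :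
    ‖iteratedFDeriv ℝ k (dirD v g) p‖ ≤ ‖v‖ * ‖iteratedFDeriv ℝ (k + 1) g p‖ := by
  have h := norm_iteratedFDeriv_clm_apply_const (f := fderiv ℝ g) (c := v) (x := p) (n := k)
    (N := (⊤ : ℕ∞)) (hg.fderiv_right (m := (⊤ : ℕ∞)) (by simp)).contDiffAt
    (WithTop.coe_le_coe.mpr le_top)
  rwa [norm_iteratedFDeriv_fderiv] at h

lemma norm_taylorHom_le (hg : ContDiff ℝ (⊤ : ℕ∞) g) (k : ℕ) (p : Fin n → ℝ) (w : Fin n → ℂ) :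
    ‖taylorHom k g p w‖ ≤ (n * ‖w‖) ^ k * ‖iteratedFDeriv ℝ k g p‖ := by
  induction k generalizing g with
  | zero => simp [taylorHom]
  | succ k ih =>
    have h : ∀ j ∈ Finset.univ, ‖w j * taylorHom k (dirD (Pi.single j 1) g) p w‖ ≤
        ‖w‖ * ((n * ‖w‖) ^ k * ‖iteratedFDeriv ℝ (k + 1) g p‖) := by
      intro j _
      rw [norm_mul]
      refine mul_le_mul (norm_le_pi_norm w j) ((ih (contDiff_dirD hg _)).trans ?_)
        (norm_nonneg _) (norm_nonneg _)
      refine mul_le_mul_of_nonneg_left ((norm_iteratedFDeriv_dirD_le hg _ p k).trans ?_)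
        (by positivity)
      rw [Pi.norm_single]; simp
    refine (norm_sum_le_of_le _ h).trans (le_of_eq ?_)
    simp; ring

lemma hasDerivAt_taylorHom (hg : ContDiff ℝ (⊤ : ℕ∞) g) (k : ℕ) (x v : Fin n → ℝ)
    (z : Fin n → ℂ) (s : ℝ) :
    HasDerivAt (fun s : ℝ => taylorHom k g (x + s • v) (z - embRC (x + s • v)))
      (taylorHom k (dirD v g) (x + s • v) (z - embRC (x + s • v)) -
        k * taylorHom (k - 1) (dirD v g) (x + s • v) (z - embRC (x + s • v))) s := by
  induction k generalizing g with
  | zero =>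
    have h1 : HasDerivAt (fun s : ℝ => x + s • v) v s := by
      simpa using ((hasDerivAt_id s).smul_const v).const_add x
    have h2 := ((hg.differentiable (by simp)) (x + s • v)).hasFDerivAt.comp_hasDerivAt s h1
    refine h2.congr_deriv ?_
    simp [taylorHom, dirD]
  | succ k ih =>
    have hw : ∀ j, HasDerivAt (fun s : ℝ => (z - embRC (x + s • v)) j) (-(v j : ℂ)) s := by
      intro j
      have h2 : HasDerivAt (fun s : ℝ => x j + s * v j) (v j) s := by
        simpa using ((hasDerivAt_id s).mul_const (v j)).const_add (x j)
      simpa [embRC] using h2.ofReal_comp.const_sub (z j)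
    have hsum := HasDerivAt.fun_sum (u := Finset.univ) fun j _ =>
      (hw j).mul (ih (contDiff_dirD hg (Pi.single j 1)))
    refine hsum.congr_deriv ?_
    set w := z - embRC (x + s • v)
    set p := x + s • v
    simp only [Nat.add_sub_cancel]
    have e1 : ∑ j, (v j : ℂ) * taylorHom k (dirD (Pi.single j 1) g) p w
        = taylorHom k (dirD v g) p w := (taylorHom_dirD hg k v p w).symm
    have e2 : ∑ j, w j * taylorHom k (dirD v (dirD (Pi.single j 1) g)) p w
        = taylorHom (k + 1) (dirD v g) p w := by
      simp only [taylorHom, dirD_comm hg v]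
    have e3 : (k : ℂ) * ∑ j, w j * taylorHom (k - 1) (dirD v (dirD (Pi.single j 1) g)) p w
        = k * taylorHom k (dirD v g) p w := by
      rcases k with _ | k
      · simp
      · simp only [Nat.add_sub_cancel]
        conv_rhs => rw [taylorHom]
        simp only [dirD_comm hg v]
    calc _ = -(∑ j, (v j : ℂ) * taylorHom k (dirD (Pi.single j 1) g) p w)
          + (∑ j, w j * taylorHom k (dirD v (dirD (Pi.single j 1) g)) p w)
          - (k : ℂ) * ∑ j, w j * taylorHom (k - 1) (dirD v (dirD (Pi.single j 1) g)) p w := by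
          rw [Finset.mul_sum, ← Finset.sum_neg_distrib, ← Finset.sum_add_distrib,
            ← Finset.sum_sub_distrib]
          refine Finset.sum_congr rfl fun j _ => by ring
      _ = _ := by
          rw [e1, e2, e3]; push_cast; ring

lemma hasDerivAt_taylorPoly (hg : ContDiff ℝ (⊤ : ℕ∞) g) (N : ℕ) (x v : Fin n → ℝ)
    (z : Fin n → ℂ) (s : ℝ) :
    HasDerivAt (fun s : ℝ => taylorPoly N g (x + s • v) z)
      (taylorHom N (dirD v g) (x + s • v) (z - embRC (x + s • v)) / (N.factorial : ℂ)) s := by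
  induction N with
  | zero =>
    simpa [taylorPoly] using hasDerivAt_taylorHom hg 0 x v z s
  | succ N ih =>
    have h := ih.add ((hasDerivAt_taylorHom hg (N + 1) x v z s).div_const
      ((N + 1).factorial : ℂ))
    have e : (fun s : ℝ => taylorPoly (N + 1) g (x + s • v) z) =
        (fun s : ℝ => taylorPoly N g (x + s • v) z) + fun s : ℝ =>
          taylorHom (N + 1) g (x + s • v) (z - embRC (x + s • v)) / ((N + 1).factorial : ℂ) := by
      funext s
      simp only [taylorPoly, Pi.add_apply]
      rw [Finset.sum_range_succ]
    rw [e]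
    refine h.congr_deriv ?_
    have h1 : (N.factorial : ℂ) ≠ 0 := by exact_mod_cast N.factorial_ne_zero
    have h2 : ((N : ℂ) + 1) ≠ 0 := by exact_mod_cast Nat.succ_ne_zero N
    rw [Nat.factorial_succ, Nat.add_sub_cancel]
    push_cast
    field_simp
    ring

lemma norm_taylorPoly_sub_center_le (hg : ContDiff ℝ (⊤ : ℕ∞) g) (N : ℕ) {x y : Fin n → ℝ}
    {z : Fin n → ℂ} {R S : ℝ}
    (hR : ∀ s ∈ Set.Icc (0 : ℝ) 1, ‖z - embRC (x + s • (y - x))‖ ≤ R)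
    (hS : ∀ s ∈ Set.Icc (0 : ℝ) 1, ‖iteratedFDeriv ℝ (N + 1) g (x + s • (y - x))‖ ≤ S) :
    ‖taylorPoly N g y z - taylorPoly N g x z‖ ≤
      (n * R) ^ N * (‖y - x‖ * S) / N.factorial := by
  have h := norm_image_sub_le_of_norm_deriv_le_segment_01'
    (f := fun s : ℝ => taylorPoly N g (x + s • (y - x)) z)
    (C := (n * R) ^ N * (‖y - x‖ * S) / N.factorial)
    (fun s _ => (hasDerivAt_taylorPoly hg N x (y - x) z s).hasDerivWithinAt) ?_
  · simpa using h
  · intro s hs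
    have hs' := Set.Ico_subset_Icc_self hs
    rw [norm_div, Complex.norm_natCast]
    refine div_le_div_of_nonneg_right ?_ (by positivity)
    refine (norm_taylorHom_le (contDiff_dirD hg _) N _ _).trans ?_
    have hR0 : 0 ≤ R := (norm_nonneg _).trans (hR s hs')
    refine mul_le_mul ?_ ?_ (norm_nonneg _) (by positivity)
    · exact pow_le_pow_left₀ (by positivity)
        (mul_le_mul_of_nonneg_left (hR s hs') (by positivity)) _
    · exact (norm_iteratedFDeriv_dirD_le hg _ _ N).trans
        (mul_le_mul_of_nonneg_left (hS s hs') (norm_nonneg _))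

end Taylor

/-! ### Mollification with a circularly invariant kernel -/

section Mollifier

open MeasureTheory Metric
open scoped Convolution

variable {n : ℕ}

/-- A smooth non-negative bump function on `ℂⁿ`, invariant under multiplication by phases. -/
noncomputable def circularBump (w : Fin n → ℂ) : ℝ :=
  Real.smoothTransition (1 - 16 * ∑ j, Complex.normSq (w j))

lemma contDiff_circularBump : ContDiff ℝ (⊤ : ℕ∞) (circularBump (n := n)) := by
  refine Real.smoothTransition.contDiff.comp ?_
  simp only [Complex.normSq_apply]
  have h : ∀ j : Fin n, ContDiff ℝ (⊤ : ℕ∞) (fun w : Fin n → ℂ => w j) := fun j =>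
    contDiff_apply ℝ ℂ j
  have hre : ∀ j : Fin n, ContDiff ℝ (⊤ : ℕ∞) (fun w : Fin n → ℂ => (w j).re) := fun j =>
    Complex.reCLM.contDiff.comp (h j)
  have him : ∀ j : Fin n, ContDiff ℝ (⊤ : ℕ∞) (fun w : Fin n → ℂ => (w j).im) := fun j =>
    Complex.imCLM.contDiff.comp (h j)
  exact contDiff_const.sub (contDiff_const.mul (ContDiff.sum fun j _ =>
    ((hre j).mul (hre j)).add ((him j).mul (him j))))

lemma circularBump_nonneg (w : Fin n → ℂ) : 0 ≤ circularBump w := Real.smoothTransition.nonneg _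

lemma circularBump_eq_zero {w : Fin n → ℂ} (hw : w ∉ closedBall (0 : Fin n → ℂ) (1 / 4)) :
    circularBump w = 0 := by
  refine Real.smoothTransition.zero_of_nonpos ?_
  rw [mem_closedBall_zero_iff, pi_norm_le_iff_of_nonneg (by norm_num)] at hw
  push Not at hw
  obtain ⟨j, hj⟩ := hw
  have h1 : Complex.normSq (w j) ≤ ∑ j, Complex.normSq (w j) :=
    Finset.single_le_sum (fun i _ => Complex.normSq_nonneg (w i)) (Finset.mem_univ j)
  rw [Complex.normSq_eq_norm_sq] at h1
  nlinarith

lemma hasCompactSupport_of_closedBall {F : Type*} [Zero F] {φ : (Fin n → ℂ) → F} {r : ℝ}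
    (h : ∀ w ∉ closedBall (0 : Fin n → ℂ) r, φ w = 0) : HasCompactSupport φ :=
  HasCompactSupport.intro (isCompact_closedBall _ _) h

lemma integral_circularBump_pos : 0 < ∫ w : Fin n → ℂ, circularBump w := by
  have hc : Continuous (circularBump (n := n)) := contDiff_circularBump.continuous
  refine (hc.integral_pos_of_hasCompactSupport_nonneg_nonzero
    (hasCompactSupport_of_closedBall fun w hw => circularBump_eq_zero hw)
    circularBump_nonneg (x := 0) ?_)
  simp [circularBump]

/-- The normalised circularly invariant kernel. -/
noncomputable def circularKernel (w : Fin n → ℂ) : ℝ :=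
  (∫ w : Fin n → ℂ, circularBump w)⁻¹ * circularBump w

lemma contDiff_circularKernel : ContDiff ℝ (⊤ : ℕ∞) (circularKernel (n := n)) :=
  contDiff_const.mul contDiff_circularBump

lemma circularKernel_eq_zero {w : Fin n → ℂ} (hw : w ∉ closedBall (0 : Fin n → ℂ) (1 / 4)) :
    circularKernel w = 0 := by
  rw [circularKernel, circularBump_eq_zero hw, mul_zero]

lemma hasCompactSupport_circularKernel : HasCompactSupport (circularKernel (n := n)) :=
  hasCompactSupport_of_closedBall fun _ hw => circularKernel_eq_zero hw

lemma integral_circularKernel : ∫ w : Fin n → ℂ, circularKernel w = 1 := by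
  simp only [circularKernel]
  rw [integral_const_mul, inv_mul_cancel₀ integral_circularBump_pos.ne']

lemma circularKernel_smul {a : ℂ} (ha : ‖a‖ = 1) (w : Fin n → ℂ) :
    circularKernel (a • w) = circularKernel w := by
  simp [circularKernel, circularBump, Complex.normSq_eq_norm_sq, ha]

lemma measurePreserving_smul_circle {a : ℂ} (ha : ‖a‖ = 1) :
    MeasurePreserving (fun w : Fin n → ℂ => a • w) volume volume := by
  have h := volume_preserving_pi (ι := Fin n) (α' := fun _ => ℂ) (β' := fun _ => ℂ)
    (f := fun _ => rotation ⟨a, by simpa [Submonoid.mem_carrier, Circle, Submonoid.unitSphere]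
      using ha⟩) (fun _ => LinearIsometryEquiv.measurePreserving _)
  exact h

lemma integral_comp_sub_mul_circularKernel {T : (Fin n → ℂ) → ℂ} (hT : Differentiable ℂ T)
    (z : Fin n → ℂ) : ∫ w, (circularKernel w : ℝ) • T (z - w) = T z := by
  have hTc := hT.continuous
  have hkc : Continuous (circularKernel (n := n)) := contDiff_circularKernel.continuous
  have hrot : ∀ a : ℂ, ‖a‖ = 1 → ∫ w, circularKernel w • T (z - a • w) =
      ∫ w, circularKernel w • T (z - w) := by
    intro a ha
    have ha0 : a ≠ 0 := by rintro rfl; simp at ha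
    have h := (measurePreserving_smul_circle (n := n) ha).integral_comp
      (Homeomorph.smulOfNeZero a ha0).measurableEmbedding
      (fun w => circularKernel w • T (z - w))
    simpa only [circularKernel_smul ha] using h
  have hcirc : ∀ w : Fin n → ℂ,
      ∫ θ in (0 : ℝ)..2 * Real.pi, T (z - circleMap 0 1 θ • w) = (2 * Real.pi) • T z := by
    intro w
    have hd : Differentiable ℂ fun a : ℂ => T (z - a • w) :=
      hT.comp ((differentiable_id.smul_const w).const_sub z)
    have h := (hd.diffContOnCl (s := ball 0 |1|)).circleAverage
    rw [Real.circleAverage_def] at h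
    simp only [zero_smul, sub_zero] at h
    rw [← h, smul_smul, mul_inv_cancel₀ (by positivity), one_smul]
  have hint : Integrable (Function.uncurry fun (θ : ℝ) (w : Fin n → ℂ) =>
      circularKernel w • T (z - circleMap 0 1 θ • w))
      ((volume.restrict (Set.uIoc 0 (2 * Real.pi))).prod volume) := by
    have hcont : Continuous (Function.uncurry fun (θ : ℝ) (w : Fin n → ℂ) =>
        circularKernel w • T (z - circleMap 0 1 θ • w)) := by
      refine (hkc.comp continuous_snd).smul (hTc.comp (continuous_const.sub ?_))
      exact ((continuous_circleMap 0 1).comp continuous_fst).smul continuous_snd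
    have hK : IsCompact (Set.Icc 0 (2 * Real.pi) ×ˢ closedBall (0 : Fin n → ℂ) (1 / 4)) :=
      isCompact_Icc.prod (isCompact_closedBall _ _)
    have h1 := (hcont.continuousOn (s := Set.Icc 0 (2 * Real.pi) ×ˢ
      closedBall (0 : Fin n → ℂ) (1 / 4))).integrableOn_compact
      (μ := (volume : Measure ℝ).prod volume) hK
    have h2 : IntegrableOn (Function.uncurry fun (θ : ℝ) (w : Fin n → ℂ) =>
        circularKernel w • T (z - circleMap 0 1 θ • w))
        (Set.Icc 0 (2 * Real.pi) ×ˢ Set.univ) ((volume : Measure ℝ).prod volume) := by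
      refine h1.of_forall_sdiff_eq_zero (measurableSet_Icc.prod MeasurableSet.univ) ?_
      rintro ⟨θ, w⟩ ⟨⟨h3, -⟩, h4⟩
      have : w ∉ closedBall (0 : Fin n → ℂ) (1 / 4) := fun h5 => h4 ⟨h3, h5⟩
      simp [circularKernel_eq_zero this]
    have h3 := h2.mono_set (Set.prod_mono_left (t := Set.univ)
      (s₁ := Set.uIoc 0 (2 * Real.pi)) (by
        rw [Set.uIoc_of_le (by positivity)]; exact Set.Ioc_subset_Icc_self))
    rw [IntegrableOn, ← Measure.prod_restrict, Measure.restrict_univ] at h3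
    exact h3
  have hswap := intervalIntegral_integral_swap hint
  have hl : ∫ θ in (0 : ℝ)..2 * Real.pi, ∫ w, circularKernel w • T (z - circleMap 0 1 θ • w)
      = (2 * Real.pi) • ∫ w, circularKernel w • T (z - w) := by
    simp_rw [fun θ => hrot (circleMap 0 1 θ) (by simp)]
    simp
  have hr : ∫ w, ∫ θ in (0 : ℝ)..2 * Real.pi, circularKernel w • T (z - circleMap 0 1 θ • w)
      = (2 * Real.pi) • T z := by
    simp_rw [intervalIntegral.integral_smul, hcirc]
    rw [integral_smul_const, integral_circularKernel, one_smul]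
  rw [hl, hr] at hswap
  exact smul_right_injective ℂ (by positivity : (2 * Real.pi) ≠ 0) hswap

lemma norm_convolution_le_of_closedBall {V W : Type} [NormedAddCommGroup V] [NormedSpace ℝ V]
    [NormedAddCommGroup W] [NormedSpace ℝ W] (L : ℂ →L[ℝ] V →L[ℝ] W)
    {f : (Fin n → ℂ) → ℂ} {φ : (Fin n → ℂ) → V} {r S A : ℝ} {z : Fin n → ℂ}
    (hφ : ∀ w ∉ closedBall (0 : Fin n → ℂ) r, φ w = 0) (hA : ∀ w, ‖φ w‖ ≤ A)
    (hS : ∀ w ∈ closedBall z r, ‖f w‖ ≤ S) :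
    ‖(f ⋆[L, volume] φ) z‖ ≤ ‖L‖ * (S * A * volume.real (closedBall (0 : Fin n → ℂ) r)) := by
  rw [convolution_def, ← setIntegral_eq_integral_of_forall_compl_eq_zero (s := closedBall z r)]
  · have hvol : volume.real (closedBall (0 : Fin n → ℂ) r) = volume.real (closedBall z r) := by
      rw [measureReal_def, measureReal_def, Measure.addHaar_closedBall_center volume z r]
    rw [hvol, ← mul_assoc, ← mul_assoc]
    refine norm_setIntegral_le_of_norm_le_const measure_closedBall_lt_top ?_
    intro t ht
    refine (L.le_opNorm₂ _ _).trans ?_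
    have hS0 : 0 ≤ S := (norm_nonneg _).trans (hS t ht)
    gcongr
    · exact hS t ht
    · exact hA _
  · intro t ht
    rw [hφ (z - t), map_zero]
    rwa [mem_closedBall_zero_iff, ← dist_eq_norm, dist_comm, ← mem_closedBall]

lemma norm_iteratedFDeriv_convolution_le {V W : Type} [NormedAddCommGroup V] [NormedSpace ℝ V]
    [NormedAddCommGroup W] [NormedSpace ℝ W] (L : ℂ →L[ℝ] V →L[ℝ] W)
    {f : (Fin n → ℂ) → ℂ} (hf : Continuous f) {φ : (Fin n → ℂ) → V}
    (hφs : ContDiff ℝ (⊤ : ℕ∞) φ) {r S A : ℝ} (hA0 : 0 ≤ A) {z : Fin n → ℂ}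
    (hφ : ∀ w ∉ closedBall (0 : Fin n → ℂ) r, φ w = 0) (k : ℕ)
    (hA : ∀ w, ‖iteratedFDeriv ℝ k φ w‖ ≤ A) (hS0 : 0 ≤ S)
    (hS : ∀ w ∈ closedBall z r, ‖f w‖ ≤ S) :
    ‖iteratedFDeriv ℝ k (f ⋆[L, volume] φ) z‖ ≤
      ‖L‖ * (S * A * volume.real (closedBall (0 : Fin n → ℂ) r)) := by
  induction k generalizing V W with
  | zero =>
    rw [norm_iteratedFDeriv_zero]
    exact norm_convolution_le_of_closedBall L hφ (fun w => by simpa using hA w) hS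
  | succ k ih =>
    have hcs : HasCompactSupport φ := hasCompactSupport_of_closedBall hφ
    have hfd : fderiv ℝ (f ⋆[L, volume] φ) = f ⋆[L.precompR (Fin n → ℂ), volume] fderiv ℝ φ :=
      funext fun x => (hcs.hasFDerivAt_convolution_right L hf.locallyIntegrable
        (hφs.of_le (by simp)) x).fderiv
    rw [← norm_iteratedFDeriv_fderiv, hfd]
    refine (ih (L.precompR (Fin n → ℂ)) (hφs.fderiv_right (m := (⊤ : ℕ∞)) (by simp)) ?_ ?_).trans ?_
    · intro w hw
      have : φ =ᶠ[𝓝 w] fun _ => 0 := by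
        filter_upwards [isClosed_closedBall.isOpen_compl.mem_nhds hw] with y hy using hφ y hy
      rw [this.fderiv_eq]; simp
    · intro w
      rw [norm_iteratedFDeriv_fderiv]; exact hA w
    · exact mul_le_mul_of_nonneg_right (L.norm_precompR_le (Fin n → ℂ)) (by positivity)

/-- Mollification of `F` at scale `c⁻¹`. -/
noncomputable def mollify (c : ℝ) (F : (Fin n → ℂ) → ℂ) (z : Fin n → ℂ) : ℂ :=
  ((fun u => F (c⁻¹ • u)) ⋆[(ContinuousLinearMap.lsmul ℝ ℝ).flip, volume] circularKernel) (c • z)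

lemma contDiff_mollify {F : (Fin n → ℂ) → ℂ} (hF : Continuous F) (c : ℝ) :
    ContDiff ℝ (⊤ : ℕ∞) (mollify c F) := by
  have h : ContDiff ℝ (⊤ : ℕ∞) ((fun u => F (c⁻¹ • u))
      ⋆[(ContinuousLinearMap.lsmul ℝ ℝ).flip, volume] circularKernel) :=
    hasCompactSupport_circularKernel.contDiff_convolution_right _
      (hF.comp (continuous_const_smul _)).locallyIntegrable contDiff_circularKernel
  exact h.comp (contDiff_const_smul c)

lemma mollify_sub {F G : (Fin n → ℂ) → ℂ} (hF : Continuous F) (hG : Continuous G) (c : ℝ)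
    (z : Fin n → ℂ) : mollify c (fun w => F w - G w) z = mollify c F z - mollify c G z := by
  have hi : ∀ {H : (Fin n → ℂ) → ℂ}, Continuous H → Integrable fun t : Fin n → ℂ =>
      (ContinuousLinearMap.lsmul ℝ ℝ).flip (H (c⁻¹ • t)) (circularKernel (c • z - t)) := by
    intro H hH
    have h := hasCompactSupport_circularKernel.convolutionExists_right
      (ContinuousLinearMap.lsmul ℝ ℝ).flip
      ((hH.comp (continuous_const_smul c⁻¹)).locallyIntegrable (μ := volume))
      contDiff_circularKernel.continuous (c • z)
    exact h
  simp only [mollify, convolution_def]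
  rw [← integral_sub (hi hF) (hi hG)]
  simp [smul_sub]

lemma mollify_of_differentiable {T : (Fin n → ℂ) → ℂ} (hT : Differentiable ℂ T) {c : ℝ}
    (hc : c ≠ 0) (z : Fin n → ℂ) : mollify c T z = T z := by
  have hd : Differentiable ℂ fun u : Fin n → ℂ => T (c⁻¹ • u) := by
    refine hT.comp ?_
    exact differentiable_id.const_smul c⁻¹
  have h := integral_comp_sub_mul_circularKernel hd (c • z)
  rw [mollify, convolution_def, ← integral_sub_left_eq_self _ volume (c • z)]
  simpa [smul_smul, inv_mul_cancel₀ hc] using h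

lemma exists_norm_iteratedFDeriv_mollify_le (n k : ℕ) :
    ∃ A : ℝ, 0 < A ∧ ∀ (F : (Fin n → ℂ) → ℂ) (_ : Continuous F) (c S : ℝ) (z : Fin n → ℂ),
      0 < c → 0 ≤ S → (∀ w ∈ closedBall z (1 / (4 * c)), ‖F w‖ ≤ S) →
      ‖iteratedFDeriv ℝ k (mollify c F) z‖ ≤ c ^ k * (A * S) := by
  obtain ⟨B, hB⟩ := (hasCompactSupport_circularKernel (n := n).iteratedFDeriv
    (𝕜 := ℝ) k).exists_bound_of_continuous
    (contDiff_circularKernel.continuous_iteratedFDeriv (WithTop.coe_le_coe.mpr le_top))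
  have hB0 : 0 ≤ B := (norm_nonneg _).trans (hB 0)
  set v := volume.real (closedBall (0 : Fin n → ℂ) (1 / 4))
  refine ⟨B * v + 1, by positivity, ?_⟩
  intro F hF c S z hc hS0 hS
  have hFc : Continuous fun u : Fin n → ℂ => F (c⁻¹ • u) := hF.comp (continuous_const_smul _)
  have h1 : ContDiff ℝ k ((fun u => F (c⁻¹ • u))
      ⋆[(ContinuousLinearMap.lsmul ℝ ℝ).flip, volume] circularKernel) :=
    (hasCompactSupport_circularKernel.contDiff_convolution_right _
      hFc.locallyIntegrable contDiff_circularKernel).of_le (WithTop.coe_le_coe.mpr le_top)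
  have h2 := congrFun (iteratedFDeriv_comp_const_smul c h1) z
  change iteratedFDeriv ℝ k (mollify c F) z = _ at h2
  rw [h2, norm_smul, norm_pow, Real.norm_of_nonneg hc.le]
  refine mul_le_mul_of_nonneg_left ?_ (by positivity)
  refine (norm_iteratedFDeriv_convolution_le _ hFc contDiff_circularKernel hB0
    (fun w hw => circularKernel_eq_zero hw) k hB hS0 ?_).trans ?_
  · intro w hw
    refine hS _ ?_
    rw [mem_closedBall, dist_eq_norm] at hw ⊢
    have : c⁻¹ • w - z = c⁻¹ • (w - c • z) := by
      rw [smul_sub, smul_smul, inv_mul_cancel₀ hc.ne', one_smul]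
    rw [this, norm_smul, norm_inv, Real.norm_of_nonneg hc.le]
    calc c⁻¹ * ‖w - c • z‖ ≤ c⁻¹ * (1 / 4) := by gcongr
      _ = 1 / (4 * c) := by field_simp
  · have hL : ‖(ContinuousLinearMap.lsmul ℝ ℝ : ℝ →L[ℝ] ℂ →L[ℝ] ℂ).flip‖ ≤ 1 := by
      rw [ContinuousLinearMap.opNorm_flip]; exact ContinuousLinearMap.opNorm_lsmul_le
    have hv : 0 ≤ v := measureReal_nonneg
    calc _ ≤ 1 * (S * B * v) := by gcongr
      _ ≤ (B * v + 1) * S := by nlinarith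

end Mollifier

/-! ### Gluing local almost-holomorphic approximations -/

section Glue

open Metric

variable {n : ℕ}

lemma norm_dbar_le (j : Fin n) (F : (Fin n → ℂ) → ℂ) (z : Fin n → ℂ) :
    ‖dbar j F z‖ ≤ ‖fderiv ℝ F z‖ := by
  have h1 : ‖fderiv ℝ F z (Pi.single j 1)‖ ≤ ‖fderiv ℝ F z‖ := by
    simpa [Pi.norm_single] using (fderiv ℝ F z).le_opNorm (Pi.single j 1)
  have h2 : ‖fderiv ℝ F z (Pi.single j Complex.I)‖ ≤ ‖fderiv ℝ F z‖ := by
    simpa [Pi.norm_single] using (fderiv ℝ F z).le_opNorm (Pi.single j Complex.I)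
  rw [dbar, norm_mul]
  have h3 := norm_add_le (fderiv ℝ F z (Pi.single j 1))
    (Complex.I * fderiv ℝ F z (Pi.single j Complex.I))
  rw [norm_mul, Complex.norm_I, one_mul] at h3
  have h4 : ‖(1 / 2 : ℂ)‖ = 1 / 2 := by simp
  rw [h4]
  linarith

lemma dbar_add {F G : (Fin n → ℂ) → ℂ} {z : Fin n → ℂ} (hF : DifferentiableAt ℝ F z)
    (hG : DifferentiableAt ℝ G z) (j : Fin n) :
    dbar j (fun w => F w + G w) z = dbar j F z + dbar j G z := by
  simp only [dbar]
  rw [fderiv_fun_add hF hG]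
  simp only [_root_.add_apply]
  ring

lemma dbar_of_differentiable {T : (Fin n → ℂ) → ℂ} (hT : Differentiable ℂ T) (j : Fin n)
    (z : Fin n → ℂ) : dbar j T z = 0 := by
  have h := ((hT z).hasFDerivAt.restrictScalars ℝ).fderiv
  have h2 : (Pi.single j Complex.I : Fin n → ℂ) = Complex.I • Pi.single j 1 := by
    rw [← Pi.single_smul, smul_eq_mul, mul_one]
  simp only [dbar, h, ContinuousLinearMap.coe_restrictScalars', h2, map_smul, smul_eq_mul]
  linear_combination (1 / 2 * fderiv ℂ T z (Pi.single j 1)) * Complex.I_mul_I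

lemma norm_fderiv_le_of_iteratedFDeriv_one {F : (Fin n → ℂ) → ℂ} (z : Fin n → ℂ) :
    ‖fderiv ℝ F z‖ = ‖iteratedFDeriv ℝ 1 F z‖ := by
  rw [← norm_iteratedFDeriv_fderiv, norm_iteratedFDeriv_zero]

/-- A continuous cutoff at distance `c⁻¹` from `Kc`. -/
noncomputable def roughCutoff (Kc : Set (Fin n → ℂ)) (c : ℝ) (w : Fin n → ℂ) : ℂ :=
  ((max 0 (min 1 (2 * (7 / 4 - c * infDist w Kc))) : ℝ) : ℂ)

/-- A smooth cutoff at distance `c⁻¹` from `Kc`. -/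
noncomputable def smoothCutoff (Kc : Set (Fin n → ℂ)) (c : ℝ) : (Fin n → ℂ) → ℂ :=
  mollify c (roughCutoff Kc c)

lemma continuous_roughCutoff (Kc : Set (Fin n → ℂ)) (c : ℝ) : Continuous (roughCutoff Kc c) := by
  have := continuous_infDist_pt Kc
  unfold roughCutoff
  fun_prop

lemma norm_roughCutoff_le (Kc : Set (Fin n → ℂ)) (c : ℝ) (w : Fin n → ℂ) :
    ‖roughCutoff Kc c w‖ ≤ 1 := by
  rw [roughCutoff, Complex.norm_real, Real.norm_of_nonneg (le_max_left _ _)]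
  exact max_le zero_le_one (min_le_left _ _)

lemma contDiff_smoothCutoff (Kc : Set (Fin n → ℂ)) (c : ℝ) :
    ContDiff ℝ (⊤ : ℕ∞) (smoothCutoff Kc c) :=
  contDiff_mollify (continuous_roughCutoff Kc c) c

lemma exists_norm_iteratedFDeriv_smoothCutoff_le (n k : ℕ) :
    ∃ A : ℝ, 0 < A ∧ ∀ (Kc : Set (Fin n → ℂ)) (c : ℝ) (z : Fin n → ℂ), 0 < c →
      ‖iteratedFDeriv ℝ k (smoothCutoff Kc c) z‖ ≤ c ^ k * A := by
  obtain ⟨A, hA, h⟩ := exists_norm_iteratedFDeriv_mollify_le n k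
  refine ⟨A, hA, fun Kc c z hc => ?_⟩
  simpa [smoothCutoff] using h _ (continuous_roughCutoff Kc c) c 1 z hc zero_le_one
    fun w _ => norm_roughCutoff_le Kc c w

lemma mul_infDist_near {Kc : Set (Fin n → ℂ)} {c : ℝ} (hc : 0 < c) {z w : Fin n → ℂ}
    (hw : w ∈ closedBall z (1 / (4 * c))) :
    c * infDist w Kc ≤ c * infDist z Kc + 1 / 4 ∧ c * infDist z Kc ≤ c * infDist w Kc + 1 / 4 := by
  have h3 : c * (1 / (4 * c)) = 1 / 4 := by field_simp
  have h4 : c * dist w z ≤ 1 / 4 := h3 ▸ mul_le_mul_of_nonneg_left (mem_closedBall.mp hw) hc.le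
  have h1 := mul_le_mul_of_nonneg_left (infDist_le_infDist_add_dist (s := Kc) (x := w) (y := z))
    hc.le
  have h2 := mul_le_mul_of_nonneg_left (infDist_le_infDist_add_dist (s := Kc) (x := z) (y := w))
    hc.le
  rw [dist_comm z w] at h2
  constructor <;> linarith

lemma smoothCutoff_eq_zero {Kc : Set (Fin n → ℂ)} {c : ℝ} (hc : 0 < c) {z : Fin n → ℂ}
    (hz : 2 ≤ c * infDist z Kc) : smoothCutoff Kc c z = 0 := by
  obtain ⟨A, hA, h⟩ := exists_norm_iteratedFDeriv_mollify_le n 0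
  have := h _ (continuous_roughCutoff Kc c) c 0 z hc le_rfl fun w hw => by
    have := (mul_infDist_near (Kc := Kc) hc hw).2
    rw [roughCutoff, max_eq_left ((min_le_right _ _).trans (by linarith))]
    simp
  simpa [smoothCutoff] using this

lemma smoothCutoff_eq_one {Kc : Set (Fin n → ℂ)} {c : ℝ} (hc : 0 < c) {z : Fin n → ℂ}
    (hz : c * infDist z Kc ≤ 1) : smoothCutoff Kc c z = 1 := by
  obtain ⟨A, hA, h⟩ := exists_norm_iteratedFDeriv_mollify_le n 0
  have hd : Differentiable ℂ fun _ : Fin n → ℂ => (1 : ℂ) := differentiable_const _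
  have := h (fun w => roughCutoff Kc c w - 1)
    ((continuous_roughCutoff Kc c).sub continuous_const) c 0 z hc le_rfl fun w hw => by
    have := (mul_infDist_near (Kc := Kc) hc hw).1
    rw [roughCutoff, min_eq_left (by linarith)]
    simp
  rw [norm_iteratedFDeriv_zero, mollify_sub (continuous_roughCutoff Kc c) continuous_const,
    mollify_of_differentiable hd hc.ne'] at this
  simpa [smoothCutoff, sub_eq_zero] using this

lemma smoothCutoff_eventuallyEq_zero {Kc : Set (Fin n → ℂ)} {c : ℝ} (hc : 0 < c) {z : Fin n → ℂ}
    (hz : 2 < c * infDist z Kc) : ∀ᶠ w in 𝓝 z, smoothCutoff Kc c w = 0 := by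
  filter_upwards [(continuous_const.mul (continuous_infDist_pt Kc)).continuousAt.eventually
    (lt_mem_nhds hz)] with w hw using smoothCutoff_eq_zero hc hw.le

lemma exists_norm_iteratedFDeriv_mollify_sub_le (n k : ℕ) :
    ∃ A : ℝ, 0 < A ∧ ∀ (F T : (Fin n → ℂ) → ℂ) (_ : Continuous F) (_ : Differentiable ℂ T)
      (c S : ℝ) (x z : Fin n → ℂ), 0 < c → 0 ≤ S → c * ‖z - x‖ ≤ 2 →
      (∀ ζ, c * ‖ζ - x‖ ≤ 3 → ‖F ζ - T ζ‖ ≤ S) →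
      ‖iteratedFDeriv ℝ k (fun w => mollify c F w - T w) z‖ ≤ c ^ k * (A * S) := by
  obtain ⟨A, hA, h⟩ := exists_norm_iteratedFDeriv_mollify_le n k
  refine ⟨A, hA, fun F T hF hT c S x z hc hS hz hFT => ?_⟩
  have h1 := h (fun w => F w - T w) (hF.sub hT.continuous) c S z hc hS fun w hw => by
    refine hFT w ?_
    have h3 : c * (1 / (4 * c)) = 1 / 4 := by field_simp
    have h4 : c * dist w z ≤ 1 / 4 := h3 ▸ mul_le_mul_of_nonneg_left (mem_closedBall.mp hw) hc.le
    have h5 := mul_le_mul_of_nonneg_left (norm_sub_le_norm_sub_add_norm_sub w z x) hc.le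
    rw [dist_eq_norm] at h4
    linarith
  have h2 : mollify c (fun w => F w - T w) = fun w => mollify c F w - T w := by
    ext w
    rw [mollify_sub hF hT.continuous, mollify_of_differentiable hT hc.ne']
  rwa [h2] at h1

/-- Data for the gluing: functions `F l` which, at distance `2⁻ˡ` from the compact set `Kc`, are
close to the entire functions `T x J` for `x ∈ Kc` and `J ≤ N l`. -/
structure GlueData (Kc : Set (Fin n → ℂ)) (F : ℕ → (Fin n → ℂ) → ℂ)
    (T : (Fin n → ℂ) → ℕ → (Fin n → ℂ) → ℂ) (N : ℕ → ℕ) (err : ℕ → ℕ → ℝ) (C : ℕ → ℝ)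
    (ω : ℕ → ℝ) (f : (Fin n → ℂ) → ℂ) : Prop where
  isCompact : IsCompact Kc
  nonempty : Kc.Nonempty
  continuous : ∀ l, Continuous (F l)
  differentiable : ∀ x ∈ Kc, ∀ J, Differentiable ℂ (T x J)
  contDiff : ∀ x ∈ Kc, ∀ J, ContDiff ℝ (⊤ : ℕ∞) (T x J)
  monotone : Monotone N
  tendsto : Tendsto N atTop atTop
  antitone_err : ∀ J, Antitone fun l => err l J
  norm_sub_le : ∀ l J, J ≤ N l → ∀ x ∈ Kc, ∀ ζ, 2 ^ l * ‖ζ - x‖ ≤ 3 → ‖F l ζ - T x J ζ‖ ≤ err l J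
  err_le : ∀ l J, J ≤ N l → err l J * (2 ^ l) ^ (J + 1) ≤ C J
  err_last_le : ∀ l, err l (N l) * 2 ^ l ≤ ω l
  antitone_weight : Antitone ω
  apply_self : ∀ x ∈ Kc, T x 0 x = f x

namespace GlueData

variable {Kc : Set (Fin n → ℂ)} {F : ℕ → (Fin n → ℂ) → ℂ}
    {T : (Fin n → ℂ) → ℕ → (Fin n → ℂ) → ℂ} {N : ℕ → ℕ} {err : ℕ → ℕ → ℝ} {C : ℕ → ℝ}
    {ω : ℕ → ℝ} {f : (Fin n → ℂ) → ℂ}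

/-- The terms of the telescoping series. -/
noncomputable def term (Kc : Set (Fin n → ℂ)) (F : ℕ → (Fin n → ℂ) → ℂ) (l : ℕ)
    (z : Fin n → ℂ) : ℂ :=
  smoothCutoff Kc (2 ^ (l + 1)) z * (mollify (2 ^ (l + 1)) (F (l + 1)) z - mollify (2 ^ l) (F l) z)

/-- The glued function. -/
noncomputable def glue (Kc : Set (Fin n → ℂ)) (F : ℕ → (Fin n → ℂ) → ℂ) (z : Fin n → ℂ) : ℂ :=
  smoothCutoff Kc 1 z * mollify 1 (F 0) z + ∑' l, term Kc F l z

lemma err_nonneg (D : GlueData Kc F T N err C ω f) {l J : ℕ} (hJ : J ≤ N l) : 0 ≤ err l J := by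
  obtain ⟨x, hx⟩ := D.nonempty
  exact (norm_nonneg _).trans (D.norm_sub_le l J hJ x hx x (by simp))

lemma contDiff_mollify_term (D : GlueData Kc F T N err C ω f) (l : ℕ) :
    ContDiff ℝ (⊤ : ℕ∞) (mollify (2 ^ l) (F l)) :=
  contDiff_mollify (D.continuous l) _

lemma contDiff_term (D : GlueData Kc F T N err C ω f) (l : ℕ) : ContDiff ℝ (⊤ : ℕ∞) (term Kc F l) :=
  (contDiff_smoothCutoff _ _).mul
    ((D.contDiff_mollify_term (l + 1)).sub (D.contDiff_mollify_term l))

lemma exists_nearest (D : GlueData Kc F T N err C ω f) (z : Fin n → ℂ) :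
    ∃ x ∈ Kc, ‖z - x‖ = infDist z Kc := by
  obtain ⟨x, hx, h⟩ := D.isCompact.exists_infDist_eq_dist D.nonempty z
  exact ⟨x, hx, by rw [h, dist_eq_norm]⟩

lemma exists_norm_iteratedFDeriv_sub_le (D : GlueData Kc F T N err C ω f) (k : ℕ) :
    ∃ A : ℝ, 0 < A ∧ ∀ l J, J ≤ N l → ∀ x ∈ Kc,
    ∀ z, 2 ^ l * ‖z - x‖ ≤ 2 →
      ‖iteratedFDeriv ℝ k (fun w => mollify (2 ^ l) (F l) w - T x J w) z‖ ≤
        (2 ^ l) ^ k * (A * err l J) := by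
  obtain ⟨A, hA, h⟩ := exists_norm_iteratedFDeriv_mollify_sub_le n k
  exact ⟨A, hA, fun l J hJ x hx z hz => h _ _ (D.continuous l) (D.differentiable x hx J) _ _ x z
    (by positivity) (D.err_nonneg hJ) hz (D.norm_sub_le l J hJ x hx)⟩

lemma exists_norm_iteratedFDeriv_term_le (D : GlueData Kc F T N err C ω f) (k : ℕ) :
    ∃ A : ℝ, 0 < A ∧ ∀ l J, J ≤ N l → ∀ z,
    ‖iteratedFDeriv ℝ k (term Kc F l) z‖ ≤ (2 ^ l) ^ k * (A * err l J) := by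
  choose A hA hA' using D.exists_norm_iteratedFDeriv_sub_le
  choose B hB hB' using exists_norm_iteratedFDeriv_smoothCutoff_le n
  set S := ∑ i ∈ Finset.range (k + 1), (k.choose i : ℝ) * B i * (2 * A (k - i)) with hS
  have hS0 : 0 < S := Finset.sum_pos (fun i hi => by
    have : 0 < k.choose i := Nat.choose_pos (Finset.mem_range_succ_iff.mp hi)
    have := hB i
    have := hA (k - i)
    positivity) ⟨0, by simp⟩
  refine ⟨2 ^ k * S, by positivity, fun l J hJ z => ?_⟩
  have herr := D.err_nonneg hJ
  by_cases hz : 2 ^ (l + 1) * infDist z Kc ≤ 2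
  · obtain ⟨x, hx, hzx⟩ := D.exists_nearest z
    have hdiff : ∀ i, ‖iteratedFDeriv ℝ i (fun w => mollify (2 ^ (l + 1)) (F (l + 1)) w -
        mollify (2 ^ l) (F l) w) z‖ ≤ (2 ^ (l + 1)) ^ i * (2 * A i * err l J) := by
      intro i
      have h1 := hA' i (l + 1) J (hJ.trans (D.monotone (Nat.le_succ l))) x hx z (hzx ▸ hz)
      have h2 := hA' i l J hJ x hx z (by
        rw [hzx]
        refine le_trans ?_ hz
        rw [pow_succ]
        nlinarith [infDist_nonneg (x := z) (s := Kc), pow_pos (two_pos (α := ℝ)) l])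
      have h3 := D.antitone_err J (Nat.le_succ l)
      have heq : (fun w => mollify (2 ^ (l + 1)) (F (l + 1)) w - mollify (2 ^ l) (F l) w) =
          (fun w => mollify (2 ^ (l + 1)) (F (l + 1)) w - T x J w) -
          fun w => mollify (2 ^ l) (F l) w - T x J w := by
        ext w; simp
      rw [heq, iteratedFDeriv_sub_apply
        (((D.contDiff_mollify_term (l + 1)).sub (D.contDiff x hx J)).of_le
          (WithTop.coe_le_coe.mpr le_top)).contDiffAt
        (((D.contDiff_mollify_term l).sub (D.contDiff x hx J)).of_le
          (WithTop.coe_le_coe.mpr le_top)).contDiffAt]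
      refine (_root_.norm_sub_le _ _).trans ?_
      have hAi := hA i
      have h4 : ((2 : ℝ) ^ (l + 1)) ^ i * (A i * err (l + 1) J) ≤
          (2 ^ (l + 1)) ^ i * (A i * err l J) := by gcongr
      have h5 : ((2 : ℝ) ^ l) ^ i * (A i * err l J) ≤ (2 ^ (l + 1)) ^ i * (A i * err l J) := by
        gcongr <;> norm_num
      linarith
    refine (norm_iteratedFDeriv_mul_le (contDiff_smoothCutoff Kc (2 ^ (l + 1)))
      ((D.contDiff_mollify_term (l + 1)).sub (D.contDiff_mollify_term l)) z
      (n := k) (WithTop.coe_le_coe.mpr le_top)).trans ?_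
    have : ((2 : ℝ) ^ l) ^ k * (2 ^ k * S * err l J) = ∑ i ∈ Finset.range (k + 1),
        (2 ^ (l + 1)) ^ k * ((k.choose i : ℝ) * B i * (2 * A (k - i)) * err l J) := by
      rw [← Finset.mul_sum, ← Finset.sum_mul, ← hS, pow_succ, mul_pow]
      ring
    rw [this]
    refine Finset.sum_le_sum fun i hi => ?_
    have hik : i ≤ k := Finset.mem_range_succ_iff.mp hi
    have h6 := hB' i Kc (2 ^ (l + 1)) z (by positivity)
    have hBi := hB i
    calc _ ≤ (k.choose i : ℝ) * ((2 ^ (l + 1)) ^ i * B i) *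
          ((2 ^ (l + 1)) ^ (k - i) * (2 * A (k - i) * err l J)) := by
            gcongr
            exact hdiff (k - i)
      _ = ((2 ^ (l + 1)) ^ i * (2 ^ (l + 1)) ^ (k - i)) *
          ((k.choose i : ℝ) * B i * (2 * A (k - i)) * err l J) := by ring
      _ = _ := by rw [← pow_add, Nat.add_sub_cancel' hik]
  · have h0 : term Kc F l =ᶠ[𝓝 z] fun _ => 0 := by
      filter_upwards [smoothCutoff_eventuallyEq_zero (by positivity) (not_le.mp hz)] with w hw
      rw [term, hw, zero_mul]
    rw [(h0.iteratedFDeriv ℝ k).self_of_nhds]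
    simp only [iteratedFDeriv_fun_zero, Pi.zero_apply, norm_zero]
    positivity

lemma term_eq_zero {l : ℕ} {z : Fin n → ℂ} (hz : 2 ≤ 2 ^ (l + 1) * infDist z Kc) :
    term Kc F l z = 0 := by
  rw [term, smoothCutoff_eq_zero (by positivity) hz, zero_mul]

lemma term_eq_sub {l : ℕ} {z : Fin n → ℂ} (hz : 2 ^ (l + 1) * infDist z Kc ≤ 1) :
    term Kc F l z = mollify (2 ^ (l + 1)) (F (l + 1)) z - mollify (2 ^ l) (F l) z := by
  rw [term, smoothCutoff_eq_one (by positivity) hz, one_mul]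

lemma glue_eq_zero {z : Fin n → ℂ} (hz : 2 ≤ infDist z Kc) : glue Kc F z = 0 := by
  have h : ∀ l, term Kc F l z = 0 := fun l => term_eq_zero (by
    have : (1 : ℝ) ≤ 2 ^ (l + 1) := one_le_pow₀ (by norm_num)
    nlinarith)
  simp [glue, h, smoothCutoff_eq_zero one_pos (by simpa using hz)]

lemma sum_range_term {L : ℕ} {z : Fin n → ℂ} (hz : 2 ^ L * infDist z Kc ≤ 1) :
    smoothCutoff Kc 1 z * mollify 1 (F 0) z + ∑ l ∈ Finset.range L, term Kc F l z =
      mollify (2 ^ L) (F L) z := by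
  have hle : ∀ l ≤ L, 2 ^ l * infDist z Kc ≤ 1 := fun l hl => by
    refine le_trans ?_ hz
    gcongr
    · exact infDist_nonneg
    · norm_num
  rw [smoothCutoff_eq_one one_pos (by simpa using hle 0 (Nat.zero_le _)), one_mul,
    Finset.sum_congr rfl fun l hl => term_eq_sub (hle (l + 1) (Finset.mem_range.mp hl)),
    Finset.sum_range_sub (fun l => mollify (2 ^ l) (F l) z)]
  simp

lemma glue_eq_of_near {l : ℕ} {z : Fin n → ℂ} (h1 : 2 ^ l * infDist z Kc ≤ 1)
    (h2 : 1 ≤ 2 ^ (l + 2) * infDist z Kc) :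
    glue Kc F z = mollify (2 ^ l) (F l) z + (term Kc F l z + term Kc F (l + 1) z) := by
  rw [glue, tsum_eq_sum (s := Finset.range (l + 2)) fun m hm => term_eq_zero ?_,
    Finset.sum_range_succ, Finset.sum_range_succ, ← sum_range_term h1]
  · ring
  · have hm : l + 2 ≤ m := by simpa using hm
    have : (2 : ℝ) ^ (l + 2) ≤ 2 ^ m := pow_le_pow_right₀ (by norm_num) hm
    have h3 := mul_le_mul_of_nonneg_right this (infDist_nonneg (x := z) (s := Kc))
    rw [pow_succ 2 m]
    linarith

lemma contDiff_glue (D : GlueData Kc F T N err C ω f) : ContDiff ℝ (⊤ : ℕ∞) (glue Kc F) := by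
  refine ((contDiff_smoothCutoff Kc 1).mul
    (contDiff_mollify (D.continuous 0) 1)).add ?_
  choose A hA hA' using D.exists_norm_iteratedFDeriv_term_le
  refine contDiff_tsum_of_eventually (v := fun k l => A k * C k * (1 / 2) ^ l) D.contDiff_term
    (fun k _ => (summable_geometric_of_lt_one (by norm_num) (by norm_num)).mul_left _) ?_
  intro k _
  rw [Nat.cofinite_eq_atTop]
  filter_upwards [D.tendsto.eventually_ge_atTop k] with l hl z
  refine (hA' k l k hl z).trans ?_
  have h1 := D.err_le l k hl
  have hAk := hA k
  have h2 : ((2 : ℝ) ^ l) ^ k * (A k * err l k) * 2 ^ l ≤ A k * C k := by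
    calc _ = A k * (err l k * (2 ^ l) ^ (k + 1)) := by ring
      _ ≤ _ := by gcongr
  rw [one_div, inv_pow, ← div_eq_mul_inv, le_div_iff₀ (by positivity)]
  exact h2

lemma hasCompactSupport_glue (D : GlueData Kc F T N err C ω f) : HasCompactSupport (glue Kc F) := by
  refine HasCompactSupport.intro (D.isCompact.cthickening (r := 2)) fun z hz => glue_eq_zero ?_
  by_contra! h
  exact hz (thickening_subset_cthickening 2 Kc ((mem_thickening_iff_infDist_lt D.nonempty).2 h))

lemma glue_apply (D : GlueData Kc F T N err C ω f) {x : Fin n → ℂ} (hx : x ∈ Kc) :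
    glue Kc F x = f x := by
  have h0 : infDist x Kc = 0 := infDist_zero_of_mem hx
  obtain ⟨A, hA, hA'⟩ := D.exists_norm_iteratedFDeriv_sub_le 0
  have herr : ∀ l, err l 0 ≤ C 0 * (1 / 2) ^ l := fun l => by
    have := D.err_le l 0 (Nat.zero_le _)
    rw [one_div, inv_pow, ← div_eq_mul_inv, le_div_iff₀ (by positivity)]
    simpa using this
  have hlim : Tendsto (fun l => mollify (2 ^ l) (F l) x) atTop (𝓝 (f x)) := by
    rw [tendsto_iff_norm_sub_tendsto_zero]
    refine squeeze_zero (g := fun l => A * (C 0 * (1 / 2) ^ l)) (fun _ => norm_nonneg _)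
      (fun l => ?_) ?_
    · have := hA' l 0 (Nat.zero_le _) x hx x (by simp)
      rw [norm_iteratedFDeriv_zero, D.apply_self x hx, pow_zero, one_mul] at this
      exact this.trans (mul_le_mul_of_nonneg_left (herr l) hA.le)
    · have := tendsto_pow_atTop_nhds_zero_of_lt_one (r := (1 / 2 : ℝ)) (by norm_num) (by norm_num)
      simpa using (this.const_mul (C 0)).const_mul A
  have hsum : Summable fun l => term Kc F l x := by
    obtain ⟨B, hB, hB'⟩ := D.exists_norm_iteratedFDeriv_term_le 0
    refine Summable.of_norm_bounded (g := fun l => B * (C 0 * (1 / 2) ^ l))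
      (((summable_geometric_of_lt_one (by norm_num) (by norm_num)).mul_left _).mul_left _) ?_
    intro l
    have := hB' l 0 (Nat.zero_le _) x
    rw [norm_iteratedFDeriv_zero, pow_zero, one_mul] at this
    exact this.trans (mul_le_mul_of_nonneg_left (herr l) hB.le)
  have h1 := (hsum.hasSum.tendsto_sum_nat).const_add (smoothCutoff Kc 1 x * mollify 1 (F 0) x)
  refine tendsto_nhds_unique h1 (hlim.congr fun L => ?_)
  rw [sum_range_term (by simp [h0])]

lemma exists_norm_dbar_glue_le (D : GlueData Kc F T N err C ω f) :
    ∃ A : ℝ, 0 < A ∧ ∀ l z, 2 ^ (l + 1) * infDist z Kc ≤ 1 →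
    1 < 2 ^ (l + 2) * infDist z Kc → ∀ j, ‖dbar j (glue Kc F) z‖ ≤ A * ω l := by
  obtain ⟨A, hA, hA'⟩ := D.exists_norm_iteratedFDeriv_sub_le 1
  obtain ⟨B, hB, hB'⟩ := D.exists_norm_iteratedFDeriv_term_le 1
  refine ⟨A + (B + B), by positivity, fun l z h1 h2 j => ?_⟩
  obtain ⟨x, hx, hzx⟩ := D.exists_nearest z
  have hd := infDist_nonneg (x := z) (s := Kc)
  have hpos : (0 : ℝ) < 2 ^ l := by positivity
  have h3 : 2 ^ l * infDist z Kc < 1 := by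
    rcases hd.eq_or_lt with h | h
    · simp [← h]
    · rw [pow_succ] at h1
      nlinarith [mul_pos hpos h]
  set H : (Fin n → ℂ) → ℂ := fun w => mollify (2 ^ l) (F l) w - T x (N l) w
  have hHd : ContDiff ℝ (⊤ : ℕ∞) H := (D.contDiff_mollify_term l).sub (D.contDiff x hx (N l))
  have hcont : ∀ m : ℕ, Continuous fun w => (2 : ℝ) ^ m * infDist w Kc := fun m =>
    continuous_const.mul (continuous_infDist_pt Kc)
  have heq : glue Kc F =ᶠ[𝓝 z] fun w => T x (N l) w + (H w +
      (term Kc F l w + term Kc F (l + 1) w)) := by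
    filter_upwards [(hcont l).continuousAt.eventually (gt_mem_nhds h3),
      (hcont (l + 2)).continuousAt.eventually (lt_mem_nhds h2)] with w hw1 hw2
    rw [glue_eq_of_near hw1.le hw2.le]
    simp only [H]
    ring
  have hdi : ∀ {G : (Fin n → ℂ) → ℂ}, ContDiff ℝ (⊤ : ℕ∞) G → DifferentiableAt ℝ G z :=
    fun hG => (hG.differentiable (by simp)) z
  have ht := D.contDiff_term
  have hdb : dbar j (glue Kc F) z = dbar j H z + (dbar j (term Kc F l) z +
      dbar j (term Kc F (l + 1)) z) := by
    have : dbar j (glue Kc F) z = dbar j (fun w => T x (N l) w + (H w +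
      (term Kc F l w + term Kc F (l + 1) w))) z := by
      simp only [dbar, heq.fderiv_eq]
    rw [this, dbar_add (hdi (D.contDiff x hx (N l))) (hdi (hHd.add ((ht l).add (ht (l + 1))))),
      dbar_add (hdi hHd) (hdi ((ht l).add (ht (l + 1)))), dbar_add (hdi (ht l)) (hdi (ht (l + 1))),
      dbar_of_differentiable (D.differentiable x hx (N l)), zero_add]
  have hω := D.err_last_le
  have b1 : ‖dbar j H z‖ ≤ A * ω l := by
    refine (norm_dbar_le _ _ _).trans ?_
    rw [norm_fderiv_le_of_iteratedFDeriv_one]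
    refine (hA' l (N l) le_rfl x hx z (by rw [hzx]; linarith)).trans ?_
    nlinarith [hω l]
  have b2 : ∀ m, ‖dbar j (term Kc F m) z‖ ≤ B * ω m := by
    intro m
    refine (norm_dbar_le _ _ _).trans ?_
    rw [norm_fderiv_le_of_iteratedFDeriv_one]
    refine (hB' m (N m) le_rfl z).trans ?_
    nlinarith [hω m]
  have b3 : B * ω (l + 1) ≤ B * ω l :=
    mul_le_mul_of_nonneg_left (D.antitone_weight (Nat.le_succ l)) hB.le
  rw [hdb]
  refine (norm_add_le _ _).trans ?_
  have := norm_add_le (dbar j (term Kc F l) z) (dbar j (term Kc F (l + 1)) z)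
  have b4 := b2 l
  have b5 := b2 (l + 1)
  linarith

end GlueData
end Glue

section Extension

open Metric

variable {n : ℕ} {K : Set (Fin n → ℝ)}

/-- The real part of a complex vector. -/
def reVec (z : Fin n → ℂ) : Fin n → ℝ := fun j => (z j).re

lemma continuous_reVec : Continuous (reVec (n := n)) :=
  continuous_pi fun j => Complex.continuous_re.comp (continuous_apply j)

@[simp] lemma reVec_embRC (x : Fin n → ℝ) : reVec (embRC x) = x := by
  funext j; simp [reVec, embRC]

lemma norm_reVec_sub_le (z : Fin n → ℂ) (y : Fin n → ℝ) : ‖reVec z - y‖ ≤ ‖z - embRC y‖ := by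
  refine (pi_norm_le_iff_of_nonneg (norm_nonneg _)).2 fun j => ?_
  have h1 : (reVec z - y) j = ((z - embRC y) j).re := by simp [reVec, embRC]
  rw [h1]
  exact (Complex.abs_re_le_norm _).trans (norm_le_pi_norm _ j)

/-- A continuous quasi-projection from `ℂⁿ` onto a convex body of `ℝⁿ`. -/
lemma exists_quasiProjection (hK : IsCompact K) (hconv : Convex ℝ K)
    (hint : (interior K).Nonempty) :
    ∃ p : (Fin n → ℂ) → (Fin n → ℝ), Continuous p ∧ (∀ z, p z ∈ K) ∧
      ∃ c : ℝ, 1 ≤ c ∧ ∀ z, ‖z - embRC (p z)‖ ≤ c * infDist z (embRC '' K) := by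
  obtain ⟨x₀, hx₀⟩ := hint
  obtain ⟨r, hr, hball⟩ := nhds_basis_closedBall.mem_iff.mp (mem_interior_iff_mem_nhds.mp hx₀)
  have hne : (embRC '' K).Nonempty := ⟨_, x₀, interior_subset hx₀, rfl⟩
  obtain ⟨R, hR⟩ := hK.isBounded.subset_closedBall x₀
  have hd : Continuous fun z : Fin n → ℂ => infDist z (embRC '' K) := continuous_infDist_pt _
  have key : ∀ z : Fin n → ℂ, ∃ y ∈ K, ‖z - embRC y‖ = infDist z (embRC '' K) := by
    intro z
    obtain ⟨_, ⟨y, hy, rfl⟩, h⟩ :=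
      (hK.image continuous_embRC).exists_infDist_eq_dist hne z
    exact ⟨y, hy, by rw [h, dist_eq_norm]⟩
  refine ⟨fun z => x₀ + (r / (r + infDist z (embRC '' K))) • (reVec z - x₀), ?_, ?_,
    2 + |R| / r, by have : 0 ≤ |R| / r := by positivity
                    linarith, ?_⟩
  · have hsub : Continuous fun z : Fin n → ℂ => reVec z - x₀ :=
        continuous_reVec.sub continuous_const
    refine continuous_const.add (Continuous.fun_smul ?_ hsub)
    exact continuous_const.div (continuous_const.add hd) fun z =>
      (add_pos_of_pos_of_nonneg hr infDist_nonneg).ne'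
  · intro z
    obtain ⟨y, hy, hyz⟩ := key z
    simp only
    rw [← hyz]
    set d := ‖z - embRC y‖
    have hd0 : 0 ≤ d := norm_nonneg _
    have hay : ‖reVec z - y‖ ≤ d := norm_reVec_sub_le z y
    rcases hd0.eq_or_lt with h0 | h0
    · rw [← h0] at hay ⊢
      have : reVec z = y := by simpa [sub_eq_zero] using hay
      simpa [this, hr.ne'] using hy
    · have hq : x₀ + (r / d) • (reVec z - y) ∈ K := by
        refine hball ?_
        rw [mem_closedBall, dist_eq_norm, add_sub_cancel_left, norm_smul, Real.norm_of_nonneg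
          (by positivity)]
        calc r / d * ‖reVec z - y‖ ≤ r / d * d := by gcongr
          _ = r := by field_simp
      have := hconv hy hq (a := r / (r + d)) (b := d / (r + d)) (by positivity) (by positivity)
        (by field_simp)
      convert this using 1
      funext j
      simp only [Pi.add_apply, Pi.smul_apply, Pi.sub_apply, smul_eq_mul]
      field_simp
      ring
  · intro z
    obtain ⟨y, hy, hyz⟩ := key z
    simp only
    rw [← hyz]
    set d := ‖z - embRC y‖
    have hd0 : 0 ≤ d := norm_nonneg _
    have hay : ‖reVec z - y‖ ≤ d := norm_reVec_sub_le z y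
    have hyx : ‖y - x₀‖ ≤ |R| := by
      rw [← dist_eq_norm]; exact (mem_closedBall.mp (hR hy)).trans (le_abs_self R)
    set q := x₀ + (r / (r + d)) • (reVec z - x₀)
    have h1 : y - q = (d / (r + d)) • (y - x₀) - (r / (r + d)) • (reVec z - y) := by
      funext j
      simp only [q, Pi.add_apply, Pi.smul_apply, Pi.sub_apply, smul_eq_mul]
      field_simp
      ring
    have h2 : ‖y - q‖ ≤ |R| / r * d + d := by
      rw [h1]
      refine (norm_sub_le _ _).trans (add_le_add ?_ ?_)
      · rw [norm_smul, Real.norm_of_nonneg (by positivity)]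
        calc d / (r + d) * ‖y - x₀‖ ≤ d / r * |R| := by gcongr; linarith
          _ = |R| / r * d := by ring
      · rw [norm_smul, Real.norm_of_nonneg (by positivity)]
        calc r / (r + d) * ‖reVec z - y‖ ≤ 1 * d := by
              gcongr
              exact (div_le_one (by positivity)).2 (by linarith)
          _ = d := one_mul d
    calc ‖z - embRC q‖ ≤ ‖z - embRC y‖ + ‖embRC y - embRC q‖ := norm_sub_le_norm_sub_add_norm_sub ..
      _ ≤ d + (|R| / r * d + d) := by
          rw [← embRC_sub, norm_embRC]
          gcongr
      _ = (2 + |R| / r) * d := by ring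

lemma sum_Ico_le_two_mul {a : ℕ → ℝ} {J N : ℕ} (ha : ∀ k, 0 ≤ a k)
    (h : ∀ k, J ≤ k → k < N → a (k + 1) ≤ a k / 2) :
    ∑ k ∈ Finset.Ico J (N + 1), a k ≤ 2 * a J := by
  rcases le_or_gt J N with hJ | hJ
  · have : ∑ k ∈ Finset.Ico J (N + 1), a k ≤ 2 * a J - a N := by
      induction N, hJ using Nat.le_induction with
      | base => simp; linarith
      | succ N hN ih =>
        rw [Finset.sum_Ico_succ_top (by omega)]
        have h1 := ih fun k h1 h2 => h k h1 (by omega)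
        have h2 := h N hN (Nat.lt_succ_self N)
        linarith
    linarith [ha N]
  · rw [Finset.Ico_eq_empty (by omega), Finset.sum_empty]
    linarith [ha J]

variable {g : (Fin n → ℝ) → ℂ} {M : ℕ → ℝ} {C h : ℝ}

lemma norm_taylorHom_div_factorial_le (hM : IsRegularWeightSeq M) (hg : ContDiff ℝ (⊤ : ℕ∞) g)
    {y : Fin n → ℝ} (hb : ∀ k, ‖iteratedFDeriv ℝ k g y‖ ≤ C * h ^ k * M k)
    {w : Fin n → ℂ} {R : ℝ} (hw : ‖w‖ ≤ R) (k : ℕ) :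
    ‖taylorHom k g y w / (k.factorial : ℂ)‖ ≤ C * ((n * R * h) ^ k * mseq M k) := by
  have hR : 0 ≤ R := (norm_nonneg _).trans hw
  have hk : (0 : ℝ) < k.factorial := by positivity
  rw [norm_div, Complex.norm_natCast, div_le_iff₀ hk]
  have hMk := (hM.pos k).le
  calc _ ≤ (n * ‖w‖) ^ k * ‖iteratedFDeriv ℝ k g y‖ := norm_taylorHom_le hg k y w
    _ ≤ (n * R) ^ k * (C * h ^ k * M k) := by gcongr; exact hb k
    _ = _ := by rw [IsRegularWeightSeq.eq_factorial_mul M k, mul_pow (n * R) h]; ring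

/-- Comparison of Taylor polynomials at different base points and of different orders. -/
lemma norm_taylorPoly_sub_taylorPoly_le (hM : IsRegularWeightSeq M) (hconv : Convex ℝ K)
    (hg : ContDiff ℝ (⊤ : ℕ∞) g) (hC : 0 ≤ C) (hh : 0 ≤ h)
    (hb : ∀ k, ∀ x ∈ K, ‖iteratedFDeriv ℝ k g x‖ ≤ C * h ^ k * M k)
    {x y : Fin n → ℝ} (hx : x ∈ K) (hy : y ∈ K) {z : Fin n → ℂ} {R q : ℝ}
    (hxz : ‖z - embRC x‖ ≤ R) (hyz : ‖z - embRC y‖ ≤ R) (hq : 4 * (n + 1) * R * h ≤ q) {J N : ℕ}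
    (hJN : J ≤ N) (hN : ∀ k < N, q * mseq M (k + 1) ≤ mseq M k / 2) :
    ‖taylorPoly N g y z - taylorPoly J g x z‖ ≤ 3 * C * (q ^ (J + 1) * mseq M (J + 1)) := by
  have hR : 0 ≤ R := (norm_nonneg _).trans hxz
  have hq0 : 0 ≤ q := le_trans (by positivity) hq
  have hm := fun k => (hM.mseq_pos k).le
  have h1 : ‖taylorPoly N g y z - taylorPoly J g y z‖ ≤
      2 * C * (q ^ (J + 1) * mseq M (J + 1)) := by
    have e : taylorPoly N g y z - taylorPoly J g y z = ∑ k ∈ Finset.Ico (J + 1) (N + 1),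
        taylorHom k g y (z - embRC y) / (k.factorial : ℂ) := by
      rw [taylorPoly, taylorPoly, Finset.sum_Ico_eq_sub _ (by omega)]
    rw [e]
    have h3 : ∀ k ∈ Finset.Ico (J + 1) (N + 1),
        ‖taylorHom k g y (z - embRC y) / (k.factorial : ℂ)‖ ≤ C * (q ^ k * mseq M k) := by
      intro k _
      refine (norm_taylorHom_div_factorial_le hM hg (fun k => hb k y hy) hyz k).trans ?_
      have := hm k
      gcongr
      refine le_trans ?_ hq
      have : 0 ≤ R * h := by positivity
      nlinarith [mul_nonneg (Nat.cast_nonneg (α := ℝ) n) this]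
    refine (norm_sum_le_of_le _ h3).trans ?_
    rw [← Finset.mul_sum]
    have h4 := sum_Ico_le_two_mul (a := fun k => q ^ k * mseq M k) (J := J + 1) (N := N)
      (fun k => mul_nonneg (pow_nonneg hq0 k) (hm k)) fun k _ hk => by
        have := mul_le_mul_of_nonneg_left (hN k hk) (pow_nonneg hq0 k)
        calc q ^ (k + 1) * mseq M (k + 1) = q ^ k * (q * mseq M (k + 1)) := by ring
          _ ≤ _ := this
          _ = _ := by ring
    calc _ ≤ C * (2 * (q ^ (J + 1) * mseq M (J + 1))) := by gcongr
      _ = _ := by ring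
  have h2 : ‖taylorPoly J g y z - taylorPoly J g x z‖ ≤ C * (q ^ (J + 1) * mseq M (J + 1)) := by
    have hseg : ∀ s ∈ Set.Icc (0 : ℝ) 1, x + s • (y - x) ∈ K := fun s hs =>
      hconv.add_smul_sub_mem hx hy hs
    refine (norm_taylorPoly_sub_center_le hg J (R := R) (S := C * h ^ (J + 1) * M (J + 1)) ?_
      fun s hs => hb _ _ (hseg s hs)).trans ?_
    · intro s hs
      have e : z - embRC (x + s • (y - x)) =
          ((1 - s : ℝ) : ℂ) • (z - embRC x) + (s : ℂ) • (z - embRC y) := by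
        funext j
        simp only [embRC, Pi.sub_apply, Pi.add_apply, Pi.smul_apply, smul_eq_mul]
        push_cast
        ring
      rw [e]
      refine (norm_add_le _ _).trans ?_
      rw [norm_smul, norm_smul, Complex.norm_real, Complex.norm_real,
        Real.norm_of_nonneg (sub_nonneg.2 hs.2), Real.norm_of_nonneg hs.1]
      nlinarith [hs.1, hs.2]
    · have hyx : ‖y - x‖ ≤ 2 * R := by
        rw [← norm_embRC, embRC_sub]
        have : embRC y - embRC x = (z - embRC x) - (z - embRC y) := by abel
        rw [this]
        exact (norm_sub_le _ _).trans (by linarith)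
      have hJ : (0 : ℝ) < J.factorial := by positivity
      have hMJ := hM.pos (J + 1)
      have hmJ := hm (J + 1)
      rw [div_le_iff₀ hJ]
      have hp : ((J : ℝ) + 1) ≤ 2 ^ (J + 1) := by
        have : J + 1 < 2 ^ (J + 1) := Nat.lt_two_pow_self
        exact_mod_cast this.le
      calc _ ≤ ((n + 1) * R) ^ J * (2 * R * (C * h ^ (J + 1) * M (J + 1))) := by
            gcongr; linarith
        _ ≤ ((n + 1) * R) ^ J * (2 * R * (C * h ^ (J + 1) * M (J + 1))) * ((n + 1) * 2 ^ J) := by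
            refine le_mul_of_one_le_right (by positivity) ?_
            exact one_le_mul_of_one_le_of_one_le (by simp) (one_le_pow₀ (by norm_num))
        _ = C * ((2 * (n + 1) * R * h) ^ (J + 1) * mseq M (J + 1)) * ((J + 1) * J.factorial) := by
            rw [IsRegularWeightSeq.eq_factorial_mul M (J + 1), Nat.factorial_succ,
              show (2 * (n + 1) * R * h : ℝ) = 2 * ((n + 1) * R) * h by ring,
              mul_pow (2 * ((n + 1) * R)) h, mul_pow 2 ((n + 1) * R)]
            push_cast
            ring
        _ ≤ C * ((2 * (n + 1) * R * h) ^ (J + 1) * mseq M (J + 1)) *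
            (2 ^ (J + 1) * J.factorial) := by gcongr
        _ = C * ((4 * (n + 1) * R * h) ^ (J + 1) * mseq M (J + 1)) * J.factorial := by
            rw [show (4 * (n + 1) * R * h : ℝ) = 2 * (2 * (n + 1) * R * h) by ring,
              mul_pow 2 (2 * (n + 1) * R * h)]
            ring
        _ ≤ _ := by gcongr
  calc _ ≤ ‖taylorPoly N g y z - taylorPoly J g y z‖ + ‖taylorPoly J g y z - taylorPoly J g x z‖ :=
        norm_sub_le_norm_sub_add_norm_sub ..
    _ ≤ _ := by linarith

/-- The Taylor polynomials of `g` provide gluing data. -/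
lemma exists_glueData (hM : IsRegularWeightSeq M) (hK : IsCompact K) (hconv : Convex ℝ K)
    (hint : (interior K).Nonempty) (hg : ContDiff ℝ (⊤ : ℕ∞) g) (hC : 0 < C) (hh : 0 < h)
    (hb : ∀ k, ∀ x ∈ K, ‖iteratedFDeriv ℝ k g x‖ ≤ C * h ^ k * M k) :
    ∃ (B S : ℝ) (F : ℕ → (Fin n → ℂ) → ℂ) (T : (Fin n → ℂ) → ℕ → (Fin n → ℂ) → ℂ) (N : ℕ → ℕ)
      (err : ℕ → ℕ → ℝ) (D : ℕ → ℝ), 0 < B ∧ 0 < S ∧ GlueData (embRC '' K) F T N err D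
        (fun l => S * weight_h M (B * (1 / 2) ^ l)) (fun z => g (reVec z)) := by
  obtain ⟨p, hp, hpK, c, hc1, hc⟩ := exists_quasiProjection hK hconv hint
  obtain ⟨A, hA1, hA⟩ := hM.exists_mseq_succ_le
  set H : ℝ := 4 * (n + 1) * (3 * c) * h with hH
  have hHpos : 0 < H := by positivity
  set B : ℝ := 2 * H * A with hB
  have hBpos : 0 < B := by positivity
  have hδ : ∀ l : ℕ, (0 : ℝ) < (1 / 2) ^ l := fun l => by positivity
  have hδ2 : ∀ l : ℕ, (2 : ℝ) ^ l * (1 / 2) ^ l = 1 := fun l => by rw [← mul_pow]; norm_num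
  have hδanti : Antitone fun l : ℕ => (1 / 2 : ℝ) ^ l := fun a b hab =>
    pow_le_pow_of_le_one (by norm_num) (by norm_num) hab
  have hm := fun k => (hM.mseq_pos k).le
  refine ⟨B, 3 * C * H, fun l z => taylorPoly (optOrder M (B * (1 / 2) ^ l)) g (p z) z,
    fun x J => taylorPoly J g (reVec x), fun l => optOrder M (B * (1 / 2) ^ l),
    fun l J => 3 * C * ((H * (1 / 2) ^ l) ^ (J + 1) * mseq M (J + 1)),
    fun J => 3 * C * (H ^ (J + 1) * mseq M (J + 1)), hBpos, by positivity, ?_⟩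
  constructor
  · exact hK.image continuous_embRC
  · exact (hint.mono interior_subset).image _
  · intro l
    exact (continuous_taylorPoly hg _).comp (hp.prodMk continuous_id)
  · intro x _ J
    exact differentiable_taylorPoly g J _
  · intro x _ J
    exact (contDiff_taylorPoly g J _).restrict_scalars ℝ
  · intro a b hab
    exact hM.optOrder_anti (mul_pos hBpos (hδ b)) (mul_le_mul_of_nonneg_left (hδanti hab) hBpos.le)
  · refine tendsto_atTop.2 fun J => ?_
    have h1 : Tendsto (fun l : ℕ => B * (1 / 2 : ℝ) ^ l) atTop (𝓝[>] 0) := by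
      refine tendsto_nhdsWithin_iff.2 ⟨?_, Eventually.of_forall fun l => mul_pos hBpos (hδ l)⟩
      simpa using (tendsto_pow_atTop_nhds_zero_of_lt_one (r := (1 / 2 : ℝ)) (by norm_num)
        (by norm_num)).const_mul B
    exact h1.eventually (hM.eventually_le_optOrder J)
  · intro J a b hab
    have := hm (J + 1)
    have := hδanti hab
    have := hδ b
    change 3 * C * ((H * (1 / 2) ^ b) ^ (J + 1) * mseq M (J + 1)) ≤
      3 * C * ((H * (1 / 2) ^ a) ^ (J + 1) * mseq M (J + 1))
    gcongr 3 * C * ((H * ?_) ^ (J + 1) * mseq M (J + 1))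
  · rintro l J hJ _ ⟨x, hx, rfl⟩ z hz
    rw [reVec_embRC]
    have hz' : ‖z - embRC x‖ ≤ 3 * (1 / 2) ^ l := by
      have := mul_le_mul_of_nonneg_right hz (hδ l).le
      calc _ = ‖z - embRC x‖ * (2 ^ l * (1 / 2) ^ l) := by rw [hδ2, mul_one]
        _ = 2 ^ l * ‖z - embRC x‖ * (1 / 2) ^ l := by ring
        _ ≤ _ := this
    have hd : infDist z (embRC '' K) ≤ 3 * (1 / 2) ^ l :=
      (infDist_le_dist_of_mem (Set.mem_image_of_mem _ hx)).trans (by rwa [dist_eq_norm])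
    refine norm_taylorPoly_sub_taylorPoly_le hM hconv hg hC.le hh.le hb hx (hpK z)
      (R := 3 * c * (1 / 2) ^ l) ?_ ?_ ?_ hJ ?_
    · refine hz'.trans ?_
      have := hδ l
      nlinarith
    · refine (hc z).trans ?_
      calc c * infDist z (embRC '' K) ≤ c * (3 * (1 / 2) ^ l) := by gcongr
        _ = _ := by ring
    · rw [hH]
      exact le_of_eq (by ring)
    · intro k hk
      have h1 := IsRegularWeightSeq.mul_succ_le_of_lt_optOrder hk
      have h2 : 2 * (H * (1 / 2) ^ l) ≤ B * (1 / 2) ^ l := by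
        rw [hB]
        have : 0 < H * (1 / 2) ^ l := mul_pos hHpos (hδ l)
        nlinarith
      have h3 := mul_le_mul_of_nonneg_right h2 (hm (k + 1))
      linarith
  · intro l J _
    rw [mul_pow, ← sub_nonneg]
    have : ((1 / 2 : ℝ) ^ l) ^ (J + 1) * (2 ^ l) ^ (J + 1) = 1 := by
      rw [← mul_pow, mul_comm, hδ2, one_pow]
    have e : 3 * C * (H ^ (J + 1) * mseq M (J + 1)) - 3 * C * (H ^ (J + 1) *
        ((1 / 2 : ℝ) ^ l) ^ (J + 1) * mseq M (J + 1)) * (2 ^ l) ^ (J + 1) =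
        3 * C * (H ^ (J + 1) * mseq M (J + 1)) *
          (1 - ((1 / 2 : ℝ) ^ l) ^ (J + 1) * (2 ^ l) ^ (J + 1)) := by ring
    rw [e, this]
    simp
  · intro l
    set N := optOrder M (B * (1 / 2) ^ l)
    have h1 : (B * (1 / 2) ^ l) ^ N * mseq M N ≤ weight_h M (B * (1 / 2) ^ l) :=
      hM.pow_optOrder_mul_le (mul_pos hBpos (hδ l))
    have hHB : H * (1 / 2) ^ l * A ≤ B * (1 / 2) ^ l := by
      rw [hB]
      have : 0 < H * (1 / 2) ^ l * A := by have := hδ l; positivity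
      nlinarith
    have hmN := hm N
    have hδl := hδ l
    calc _ = 3 * C * H * ((H * (1 / 2) ^ l) ^ N * mseq M (N + 1)) * (2 ^ l * (1 / 2) ^ l) := by ring
      _ ≤ 3 * C * H * ((H * (1 / 2) ^ l) ^ N * (A ^ N * mseq M N)) * 1 := by
          rw [hδ2]
          gcongr
          exact hA N
      _ = 3 * C * H * ((H * (1 / 2) ^ l * A) ^ N * mseq M N) := by rw [mul_pow (_ * _) A]; ring
      _ ≤ 3 * C * H * ((B * (1 / 2) ^ l) ^ N * mseq M N) := by gcongr
      _ ≤ _ := by gcongr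
  · intro a b hab
    have := hM.weight_h_mono (mul_pos hBpos (hδ b)).le
      (mul_le_mul_of_nonneg_left (hδanti hab) hBpos.le)
    simp only
    gcongr
  · rintro _ ⟨x, hx, rfl⟩
    simp [taylorPoly, taylorHom]

/-- A function with Denjoy–Carleman bounds on a convex body has an almost-analytic extension. -/
theorem exists_almostAnalytic_extension (hM : IsRegularWeightSeq M) (hK : IsCompact K)
    (hconv : Convex ℝ K) (hint : (interior K).Nonempty) (hg : ContDiff ℝ (⊤ : ℕ∞) g)
    (hC : 0 < C) (hh : 0 < h)
    (hb : ∀ k, ∀ x ∈ K, ‖iteratedFDeriv ℝ k g x‖ ≤ C * h ^ k * M k) :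
    ∃ F : (Fin n → ℂ) → ℂ, ContDiff ℝ (⊤ : ℕ∞) F ∧ HasCompactSupport F ∧
      (∀ x ∈ K, F (embRC x) = g x) ∧
      ∃ C > 0, ∃ Q > 0, ∀ z : Fin n → ℂ, z ∉ embRC '' K → ∀ j : Fin n,
        ‖dbar j F z‖ ≤ C * weight_h M (Q * infDist z (embRC '' K)) := by
  obtain ⟨B, S, F, T, N, err, D, hB, hS, G⟩ := exists_glueData hM hK hconv hint hg hC hh hb
  refine ⟨_, G.contDiff_glue, G.hasCompactSupport_glue, fun x hx => by
    rw [G.glue_apply (Set.mem_image_of_mem _ hx), reVec_embRC], ?_⟩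
  obtain ⟨A, hA, hA'⟩ := G.exists_norm_dbar_glue_le
  obtain ⟨L, hL⟩ := (G.hasCompactSupport_glue.fderiv (𝕜 := ℝ)).exists_bound_of_continuous
    (G.contDiff_glue.continuous_fderiv (by simp))
  have hL0 : 0 ≤ L := (norm_nonneg _).trans (hL 0)
  have hw : 0 < weight_h M (2 * B) := hM.weight_h_pos (by positivity)
  refine ⟨A * S + L / weight_h M (2 * B), by positivity, 4 * B, by positivity, fun z hz j => ?_⟩
  set d := infDist z (embRC '' K) with hd
  have hdpos : 0 < d :=
    ((hK.image continuous_embRC).isClosed.notMem_iff_infDist_pos G.nonempty).1 hz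
  have hw' := (hM.weight_h_pos (by positivity : 0 < 4 * B * d)).le
  rcases le_or_gt d (1 / 2) with h1 | h1
  · obtain ⟨m, hm1, hm2⟩ := exists_nat_pow_near_of_lt_one hdpos (by linarith)
      (by norm_num : (0 : ℝ) < 1 / 2) (by norm_num)
    have hm0 : m ≠ 0 := by
      rintro rfl
      simp at hm1
      linarith
    obtain ⟨l, rfl⟩ := Nat.exists_eq_succ_of_ne_zero hm0
    have e : ∀ l : ℕ, (2 : ℝ) ^ l * (1 / 2) ^ l = 1 := fun l => by rw [← mul_pow]; norm_num
    have h2 : 2 ^ (l + 1) * d ≤ 1 := by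
      rw [← e (l + 1)]; gcongr
    have h3 : 1 < 2 ^ (l + 2) * d := by
      rw [← e (l + 2)]; gcongr
    refine (hA' l z h2 h3 j).trans ?_
    have h4 : weight_h M (B * (1 / 2) ^ l) ≤ weight_h M (4 * B * d) := by
      refine hM.weight_h_mono (by positivity) ?_
      have : (1 / 2 : ℝ) ^ l = 4 * (1 / 2) ^ (l + 2) := by
        rw [pow_add]; ring
      rw [this]
      have h5 : (1 / 2 : ℝ) ^ (l + 2) < d := hm1
      calc B * (4 * (1 / 2) ^ (l + 2)) ≤ B * (4 * d) := by gcongr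
        _ = 4 * B * d := by ring
    have h6 : 0 ≤ L / weight_h M (2 * B) := by positivity
    calc A * (S * weight_h M (B * (1 / 2) ^ l)) ≤ A * (S * weight_h M (4 * B * d)) := by gcongr
      _ ≤ _ := by nlinarith
  · have h2 : weight_h M (2 * B) ≤ weight_h M (4 * B * d) :=
      hM.weight_h_mono (by positivity) (by nlinarith)
    refine (norm_dbar_le j _ z).trans ((hL z).trans ?_)
    calc L = L / weight_h M (2 * B) * weight_h M (2 * B) := by field_simp
      _ ≤ L / weight_h M (2 * B) * weight_h M (4 * B * d) := by gcongr
      _ ≤ _ := by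
        have : 0 ≤ A * S * weight_h M (4 * B * d) := by positivity
        linarith

end Extension

section CauchyPompeiu

open MeasureTheory

/-- The one-dimensional operator `∂̄`. -/
noncomputable def wirtinger (G : ℂ → ℂ) (w : ℂ) : ℂ :=
  (1 / 2) * (fderiv ℝ G w 1 + Complex.I * fderiv ℝ G w Complex.I)

lemma continuous_wirtinger {G : ℂ → ℂ} (hG : ContDiff ℝ 1 G) : Continuous (wirtinger G) := by
  have h := hG.continuous_fderiv one_ne_zero
  unfold wirtinger
  fun_prop

lemma wirtinger_mul_exp (G : ℂ → ℂ) (w : ℂ) (θ : ℝ) :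
    2 * wirtinger G w = (fderiv ℝ G w (Complex.exp (θ * Complex.I)) +
      Complex.I * fderiv ℝ G w (Complex.I * Complex.exp (θ * Complex.I))) *
        Complex.exp (θ * Complex.I) := by
  have e1 : Complex.exp (θ * Complex.I) = Real.cos θ • (1 : ℂ) + Real.sin θ • Complex.I := by
    rw [Complex.exp_mul_I]; simp
  have e2 : Complex.I * Complex.exp (θ * Complex.I) =
      Real.cos θ • Complex.I - Real.sin θ • (1 : ℂ) := by
    rw [Complex.exp_mul_I]; simp
    linear_combination (Complex.sin θ) * Complex.I_mul_I
  rw [e2, map_sub, map_smul, map_smul, e1, map_add, map_smul, map_smul]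
  simp only [wirtinger, Complex.real_smul]
  have h := Complex.sin_sq_add_cos_sq (θ : ℂ)
  push_cast
  linear_combination (-(fderiv ℝ G w 1 + Complex.I * fderiv ℝ G w Complex.I)) * h +
    (fderiv ℝ G w 1 * Complex.sin θ ^ 2 - fderiv ℝ G w Complex.I * Complex.sin θ * Complex.cos θ) *
      Complex.I_mul_I

/-- The Cauchy–Pompeiu formula at the origin for compactly supported functions. -/
lemma integral_wirtinger_div {G : ℂ → ℂ} (hG : ContDiff ℝ 1 G) (hc : HasCompactSupport G) :
    ∫ w, wirtinger G w / w = -Real.pi * G 0 := by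
  have hfd := hG.continuous_fderiv one_ne_zero
  obtain ⟨R, hR⟩ := (hc.isCompact.isBounded).subset_closedBall 0
  have hzero : ∀ w : ℂ, R < ‖w‖ → fderiv ℝ G w = 0 := fun w hw => by
    by_contra h
    have h1 : w ∈ tsupport G := support_fderiv_subset ℝ h
    have := hR h1
    rw [mem_closedBall_zero_iff] at this
    linarith
  set e : ℝ → ℂ := fun θ => Complex.exp (θ * Complex.I) with he
  have hen : ∀ θ, ‖e θ‖ = 1 := fun θ => Complex.norm_exp_ofReal_mul_I θ
  have hec : Continuous e := by fun_prop
  have hint : ∀ c : ℂ, IntegrableOn (fun p : ℝ × ℝ => fderiv ℝ G (p.1 * e p.2) (c * e p.2))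
      (Set.Ioi 0 ×ˢ Set.Ioo (-Real.pi) Real.pi) := by
    intro c
    have hcont : Continuous (fun p : ℝ × ℝ => fderiv ℝ G (p.1 * e p.2) (c * e p.2)) := by
      have h1 : Continuous fun p : ℝ × ℝ => fderiv ℝ G (p.1 * e p.2) :=
        hfd.comp ((Complex.continuous_ofReal.comp continuous_fst).mul (hec.comp continuous_snd))
      exact h1.clm_apply (continuous_const.mul (hec.comp continuous_snd))
    have h1 := (hcont.continuousOn (s := Set.Icc 0 R ×ˢ Set.Icc (-Real.pi) Real.pi)
      ).integrableOn_compact (μ := volume) (isCompact_Icc.prod isCompact_Icc)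
    have h2 := h1.mono_set (t := Set.Icc 0 R ×ˢ Set.Icc (-Real.pi) Real.pi)
      (s := Set.Icc 0 R ×ˢ Set.Ioo (-Real.pi) Real.pi)
      (Set.prod_mono_right Set.Ioo_subset_Icc_self)
    refine h2.of_forall_sdiff_eq_zero (measurableSet_Ioi.prod measurableSet_Ioo) ?_
    rintro ⟨r, θ⟩ ⟨⟨h3, h4⟩, h5⟩
    have h3' : (0 : ℝ) < r := h3
    have : R < r := by
      by_contra! h6
      exact h5 ⟨⟨h3'.le, h6⟩, h4⟩
    simp only
    rw [hzero, _root_.zero_apply]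
    rwa [norm_mul, hen, mul_one, Complex.norm_real, Real.norm_of_nonneg h3'.le]
  have hderiv : ∀ (γ : ℝ → ℂ) (γ' : ℂ) (s : ℝ), HasDerivAt γ γ' s →
      HasDerivAt (fun s => G (γ s)) (fderiv ℝ G (γ s) γ') s := fun γ γ' s h =>
    ((hG.differentiable one_ne_zero) (γ s)).hasFDerivAt.comp_hasDerivAt s h
  have hrad : ∀ θ : ℝ, ∫ r in Set.Ioi (0 : ℝ), fderiv ℝ G (r * e θ) (1 * e θ) = -G 0 := by
    intro θ
    have hd : ∀ r : ℝ, HasDerivAt (fun r : ℝ => G (r * e θ)) (fderiv ℝ G (r * e θ) (1 * e θ)) r :=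
      fun r => hderiv _ _ r ((hasDerivAt_id r).ofReal_comp.mul_const (e θ))
    have hcd : ContDiff ℝ 1 fun r : ℝ => G (r * e θ) :=
      hG.comp (Complex.ofRealCLM.contDiff.mul contDiff_const)
    have hcs : HasCompactSupport fun r : ℝ => G (r * e θ) := by
      refine HasCompactSupport.intro (isCompact_closedBall (0 : ℝ) R) fun r hr => ?_
      by_contra h
      have := hR (subset_tsupport G h)
      rw [mem_closedBall_zero_iff, norm_mul, hen, mul_one, Complex.norm_real] at this
      exact hr (mem_closedBall_zero_iff.2 this)
    have h := hcs.integral_Ioi_deriv_eq hcd 0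
    simp only [(hd _).deriv] at h
    simpa using h
  have hang : ∀ r : ℝ, r ≠ 0 → ∫ θ in Set.Ioo (-Real.pi) Real.pi,
      fderiv ℝ G (r * e θ) (Complex.I * e θ) = 0 := by
    intro r hr
    have hd : ∀ θ : ℝ, HasDerivAt (fun θ : ℝ => (r : ℂ)⁻¹ * G (r * e θ))
        (fderiv ℝ G (r * e θ) (Complex.I * e θ)) θ := by
      intro θ
      have h1 : HasDerivAt (fun θ : ℝ => (r : ℂ) * e θ) (r * (e θ * (1 * Complex.I))) θ :=
        (((hasDerivAt_id θ).ofReal_comp.mul_const Complex.I).cexp).const_mul (r : ℂ)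
      refine ((hderiv _ _ θ h1).const_mul (r : ℂ)⁻¹).congr_deriv ?_
      have : (r : ℂ) * (e θ * (1 * Complex.I)) = r • (Complex.I * e θ) := by
        rw [Complex.real_smul]; ring
      rw [this, map_smul, Complex.real_smul, ← mul_assoc, inv_mul_cancel₀ (by exact_mod_cast hr),
        one_mul]
    have hcont : Continuous fun θ : ℝ => fderiv ℝ G (r * e θ) (Complex.I * e θ) :=
      (hfd.comp (continuous_const.mul hec)).clm_apply (continuous_const.mul hec)
    rw [← integral_Ioc_eq_integral_Ioo,
      ← intervalIntegral.integral_of_le (by linarith [Real.pi_pos]),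
      intervalIntegral.integral_eq_sub_of_hasDerivAt (fun θ _ => hd θ)
        (hcont.intervalIntegrable _ _)]
    have : e Real.pi = e (-Real.pi) := by
      simp only [he]
      push_cast
      rw [Complex.exp_pi_mul_I, neg_mul, Complex.exp_neg_pi_mul_I]
    rw [this, sub_self]
  rw [← Complex.integral_comp_polarCoord_symm, polarCoord_target]
  have hcongr : ∀ p ∈ Set.Ioi (0 : ℝ) ×ˢ Set.Ioo (-Real.pi) Real.pi,
      p.1 • (wirtinger G (Complex.polarCoord.symm p) / Complex.polarCoord.symm p) =
        (1 / 2 : ℂ) * (fderiv ℝ G (p.1 * e p.2) (1 * e p.2) +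
          Complex.I * fderiv ℝ G (p.1 * e p.2) (Complex.I * e p.2)) := by
    rintro ⟨r, θ⟩ ⟨hr, -⟩
    have hr' : (r : ℂ) ≠ 0 := by exact_mod_cast (ne_of_gt hr : r ≠ 0)
    have h1 : Complex.polarCoord.symm (r, θ) = r * e θ := by
      rw [Complex.polarCoord_symm_apply, he]
      simp only [Complex.exp_mul_I]
      push_cast; ring
    have h2 := wirtinger_mul_exp G (r * e θ) θ
    have h3 : e θ ≠ 0 := Complex.exp_ne_zero _
    rw [h1, Complex.real_smul, one_mul]
    simp only
    field_simp
    rw [mul_comm _ (2 : ℂ), h2, mul_comm (e θ) Complex.I]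
    exact mul_comm _ _
  rw [setIntegral_congr_fun (measurableSet_Ioi.prod measurableSet_Ioo) hcongr,
    integral_const_mul, integral_add (hint 1) ((hint Complex.I).const_mul _), integral_const_mul]
  have hA : ∫ p in Set.Ioi (0 : ℝ) ×ˢ Set.Ioo (-Real.pi) Real.pi,
      fderiv ℝ G (p.1 * e p.2) (1 * e p.2) = 2 * Real.pi * (-G 0) := by
    have h := hint 1
    rw [IntegrableOn, Measure.volume_eq_prod, ← Measure.prod_restrict] at h
    rw [Measure.volume_eq_prod, ← Measure.prod_restrict, integral_prod_symm _ h]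
    simp only [hrad]
    rw [setIntegral_const, Real.volume_real_Ioo_of_le (by linarith [Real.pi_pos]),
      Complex.real_smul]
    push_cast; ring
  have hB : ∫ p in Set.Ioi (0 : ℝ) ×ˢ Set.Ioo (-Real.pi) Real.pi,
      fderiv ℝ G (p.1 * e p.2) (Complex.I * e p.2) = 0 := by
    rw [Measure.volume_eq_prod, setIntegral_prod _ (hint Complex.I),
      setIntegral_congr_fun measurableSet_Ioi (g := fun _ => (0 : ℂ)) fun r hr => hang r
        (ne_of_gt hr), integral_zero]
  rw [hA, hB]
  ring

/-- The Cauchy–Pompeiu formula for compactly supported functions. -/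
lemma integral_wirtinger_div_sub {G : ℂ → ℂ} (hG : ContDiff ℝ 1 G) (hc : HasCompactSupport G)
    (a : ℂ) : ∫ w, wirtinger G w / (w - a) = -Real.pi * G a := by
  have hG' : ContDiff ℝ 1 fun w => G (w + a) := hG.comp (contDiff_id.add contDiff_const)
  have hc' : HasCompactSupport fun w => G (w + a) := hc.comp_homeomorph (Homeomorph.addRight a)
  have h := integral_wirtinger_div hG' hc'
  have e : ∀ w, wirtinger (fun w => G (w + a)) w = wirtinger G (w + a) := fun w => by
    simp only [wirtinger, fderiv_comp_add_right]
  simp only [e, zero_add] at h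
  rw [← h, ← integral_add_right_eq_self _ a]
  simp

end CauchyPompeiu

section CauchyDerivatives

open MeasureTheory

/-- Bounds for the derivatives along the real line of a function whose `∂̄`-derivative is flat on a
real interval. -/
theorem norm_iteratedDeriv_le_of_wirtinger_le {G : ℂ → ℂ} (hG : ContDiff ℝ 1 G) {R ε : ℝ}
    (hε : 0 < ε) (hR : ∀ w, R < ‖w‖ → G w = 0) {D : ℕ → ℝ} (hD : ∀ k, 0 ≤ D k)
    (hb : ∀ t : ℝ, |t| < ε → ∀ w k, ‖wirtinger G w‖ ≤ D k * ‖w - t‖ ^ k) (k : ℕ) :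
    ‖iteratedDeriv k (fun t : ℝ => G t) 0‖ ≤
      k.factorial * D (k + 1) * volume.real (Metric.closedBall (0 : ℂ) R) := by
  have hc : HasCompactSupport G := HasCompactSupport.intro (isCompact_closedBall 0 R) fun w hw =>
    hR w (by simpa using hw)
  have hW : ∀ w, R < ‖w‖ → wirtinger G w = 0 := by
    intro w hw
    have h : G =ᶠ[𝓝 w] fun _ => 0 := by
      filter_upwards [(isOpen_lt continuous_const continuous_norm).mem_nhds hw] with y hy
      exact hR y hy
    simp [wirtinger, h.fderiv_eq]
  have hWc := continuous_wirtinger hG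
  set φ : ℕ → ℝ → ℂ := fun k t => ∫ w, wirtinger G w / (w - t) ^ (k + 1) with hφ
  have hzero : ∀ t : ℝ, |t| < ε → wirtinger G t = 0 := fun t ht => by
    simpa using hb t ht t 1
  have hbound : ∀ (t : ℝ), |t| < ε → ∀ k w, ‖wirtinger G w / (w - t) ^ k‖ ≤
      (Metric.closedBall (0 : ℂ) R).indicator (fun _ => D k) w := by
    intro t ht k w
    by_cases hw : w ∈ Metric.closedBall (0 : ℂ) R
    · rw [Set.indicator_of_mem hw, norm_div, norm_pow]
      exact div_le_of_le_mul₀ (by positivity) (hD k) (hb t ht w k)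
    · rw [Set.indicator_of_notMem hw, hW w (by simpa using hw)]
      simp
  have hindint : ∀ k, Integrable ((Metric.closedBall (0 : ℂ) R).indicator (fun _ => D k)) :=
    fun k => (integrable_indicator_iff measurableSet_closedBall).2
      (integrableOn_const (isCompact_closedBall _ _).measure_ne_top)
  have hmeas : ∀ (t : ℝ) k, AEStronglyMeasurable (fun w => wirtinger G w / (w - t) ^ k) volume :=
    fun t k => (hWc.measurable.div (by fun_prop)).aestronglyMeasurable
  have hinte : ∀ (t : ℝ), |t| < ε → ∀ k, Integrable (fun w => wirtinger G w / (w - t) ^ k) :=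
    fun t ht k => (hindint k).mono' (hmeas t k) (Eventually.of_forall (hbound t ht k))
  have hopen : IsOpen {t : ℝ | |t| < ε} := isOpen_lt continuous_abs continuous_const
  have hderiv : ∀ k (t : ℝ), |t| < ε → HasDerivAt (φ k) ((k + 1) * φ (k + 1) t) t := by
    intro k t ht
    have h := hasDerivAt_integral_of_dominated_loc_of_deriv_le (μ := (volume : Measure ℂ))
      (F := fun (t : ℝ) w => wirtinger G w / (w - t) ^ (k + 1))
      (F' := fun (t : ℝ) w => (k + 1 : ℂ) * (wirtinger G w / (w - t) ^ (k + 2)))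
      (bound := fun w => (k + 1 : ℝ) *
        (Metric.closedBall (0 : ℂ) R).indicator (fun _ => D (k + 2)) w)
      (x₀ := t) (s := {t : ℝ | |t| < ε}) (hopen.mem_nhds ht)
      (Eventually.of_forall fun s => hmeas s _) (hinte t ht _) ((hmeas t _).const_mul _)
      (Eventually.of_forall fun w s hs => by
        rw [norm_mul]
        have : ‖(k + 1 : ℂ)‖ = k + 1 := by
          rw [← Nat.cast_add_one, Complex.norm_natCast]; push_cast; rfl
        rw [this]
        exact mul_le_mul_of_nonneg_left (hbound s hs _ w) (by positivity))
      ((hindint _).const_mul _)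
      (Eventually.of_forall fun w s hs => by
        by_cases hw : w = s
        · have h0 : wirtinger G w = 0 := by rw [hw]; exact hzero s hs
          simp only [h0, zero_div, mul_zero]
          exact hasDerivAt_const _ _
        · have hne : w - s ≠ 0 := sub_ne_zero.2 hw
          have h1 : HasDerivAt (fun s : ℝ => (w - s : ℂ)) (-1) s := by
            simpa using (hasDerivAt_id s).ofReal_comp.const_sub w
          have h2 := ((h1.fun_pow (k + 1)).fun_inv (pow_ne_zero _ hne)).const_mul (wirtinger G w)
          simp only [div_eq_mul_inv]
          refine h2.congr_deriv ?_
          field_simp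
          rw [Nat.add_sub_cancel]
          push_cast
          ring)
    have h2 := h.2
    rw [integral_const_mul] at h2
    exact h2
  have hiter : ∀ k (t : ℝ), |t| < ε → iteratedDeriv k (fun t : ℝ => G t) t =
      -(Real.pi : ℂ)⁻¹ * k.factorial * φ k t := by
    intro k
    induction k with
    | zero =>
      intro t ht
      have := integral_wirtinger_div_sub hG hc t
      simp only [iteratedDeriv_zero, hφ, zero_add, pow_one, this]
      have : (Real.pi : ℂ) ≠ 0 := by exact_mod_cast Real.pi_ne_zero
      field_simp
      simp
    | succ k ih =>
      intro t ht
      have h : iteratedDeriv k (fun t : ℝ => G t) =ᶠ[𝓝 t]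
          fun t => -(Real.pi : ℂ)⁻¹ * k.factorial * φ k t := by
        filter_upwards [hopen.mem_nhds ht] with s hs using ih s hs
      rw [iteratedDeriv_succ, h.deriv_eq, ((hderiv k t ht).const_mul _).deriv, Nat.factorial_succ]
      push_cast
      ring
  have h0 : |(0 : ℝ)| < ε := by simpa using hε
  rw [hiter k 0 h0, norm_mul, norm_mul, norm_neg, norm_inv, Complex.norm_real, Complex.norm_natCast,
    Real.norm_of_nonneg Real.pi_pos.le]
  have hφb : ‖φ k 0‖ ≤ D (k + 1) * volume.real (Metric.closedBall (0 : ℂ) R) := by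
    refine (norm_integral_le_of_norm_le (hindint (k + 1))
      (Eventually.of_forall (hbound 0 h0 (k + 1)))).trans_eq ?_
    rw [integral_indicator measurableSet_closedBall, setIntegral_const, smul_eq_mul, mul_comm]
  have hpi : Real.pi⁻¹ ≤ 1 := inv_le_one_of_one_le₀ (by linarith [Real.pi_gt_three])
  calc Real.pi⁻¹ * k.factorial * ‖φ k 0‖ ≤
      1 * k.factorial * (D (k + 1) * volume.real (Metric.closedBall (0 : ℂ) R)) := by
        gcongr
    _ = _ := by ring

end CauchyDerivatives

section Polarization

open Finset

/-- The polarization identity for symmetric multilinear maps. -/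
theorem MultilinearMap.factorial_smul_eq_sum_of_symmetric {k : ℕ} {E F : Type*}
    [AddCommGroup E] [Module ℝ E] [AddCommGroup F] [Module ℝ F]
    (A : MultilinearMap ℝ (fun _ : Fin k => E) F)
    (hA : ∀ (σ : Equiv.Perm (Fin k)) (v : Fin k → E), A (v ∘ σ) = A v) (v : Fin k → E) :
    (k.factorial : ℝ) • A v = ∑ s : Finset (Fin k),
      (-1 : ℝ) ^ (k + #s) • A fun _ => ∑ i ∈ s, v i := by
  classical
  have h1 : ∀ s : Finset (Fin k), (A fun _ => ∑ i ∈ s, v i) =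
      ∑ r : Fin k → Fin k, (∏ j, if r j ∈ s then (1 : ℝ) else 0) • A (v ∘ r) := by
    intro s
    have : (fun _ : Fin k => ∑ i ∈ s, v i) =
        fun _ : Fin k => ∑ i, (if i ∈ s then (1 : ℝ) else 0) • v i := by
      funext; simp
    rw [this, MultilinearMap.map_sum]
    exact sum_congr rfl fun r _ => A.map_smul_univ _ _
  simp only [h1, smul_sum, smul_smul]
  rw [sum_comm]
  simp only [← sum_smul]
  have h2 : ∀ r : Fin k → Fin k, ∑ s : Finset (Fin k), (-1 : ℝ) ^ (k + #s) *
      (∏ j, if r j ∈ s then (1 : ℝ) else 0) = if Function.Bijective r then 1 else 0 := by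
    intro r
    split_ifs with hr
    · rw [sum_eq_single univ]
      · simp [← two_mul]
      · intro s _ hs
        obtain ⟨i, hi⟩ : ∃ i, i ∉ s := by simpa [eq_univ_iff_forall] using hs
        obtain ⟨j, rfl⟩ := hr.2 i
        rw [prod_eq_zero (mem_univ j) (by simp [hi]), mul_zero]
      · simp
    · obtain ⟨i, hi⟩ : ∃ i, ∀ j, r j ≠ i := by
        by_contra! h
        exact hr (Finite.surjective_iff_bijective.1 h)
      refine sum_involution (fun s _ => if i ∈ s then s.erase i else insert i s) ?_ ?_ ?_ ?_
      · intro s _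
        have hp : ∀ t : Finset (Fin k), (∀ j, r j ∈ s ↔ r j ∈ t) →
            (∏ j, if r j ∈ s then (1 : ℝ) else 0) = ∏ j, if r j ∈ t then (1 : ℝ) else 0 :=
          fun t ht => prod_congr rfl fun j _ => by simp [ht j]
        split_ifs with h
        · rw [hp (s.erase i) fun j => by simp [hi j], ← card_erase_add_one h]
          ring
        · rw [hp (insert i s) fun j => by simp [hi j], card_insert_of_notMem h]
          ring
      · intro s _ _
        split_ifs with h
        · exact fun h' => by rw [← h'] at h; simp at h
        · exact fun h' => h (by rw [← h']; simp)
      · simp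
      · intro s _
        by_cases h : i ∈ s
        · simp [h, insert_erase]
        · simp [h]
  simp only [h2, ite_smul, one_smul, zero_smul]
  rw [← sum_filter]
  have h3 : ∀ r ∈ univ.filter (fun r : Fin k → Fin k => Function.Bijective r), A (v ∘ r) = A v :=
    fun r hr => hA (Equiv.ofBijective r (mem_filter.1 hr).2) v
  rw [sum_congr rfl h3, sum_const]
  have h4 : #(univ.filter fun r : Fin k → Fin k => Function.Bijective r) = k.factorial := by
    rw [← Fintype.card_subtype, Fintype.card_congr Equiv.bijectiveEquiv, Fintype.card_perm,
      Fintype.card_fin]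
  rw [h4, Nat.cast_smul_eq_nsmul]

/-- The operator norm of a symmetric multilinear map is controlled by its values on the
diagonal. -/
theorem ContinuousMultilinearMap.norm_le_of_symmetric_of_diag_le {k : ℕ} {E F : Type*}
    [NormedAddCommGroup E] [NormedSpace ℝ E] [NormedAddCommGroup F] [NormedSpace ℝ F]
    (A : ContinuousMultilinearMap ℝ (fun _ : Fin k => E) F)
    (hA : ∀ (σ : Equiv.Perm (Fin k)) (v : Fin k → E), A (v ∘ σ) = A v) {B : ℝ} (hB : 0 ≤ B)
    (hb : ∀ v : E, ‖v‖ ≤ 1 → ‖A fun _ => v‖ ≤ B) :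
    ‖A‖ ≤ (2 * Real.exp 1) ^ k * B := by
  have hdiag : ∀ (v : E) (c : ℝ), ‖v‖ ≤ c → ‖A fun _ => v‖ ≤ c ^ k * B := by
    intro v c hc
    rcases (norm_nonneg v).trans hc |>.eq_or_lt with h0 | hpos
    · have hv : v = 0 := norm_le_zero_iff.1 (hc.trans h0.symm.le)
      rcases k.eq_zero_or_pos with rfl | hk
      · simpa using hb v (by rw [hv]; simp)
      · rw [A.map_coord_zero ⟨0, hk⟩ hv, norm_zero, ← h0]
        positivity
    · have h := A.map_smul_univ (fun _ => c) (fun _ => c⁻¹ • v)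
      simp only [smul_inv_smul₀ hpos.ne', prod_const, card_univ, Fintype.card_fin] at h
      rw [h, norm_smul, norm_pow, Real.norm_of_nonneg hpos.le]
      refine mul_le_mul_of_nonneg_left (hb _ ?_) (by positivity)
      rw [norm_smul, norm_inv, Real.norm_of_nonneg hpos.le, inv_mul_le_iff₀ hpos]
      simpa using hc
  have hunit : ∀ v : Fin k → E, (∀ i, ‖v i‖ ≤ 1) → ‖A v‖ ≤ (2 * Real.exp 1) ^ k * B := by
    intro v hv
    have h := A.toMultilinearMap.factorial_smul_eq_sum_of_symmetric hA v
    have hk : (0 : ℝ) < k.factorial := by exact_mod_cast k.factorial_pos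
    have h1 : ‖(k.factorial : ℝ) • A v‖ ≤ ∑ s : Finset (Fin k), (k : ℝ) ^ k * B := by
      refine (congrArg norm h).trans_le ((norm_sum_le _ _).trans (sum_le_sum fun s _ => ?_))
      rw [norm_smul, norm_pow, norm_neg, norm_one, one_pow, one_mul]
      refine hdiag _ _ ((norm_sum_le _ _).trans ((sum_le_sum fun i _ => hv i).trans ?_))
      simpa using card_le_univ s
    rw [norm_smul, Real.norm_of_nonneg hk.le, sum_const, card_univ, Fintype.card_finset,
      Fintype.card_fin, nsmul_eq_mul] at h1
    have h2 : (k : ℝ) ^ k ≤ k.factorial * Real.exp 1 ^ k := by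
      have := Real.pow_div_factorial_le_exp (k : ℝ) (by positivity) k
      rw [div_le_iff₀ hk] at this
      rwa [← Real.exp_nat_mul, mul_one, mul_comm]
    refine le_of_mul_le_mul_left (h1.trans ?_) hk
    push_cast
    calc (2 : ℝ) ^ k * ((k : ℝ) ^ k * B) ≤ 2 ^ k * ((k.factorial * Real.exp 1 ^ k) * B) := by gcongr
      _ = _ := by rw [mul_pow]; ring
  refine A.opNorm_le_bound (by positivity) fun v => ?_
  by_cases h0 : ∃ i, v i = 0
  · obtain ⟨i, hi⟩ := h0
    rw [A.map_coord_zero i hi, norm_zero]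
    positivity
  · push Not at h0
    have h := A.map_smul_univ (fun i => ‖v i‖) (fun i => ‖v i‖⁻¹ • v i)
    have e : (fun i => ‖v i‖ • ‖v i‖⁻¹ • v i) = v := by
      funext i; exact smul_inv_smul₀ (norm_ne_zero_iff.2 (h0 i)) _
    rw [e] at h
    rw [h, norm_smul, norm_prod, mul_comm]
    simp only [norm_norm]
    refine mul_le_mul_of_nonneg_right (hunit _ fun i => ?_) (by positivity)
    rw [norm_smul, norm_inv, norm_norm, inv_mul_cancel₀ (norm_ne_zero_iff.2 (h0 i))]

end Polarization

section LineDerivatives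

/-- The iterated derivative of a smooth function is symmetric. -/
theorem ContDiff.iteratedFDeriv_comp_perm {E F : Type*} [NormedAddCommGroup E] [NormedSpace ℝ E]
    [NormedAddCommGroup F] [NormedSpace ℝ F] {g : E → F} (hg : ContDiff ℝ (⊤ : ℕ∞) g) {k : ℕ}
    (x : E) (v : Fin k → E) (σ : Equiv.Perm (Fin k)) :
    iteratedFDeriv ℝ k g x (v ∘ σ) = iteratedFDeriv ℝ k g x v := by
  have hsmooth : ∀ (v : E) {g : E → F}, ContDiff ℝ (⊤ : ℕ∞) g →
      ContDiff ℝ (⊤ : ℕ∞) fun y => fderiv ℝ g y v := fun v g hg =>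
    (hg.fderiv_right (m := ((⊤ : ℕ∞) : WithTop ℕ∞)) le_rfl).clm_apply contDiff_const
  let D : E → {g : E → F // ContDiff ℝ (⊤ : ℕ∞) g} → {g : E → F // ContDiff ℝ (⊤ : ℕ∞) g} :=
    fun v g => ⟨fun y => fderiv ℝ g.1 y v, hsmooth v g.2⟩
  have : LeftCommutative D := by
    refine ⟨fun a b g => Subtype.ext (funext fun y => ?_)⟩
    have hd : DifferentiableAt ℝ (fderiv ℝ g.1) y :=
      (g.2.fderiv_right (m := ((⊤ : ℕ∞) : WithTop ℕ∞)) le_rfl).differentiable (by simp) y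
    have hs : IsSymmSndFDerivAt ℝ g.1 y := g.2.contDiffAt.isSymmSndFDerivAt <| by
      rw [minSmoothness_of_isRCLikeNormedField]
      exact WithTop.coe_le_coe.2 (le_top : (2 : ℕ∞) ≤ ⊤)
    have e : ∀ a b : E, fderiv ℝ (fun y => fderiv ℝ g.1 y b) y a =
        fderiv ℝ (fderiv ℝ g.1) y a b := fun a b => by
      rw [fderiv_clm_apply hd (differentiableAt_const _)]
      simp
    change fderiv ℝ (fun y => fderiv ℝ g.1 y b) y a = fderiv ℝ (fun y => fderiv ℝ g.1 y a) y b
    rw [e, e]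
    exact hs a b
  have hfold : ∀ (k : ℕ) (v : Fin k → E) (x : E),
      iteratedFDeriv ℝ k g x v = ((List.ofFn v).foldr D ⟨g, hg⟩).1 x := by
    intro k
    induction k with
    | zero => intro v x; simp
    | succ k ih =>
      intro v x
      have hd : DifferentiableAt ℝ (iteratedFDeriv ℝ k g) x :=
        hg.differentiable_iteratedFDeriv (by exact_mod_cast WithTop.coe_lt_top k) x
      rw [hd.iteratedFDeriv_succ_apply_left', List.ofFn_succ, List.foldr_cons]
      change _ = fderiv ℝ ((List.ofFn fun i : Fin k => v i.succ).foldr D ⟨g, hg⟩).1 x (v 0)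
      congr 2
      funext y
      exact ih _ y
  rw [hfold, hfold, (σ.ofFn_comp_perm v).foldr_eq]

/-- The diagonal values of the iterated derivative are the derivatives along lines. -/
theorem iteratedFDeriv_apply_diag {E F : Type*} [NormedAddCommGroup E] [NormedSpace ℝ E]
    [NormedAddCommGroup F] [NormedSpace ℝ F] {g : E → F} (hg : ContDiff ℝ (⊤ : ℕ∞) g)
    (k : ℕ) (x v : E) :
    (iteratedFDeriv ℝ k g x fun _ => v) = iteratedDeriv k (fun t : ℝ => g (x + t • v)) 0 := by
  have hg' : ContDiff ℝ k fun y => g (x + y) :=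
    (hg.of_le (by exact_mod_cast le_top)).comp (contDiff_const.add contDiff_id)
  have e : (fun t : ℝ => g (x + t • v)) =
      (fun y => g (x + y)) ∘ (ContinuousLinearMap.toSpanSingleton ℝ v) := by
    funext t; simp
  rw [e, iteratedDeriv_eq_iteratedFDeriv,
    ContinuousLinearMap.iteratedFDeriv_comp_right _ hg' _ le_rfl,
    ContinuousMultilinearMap.compContinuousLinearMap_apply, iteratedFDeriv_comp_add_left]
  simp

/-- Bounds on derivatives along lines control the iterated derivative. -/
theorem norm_iteratedFDeriv_le_of_line {E F : Type*} [NormedAddCommGroup E] [NormedSpace ℝ E]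
    [NormedAddCommGroup F] [NormedSpace ℝ F] {g : E → F} (hg : ContDiff ℝ (⊤ : ℕ∞) g)
    (k : ℕ) (x : E) {B : ℝ} (hB : 0 ≤ B) (h0 : k = 0 → ‖g x‖ ≤ B)
    (hb : ∀ v : E, ‖v‖ = 1 → ‖iteratedDeriv k (fun t : ℝ => g (x + t • v)) 0‖ ≤ B) :
    ‖iteratedFDeriv ℝ k g x‖ ≤ (2 * Real.exp 1) ^ k * B := by
  refine ContinuousMultilinearMap.norm_le_of_symmetric_of_diag_le _
    (fun σ v => hg.iteratedFDeriv_comp_perm x v σ) hB fun v hv => ?_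
  rcases k.eq_zero_or_pos with rfl | hk
  · simpa using h0 rfl
  rcases eq_or_ne v 0 with rfl | hne
  · rw [ContinuousMultilinearMap.map_coord_zero _ ⟨0, hk⟩ rfl, norm_zero]
    exact hB
  · have h := (iteratedFDeriv ℝ k g x).map_smul_univ (fun _ => ‖v‖) (fun _ => ‖v‖⁻¹ • v)
    simp only [smul_inv_smul₀ (norm_ne_zero_iff.2 hne), Finset.prod_const, Finset.card_univ,
      Fintype.card_fin] at h
    rw [h, norm_smul, norm_pow, norm_norm, iteratedFDeriv_apply_diag hg]
    refine (mul_le_of_le_one_left (norm_nonneg _) (pow_le_one₀ (norm_nonneg _) hv)).trans (hb _ ?_)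
    rw [norm_smul, norm_inv, norm_norm, inv_mul_cancel₀ (norm_ne_zero_iff.2 hne)]

end LineDerivatives

section Converse

variable {n : ℕ}

lemma contDiff_embRC {m : WithTop ℕ∞} : ContDiff ℝ m (embRC : (Fin n → ℝ) → (Fin n → ℂ)) :=
  contDiff_pi.2 fun j => Complex.ofRealCLM.contDiff.comp (contDiff_apply ℝ ℝ j)

lemma continuous_dbar {F : (Fin n → ℂ) → ℂ} (hF : ContDiff ℝ 1 F) (j : Fin n) :
    Continuous (dbar j F) := by
  have h := hF.continuous_fderiv one_ne_zero
  unfold dbar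
  fun_prop

/-- A bound for `∂̄_j F` off `K` by positive powers of the distance extends to all of `ℂⁿ`. -/
lemma norm_dbar_le_of_weight_h {M : ℕ → ℝ} (hM : IsRegularWeightSeq M) {K : Set (Fin n → ℝ)}
    {F : (Fin n → ℂ) → ℂ} (hF : ContDiff ℝ 1 F) {C Q : ℝ} (hC : 0 < C) (hQ : 0 < Q)
    (hb : ∀ z : Fin n → ℂ, z ∉ embRC '' K → ∀ j : Fin n,
      ‖dbar j F z‖ ≤ C * weight_h M (Q * Metric.infDist z (embRC '' K)))
    (z : Fin n → ℂ) (j : Fin n) (k : ℕ) :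
    ‖dbar j F z‖ ≤ C * ((Q * Metric.infDist z (embRC '' K)) ^ k * mseq M k) := by
  have hoff : ∀ z : Fin n → ℂ, z ∉ embRC '' K → ∀ k,
      ‖dbar j F z‖ ≤ C * ((Q * Metric.infDist z (embRC '' K)) ^ k * mseq M k) := fun z hz k =>
    (hb z hz j).trans (mul_le_mul_of_nonneg_left
      (hM.weight_h_le (mul_nonneg hQ.le Metric.infDist_nonneg) k) hC.le)
  have hm := hM.mseq_pos
  by_cases hz : z ∈ embRC '' K
  swap
  · exact hoff z hz k
  suffices h : dbar j F z = 0 by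
    rw [h, norm_zero]
    have := Metric.infDist_nonneg (x := z) (s := embRC '' K)
    have := hm k
    positivity
  obtain ⟨x, hx, rfl⟩ := hz
  set γ : ℝ → (Fin n → ℂ) := fun t => embRC x + Pi.single j (t * Complex.I) with hγ
  have hγc : Continuous γ := by
    refine continuous_const.add ?_
    exact (continuous_single j).comp (Complex.continuous_ofReal.mul continuous_const)
  have hγ0 : γ 0 = embRC x := by simp [hγ]
  have h1 : Tendsto (fun t => ‖dbar j F (γ t)‖) (𝓝[≠] 0) (𝓝 ‖dbar j F (embRC x)‖) := by
    have h := ((continuous_dbar hF j).norm.comp hγc).tendsto 0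
    simp only [Function.comp_apply, hγ0] at h
    exact h.mono_left nhdsWithin_le_nhds
  have h2 : Tendsto (fun t => C * ((Q * Metric.infDist (γ t) (embRC '' K)) ^ 1 * mseq M 1))
      (𝓝[≠] 0) (𝓝 0) := by
    have hc : Continuous fun t => C * ((Q * Metric.infDist (γ t) (embRC '' K)) ^ 1 * mseq M 1) :=
      continuous_const.mul (((continuous_const.mul
        ((Metric.continuous_infDist_pt _).comp hγc)).pow 1).mul continuous_const)
    have h := hc.tendsto 0
    simp only [hγ0, Metric.infDist_zero_of_mem (Set.mem_image_of_mem embRC hx)] at h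
    simp only [mul_zero, pow_one, zero_mul] at h ⊢
    exact h.mono_left nhdsWithin_le_nhds
  have h3 := le_of_tendsto_of_tendsto h1 h2 (by
    filter_upwards [self_mem_nhdsWithin] with t ht
    refine hoff _ ?_ 1
    rintro ⟨y, -, hy⟩
    have := congrArg Complex.im (congrFun hy j)
    simp only [hγ, embRC, Pi.add_apply, Pi.single_eq_same] at this
    simp at this
    exact ht this.symm)
  exact norm_le_zero_iff.1 h3

/-- The `∂̄`-derivative of the restriction of `F` to a complex line in a real direction. -/
lemma wirtinger_comp_line {F : (Fin n → ℂ) → ℂ} (hF : ContDiff ℝ 1 F) (a : Fin n → ℂ)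
    (v : Fin n → ℝ) (w : ℂ) :
    wirtinger (fun w : ℂ => F (a + w • embRC v)) w =
      ∑ j, (v j : ℂ) * dbar j F (a + w • embRC v) := by
  have hℓ : HasFDerivAt (fun w : ℂ => a + w • embRC v)
      ((ContinuousLinearMap.toSpanSingleton ℂ (embRC v)).restrictScalars ℝ) w := by
    have h := (ContinuousLinearMap.toSpanSingleton ℂ (embRC v)).hasFDerivAt (x := w)
    simpa using (h.restrictScalars ℝ).const_add a
  have h := ((hF.differentiable one_ne_zero) _).hasFDerivAt.comp w hℓ
  have hu : ∀ u : ℂ, u • embRC v = ∑ j, v j • (Pi.single j u : Fin n → ℂ) := by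
    intro u
    have e : ∀ j, v j • (Pi.single j u : Fin n → ℂ) = Pi.single j ((u • embRC v) j) := fun j => by
      rw [← Pi.single_smul]
      simp [embRC, mul_comm]
    simp only [e]
    exact (Finset.univ_sum_single _).symm
  have hd : ∀ u : ℂ, fderiv ℝ (fun w : ℂ => F (a + w • embRC v)) w u =
      ∑ j, (v j : ℂ) * fderiv ℝ F (a + w • embRC v) (Pi.single j u) := by
    intro u
    have : fderiv ℝ (fun w : ℂ => F (a + w • embRC v)) w u =
        fderiv ℝ F (a + w • embRC v) (u • embRC v) := by
      rw [show (fun w : ℂ => F (a + w • embRC v)) = F ∘ fun w : ℂ => a + w • embRC v from rfl,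
        h.fderiv]
      simp
    rw [this, hu u, map_sum]
    simp [map_smul]
  simp only [wirtinger, dbar, hd, Finset.mul_sum, ← Finset.sum_add_distrib]
  exact Finset.sum_congr rfl fun j _ => by ring

/-- The trace on `ℝⁿ` of an almost analytic function has Denjoy–Carleman bounds. -/
theorem exists_bound_of_almostAnalytic {M : ℕ → ℝ} (hM : IsRegularWeightSeq M)
    {K : Set (Fin n → ℝ)} (hK : IsCompact K) (hcl : K = closure (interior K))
    {F : (Fin n → ℂ) → ℂ} (hF : ContDiff ℝ (⊤ : ℕ∞) F) (hFc : HasCompactSupport F)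
    {C Q : ℝ} (hC : 0 < C) (hQ : 0 < Q)
    (hb : ∀ z : Fin n → ℂ, z ∉ embRC '' K → ∀ j : Fin n,
      ‖dbar j F z‖ ≤ C * weight_h M (Q * Metric.infDist z (embRC '' K))) :
    ∃ C > 0, ∃ h > 0, ∀ k : ℕ, ∀ x ∈ K,
      ‖iteratedFDeriv ℝ k (fun x => F (embRC x)) x‖ ≤ C * h ^ k * M k := by
  have hF1 : ContDiff ℝ 1 F := hF.of_le (by exact_mod_cast le_top)
  obtain ⟨A, hA1, hA⟩ := hM.exists_mseq_succ_le
  obtain ⟨S, hS⟩ := hF.continuous.bounded_above_of_compact_support hFc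
  have hS0 : 0 ≤ S := (norm_nonneg _).trans (hS 0)
  obtain ⟨RF, hRF⟩ := hFc.isCompact.isBounded.subset_closedBall 0
  obtain ⟨RK, hRK⟩ := hK.isBounded.subset_closedBall 0
  set R := RF + RK with hR
  set V := MeasureTheory.volume.real (Metric.closedBall (0 : ℂ) R) with hV
  have hV0 : 0 ≤ V := MeasureTheory.measureReal_nonneg
  have hg : ContDiff ℝ (⊤ : ℕ∞) fun x : Fin n → ℝ => F (embRC x) := hF.comp contDiff_embRC
  have hm := hM.mseq_pos
  set C' := n * C * Q * V + S + 1 with hC'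
  have hC'0 : 0 < C' := by positivity
  have hint : ∀ k : ℕ, ∀ x ∈ interior K,
      ‖iteratedFDeriv ℝ k (fun x => F (embRC x)) x‖ ≤
        C' * (2 * Real.exp 1 * (Q * A)) ^ k * M k := by
    intro k x hx
    have hMk := hM.pos k
    have hA0 : 0 < A := by linarith
    have key : ‖iteratedFDeriv ℝ k (fun x => F (embRC x)) x‖ ≤
        (2 * Real.exp 1) ^ k * (C' * (Q * A) ^ k * M k) := by
      refine norm_iteratedFDeriv_le_of_line hg k x (by positivity) ?_ ?_
      · rintro rfl
        rw [pow_zero, hM.one, mul_one, mul_one]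
        refine (hS _).trans ?_
        have : 0 ≤ n * C * Q * V := by positivity
        linarith
      · intro v hv
        obtain ⟨ε, hε, hball⟩ := Metric.mem_nhds_iff.1 (mem_interior_iff_mem_nhds.1 hx)
        have hmem : ∀ t : ℝ, |t| < ε → x + t • v ∈ K := fun t ht => hball (by
          rw [Metric.mem_ball, dist_eq_norm, add_sub_cancel_left, norm_smul, hv, mul_one]
          exact ht)
        have hemb : ∀ t : ℝ, embRC (x + t • v) = embRC x + (t : ℂ) • embRC v := fun t => by
          funext j; simp [embRC]
        have hG : ContDiff ℝ 1 fun w : ℂ => F (embRC x + w • embRC v) :=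
          hF1.comp (contDiff_const.add (contDiff_id.smul contDiff_const))
        have hsupp : ∀ w : ℂ, R < ‖w‖ → F (embRC x + w • embRC v) = 0 := by
          intro w hw
          by_contra h
          have h1 := hRF (subset_tsupport F h)
          have h2 := hRK (interior_subset hx)
          rw [mem_closedBall_zero_iff] at h1 h2
          have h3 : ‖w • embRC v‖ ≤ ‖embRC x + w • embRC v‖ + ‖embRC x‖ := by
            have := norm_sub_le (embRC x + w • embRC v) (embRC x)
            rwa [add_sub_cancel_left] at this
          rw [norm_smul, norm_embRC, norm_embRC, hv, mul_one] at h3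
          linarith
        have h := norm_iteratedDeriv_le_of_wirtinger_le hG hε hsupp
          (D := fun k => n * C * Q ^ k * mseq M k) (fun k => by have := hm k; positivity) ?_ k
        · have e : (fun t : ℝ => F (embRC (x + t • v))) =
              fun t : ℝ => F (embRC x + (t : ℂ) • embRC v) := by
            funext t; rw [hemb]
          rw [e]
          refine h.trans ?_
          have hk := hA k
          calc (k.factorial : ℝ) * (n * C * Q ^ (k + 1) * mseq M (k + 1)) * V
              ≤ k.factorial * (n * C * Q ^ (k + 1) * (A ^ k * mseq M k)) * V := by gcongr
            _ = (n * C * Q * V) * (Q * A) ^ k * (k.factorial * mseq M k) := by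
              rw [mul_pow]; ring
            _ = (n * C * Q * V) * (Q * A) ^ k * M k := by
              rw [← IsRegularWeightSeq.eq_factorial_mul]
            _ ≤ C' * (Q * A) ^ k * M k := by
              gcongr
              rw [hC']
              linarith
        · intro t ht w k
          have hmk := hm k
          rw [wirtinger_comp_line hF1]
          have hd : Metric.infDist (embRC x + w • embRC v) (embRC '' K) ≤ ‖w - t‖ := by
            refine (Metric.infDist_le_dist_of_mem
              (Set.mem_image_of_mem embRC (hmem t ht))).trans_eq ?_
            rw [hemb, dist_eq_norm, add_sub_add_left_eq_sub, ← sub_smul, norm_smul, norm_embRC, hv,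
              mul_one]
          have hterm : ∀ j ∈ Finset.univ, ‖(v j : ℂ) * dbar j F (embRC x + w • embRC v)‖ ≤
              C * (Q * ‖w - t‖) ^ k * mseq M k := by
            intro j _
            have hvj : ‖(v j : ℂ)‖ ≤ 1 := by
              rw [Complex.norm_real, ← hv]; exact norm_le_pi_norm v j
            rw [norm_mul]
            refine (mul_le_of_le_one_left (norm_nonneg _) hvj).trans
              ((norm_dbar_le_of_weight_h hM hF1 hC hQ hb _ j k).trans ?_)
            rw [mul_assoc]
            have := Metric.infDist_nonneg (x := embRC x + w • embRC v) (s := embRC '' K)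
            gcongr
          refine (norm_sum_le_of_le _ hterm).trans_eq ?_
          rw [Finset.sum_const, Finset.card_univ, Fintype.card_fin, nsmul_eq_mul, mul_pow]
          ring
    refine key.trans_eq ?_
    rw [mul_pow (2 * Real.exp 1)]
    ring
  refine ⟨C', hC'0, 2 * Real.exp 1 * (Q * A), by have := Real.exp_pos 1; positivity,
    fun k x hx => ?_⟩
  have hclosed : IsClosed {x : Fin n → ℝ | ‖iteratedFDeriv ℝ k (fun x => F (embRC x)) x‖ ≤
      C' * (2 * Real.exp 1 * (Q * A)) ^ k * M k} :=
    isClosed_le (hg.continuous_iteratedFDeriv (by exact_mod_cast le_top)).norm continuous_const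
  rw [hcl] at hx
  exact closure_minimal (hint k) hclosed hx

end Converse

/-- A function that is smooth near a compact set agrees near that set with a globally smooth
function. -/
lemma exists_contDiff_eventuallyEq {n : ℕ} {K U : Set (Fin n → ℝ)} (hK : IsCompact K)
    (hU : IsOpen U) (hKU : K ⊆ U) {g : (Fin n → ℝ) → ℂ} (hg : ContDiffOn ℝ (⊤ : ℕ∞) g U) :
    ∃ g' : (Fin n → ℝ) → ℂ, ContDiff ℝ (⊤ : ℕ∞) g' ∧ ∀ x ∈ K, g' =ᶠ[𝓝 x] g := by
  obtain ⟨V, hVo, hKV, hVU, -⟩ := exists_open_between_and_isCompact_closure hK hU hKU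
  obtain ⟨W, hWo, hKW, hWV, -⟩ := exists_open_between_and_isCompact_closure hK hVo hKV
  obtain ⟨χ, hχ0, hχ1, -⟩ := exists_contMDiffMap_zero_one_of_isClosed
    (n := (⊤ : ℕ∞)) (modelWithCornersSelf ℝ (Fin n → ℝ))
    (s := Vᶜ) (t := closure W) hVo.isClosed_compl isClosed_closure
    (Set.disjoint_compl_left_iff_subset.2 hWV)
  have hχ : ContDiff ℝ (⊤ : ℕ∞) χ := χ.contMDiff.contDiff
  refine ⟨fun x => (χ x) • g x, contDiff_iff_contDiffAt.2 fun x => ?_, fun x hx => ?_⟩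
  · by_cases hx : x ∈ U
    · exact hχ.contDiffAt.smul (hg.contDiffAt (hU.mem_nhds hx))
    · have h : (fun x => (χ x) • g x) =ᶠ[𝓝 x] fun _ => 0 := by
        filter_upwards [isClosed_closure.isOpen_compl.mem_nhds fun h => hx (hVU h)] with y hy
        have : χ y = 0 := hχ0 fun h => hy (subset_closure h)
        simp [this]
      exact contDiffAt_const.congr_of_eventuallyEq h
  · filter_upwards [hWo.mem_nhds (hKW hx)] with y hy
    have : χ y = 1 := hχ1 (subset_closure hy)
    simp [this]

/-- Dyn'kin's almost-analytic extension theorem: `f ∈ E_M(K)` iff `f` extends to a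
compactly supported smooth `F` on `ℂⁿ` with `|∂̄_j F(z)| ≤ C h_M(Q dist(z,K))`. -/
theorem stmt_18 (M : ℕ → ℝ) (hM : IsRegularWeightSeq M)
    {n : ℕ} (K : Set (Fin n → ℝ)) (hK : IsCompact K) (hconv : Convex ℝ K)
    (hcl : K = closure (interior K)) (f : (Fin n → ℝ) → ℂ) :
    (∃ U : Set (Fin n → ℝ), IsOpen U ∧ K ⊆ U ∧
      ∃ g : (Fin n → ℝ) → ℂ, ContDiffOn ℝ (⊤ : ℕ∞) g U ∧ (∀ x ∈ K, g x = f x) ∧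
        ∃ C > 0, ∃ h > 0, ∀ k : ℕ, ∀ x ∈ K,
          ‖iteratedFDerivWithin ℝ k g U x‖ ≤ C * h ^ k * M k) ↔
    (∃ F : (Fin n → ℂ) → ℂ, ContDiff ℝ (⊤ : ℕ∞) F ∧ HasCompactSupport F ∧
      (∀ x ∈ K, F (embRC x) = f x) ∧
      ∃ C > 0, ∃ Q > 0, ∀ z : Fin n → ℂ, z ∉ embRC '' K → ∀ j : Fin n,
        ‖dbar j F z‖ ≤ C * weight_h M (Q * Metric.infDist z (embRC '' K))) := by
  constructor
  · rintro ⟨U, hU, hKU, g, hg, hgf, C, hC, h, hh, hb⟩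
    rcases K.eq_empty_or_nonempty with rfl | hne
    · refine ⟨fun _ => 0, contDiff_const, HasCompactSupport.zero, by simp, 1, one_pos, 1, one_pos,
        fun z _ j => ?_⟩
      have h0 : dbar j (fun _ : Fin n → ℂ => (0 : ℂ)) z = 0 := by simp [dbar]
      rw [h0, norm_zero, one_mul]
      exact hM.weight_h_nonneg (by rw [one_mul]; exact Metric.infDist_nonneg)
    have hint : (interior K).Nonempty := by
      rw [hcl] at hne
      exact closure_nonempty_iff.1 hne
    obtain ⟨g', hg', hgg'⟩ := exists_contDiff_eventuallyEq hK hU hKU hg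
    obtain ⟨F, hF, hFc, hFg, hFb⟩ := exists_almostAnalytic_extension hM hK hconv hint hg' hC hh
      fun k x hx => by
        rw [((hgg' x hx).iteratedFDeriv ℝ k).eq_of_nhds,
          ← iteratedFDerivWithin_of_isOpen k hU (hKU hx)]
        exact hb k x hx
    exact ⟨F, hF, hFc, fun x hx => by rw [hFg x hx, (hgg' x hx).eq_of_nhds, hgf x hx], hFb⟩
  · rintro ⟨F, hF, hFc, hFf, C, hC, Q, hQ, hb⟩
    refine ⟨Set.univ, isOpen_univ, Set.subset_univ _, fun x => F (embRC x),
      (hF.comp contDiff_embRC).contDiffOn, hFf, ?_⟩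
    simp only [iteratedFDerivWithin_univ]
    exact exists_bound_of_almostAnalytic hM hK hcl hF hFc hC hQ hb
end

section
/- (Sjöstrand) Let Ω ⊆ ℝⁿ be open and F ⊆ Ω closed, and let N_e(F) denote the exterior normal set of F. Suppose p : Ω × (ℝⁿ\{0}) → ℝ is smooth and vanishes at every point of N_e(F). If (x₀,ξ₀) ∈ N_e(F) and t ↦ (x(t),ξ(t)) is a solution of the Hamilton equations x′(t) = ∂p/∂ξ(x(t),ξ(t)), ξ′(t) = −∂p/∂x(x(t),ξ(t)) with (x(0),ξ(0)) = (x₀,ξ₀), then there exists ε > 0 such that (x(t),ξ(t)) ∈ N_e(F) for all |t| < ε. -/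
open scoped Topology
open Filter

/-- The exterior normal set `N_e(F)` of a closed subset `F` of `Ω`. -/
def extNormal {n : ℕ} (Ω F : Set (Fin n → ℝ)) : Set ((Fin n → ℝ) × (Fin n → ℝ)) :=
  {p | p.1 ∈ F ∧ p.2 ≠ 0 ∧
    ∃ f : (Fin n → ℝ) → ℝ, ContDiffOn ℝ 2 f Ω ∧
      (∀ v : Fin n → ℝ, fderiv ℝ f p.1 v = ∑ j, p.2 j * v j) ∧
      ∀ x ∈ F, f x ≤ f p.1}

lemma exists_quadratic_remainder {E G : Type*} [NormedAddCommGroup E] [NormedSpace ℝ E]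
    [NormedAddCommGroup G] [NormedSpace ℝ G] {f : E → G} {q₀ : E} (hf : ContDiffAt ℝ 2 f q₀) :
    ∃ ρ > 0, ∃ L ≥ 0, (∀ q ∈ Metric.ball q₀ ρ, DifferentiableAt ℝ f q) ∧
      ContinuousOn (fderiv ℝ f) (Metric.ball q₀ ρ) ∧
      ∀ q ∈ Metric.ball q₀ ρ, ∀ q' ∈ Metric.ball q₀ ρ,
        ‖f q' - f q - fderiv ℝ f q (q' - q)‖ ≤ L * ‖q' - q‖ ^ 2 := by
  have h1 : ContDiffAt ℝ 1 (fderiv ℝ f) q₀ := hf.fderiv_right (by norm_num)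
  obtain ⟨L, s, hs, hL⟩ := h1.exists_lipschitzOnWith
  have h2 : ∀ᶠ q in 𝓝 q₀, DifferentiableAt ℝ f q :=
    (hf.eventually (by simp)).mono fun q hq => hq.differentiableAt (by simp)
  obtain ⟨ρ, hρ, hball⟩ := Metric.mem_nhds_iff.1 (inter_mem hs h2)
  refine ⟨ρ, hρ, L, L.2, fun q hq => (hball hq).2,
    hL.continuousOn.mono fun q hq => (hball hq).1, fun q hq q' hq' => ?_⟩
  have hseg : segment ℝ q q' ⊆ Metric.ball q₀ ρ := (convex_ball q₀ ρ).segment_subset hq hq'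
  have key := (convex_segment q q').norm_image_sub_le_of_norm_hasFDerivWithin_le'
    (f := f) (f' := fderiv ℝ f) (φ := fderiv ℝ f q) (C := L * ‖q' - q‖)
    (fun z hz => (hball (hseg hz)).2.hasFDerivAt.hasFDerivWithinAt)
    (fun z hz => ?_) (left_mem_segment ℝ q q') (right_mem_segment ℝ q q')
  · calc _ ≤ _ := key
      _ = _ := by ring
  · refine (hL.norm_sub_le (hball (hseg hz)).1 (hball hq).1).trans ?_
    gcongr
    rw [← dist_eq_norm, ← dist_eq_norm, dist_comm q' q]
    have := dist_add_dist_of_mem_segment hz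
    rw [dist_comm z q]
    linarith [dist_nonneg (x := z) (y := q')]

lemma le_of_deriv_nonpos_at_max {Y : Type*} [TopologicalSpace Y] {K : Set Y} (hK : IsCompact K)
    {T B : ℝ} {f f' : ℝ → Y → ℝ}
    (hc : ContinuousOn (fun q : ℝ × Y => f q.1 q.2) (Set.Icc 0 T ×ˢ K))
    (h0 : ∀ y ∈ K, f 0 y ≤ B)
    (hd : ∀ t ∈ Set.Icc 0 T, ∀ y ∈ K, HasDerivAt (fun s => f s y) (f' t y) t)
    (hmax : ∀ t ∈ Set.Icc 0 T, ∀ y ∈ K, B < f t y → IsMaxOn (f t) K y → f' t y ≤ 0) :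
    ∀ t ∈ Set.Icc 0 T, ∀ y ∈ K, f t y ≤ B := by
  intro t₁ ht₁ y₁ hy₁
  by_contra! hlt
  obtain ⟨ε, hε, hεB⟩ : ∃ ε > 0, B < f t₁ y₁ - ε * t₁ := by
    refine ⟨(f t₁ y₁ - B) / (2 * (t₁ + 1)), by have := ht₁.1; have := sub_pos.2 hlt; positivity, ?_⟩
    have h1 : 0 < t₁ + 1 := by linarith [ht₁.1]
    have : (f t₁ y₁ - B) / (2 * (t₁ + 1)) * t₁ < f t₁ y₁ - B := by
      rw [div_mul_eq_mul_div, div_lt_iff₀ (by positivity)]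
      nlinarith [ht₁.1]
    linarith
  obtain ⟨⟨t, y⟩, ⟨ht, hy⟩, hM⟩ := (isCompact_Icc.prod hK).exists_isMaxOn ⟨(t₁, y₁), ht₁, hy₁⟩
    (hc.sub (continuousOn_const.mul continuous_fst.continuousOn :
      ContinuousOn (fun q : ℝ × Y => ε * q.1) _))
  have hM' : ∀ s ∈ Set.Icc 0 T, ∀ z ∈ K, f s z - ε * s ≤ f t y - ε * t :=
    fun s hs z hz => hM (Set.mk_mem_prod hs hz)
  simp only at ht hy
  have hBt : B < f t y - ε * t := hεB.trans_le (hM' _ ht₁ _ hy₁)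
  have htpos : 0 < t := by
    rcases ht.1.eq_or_lt with h | h
    · subst h
      linarith [h0 y hy]
    · exact h
  have hd' : f' t y ≤ 0 := hmax t ht y hy (by nlinarith)
    (fun z hz => by have := hM' t ht z hz; simp only [Set.mem_ofPred_eq]; linarith)
  have hder : HasDerivAt (fun s => f s y - ε * s) (f' t y - ε) t := by
    simpa using (hd t ht y hy).fun_sub ((hasDerivAt_id t).const_mul ε)
  have hsl := (hasDerivAt_iff_tendsto_slope.1 hder).mono_left
    (nhdsWithin_mono t (fun s (hs : s ∈ Set.Iio t) => ne_of_lt hs))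
  have hneg := hsl.eventually (gt_mem_nhds (show f' t y - ε < 0 by linarith))
  obtain ⟨s, hs1, hs2⟩ := (hneg.and (Ioo_mem_nhdsLT htpos)).exists
  rw [slope_def_field, div_lt_iff_of_neg (by linarith [hs2.2])] at hs1
  have := hM' s ⟨hs2.1.le, hs2.2.le.trans ht.2⟩ y hy
  linarith

lemma hasDerivAt_dotProduct {ι : Type*} [Fintype ι] {u v : ℝ → ι → ℝ} {u' v' : ι → ℝ} {t : ℝ}
    (hu : HasDerivAt u u' t) (hv : HasDerivAt v v' t) :
    HasDerivAt (fun s => u s ⬝ᵥ v s) (u' ⬝ᵥ v t + u t ⬝ᵥ v') t := by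
  rw [hasDerivAt_pi] at hu hv
  simp only [dotProduct, ← Finset.sum_add_distrib]
  exact HasDerivAt.fun_sum fun i _ => (hu i).mul (hv i)

lemma norm_sq_le_dotProduct {ι : Type*} [Fintype ι] (w : ι → ℝ) : ‖w‖ ^ 2 ≤ w ⬝ᵥ w := by
  have h0 : 0 ≤ w ⬝ᵥ w := Finset.sum_nonneg fun i _ => mul_self_nonneg (w i)
  rw [← Real.le_sqrt (norm_nonneg w) h0, pi_norm_le_iff_of_nonneg (Real.sqrt_nonneg _)]
  intro i
  refine Real.abs_le_sqrt ?_
  rw [sq]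
  exact Finset.single_le_sum (f := fun i => w i * w i) (fun i _ => mul_self_nonneg (w i))
    (Finset.mem_univ i)

lemma dotProduct_le_sum_abs_mul_norm {ι : Type*} [Fintype ι] (ξ w : ι → ℝ) :
    ξ ⬝ᵥ w ≤ (∑ i, |ξ i|) * ‖w‖ := by
  rw [Finset.sum_mul]
  refine Finset.sum_le_sum fun i _ => (le_abs_self _).trans ?_
  rw [abs_mul]
  gcongr
  exact norm_le_pi_norm w i

/-- `ξ` is a nonzero proximal normal to `F` at `x`: a paraboloid with slope `ξ` touches `F`
at `x` from outside. -/
def IsProximalNormal {ι : Type*} [Fintype ι] (F : Set (ι → ℝ)) (x ξ : ι → ℝ) : Prop :=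
  x ∈ F ∧ ξ ≠ 0 ∧ ∃ C : ℝ, ∀ y ∈ F, ξ ⬝ᵥ (y - x) ≤ C * ((y - x) ⬝ᵥ (y - x))

lemma IsProximalNormal.of_local {ι : Type*} [Fintype ι] {F : Set (ι → ℝ)} {x ξ : ι → ℝ}
    (hx : x ∈ F) (hξ : ξ ≠ 0) {ρ C : ℝ} (hρ : 0 < ρ)
    (h : ∀ y ∈ F, dist y x < ρ → ξ ⬝ᵥ (y - x) ≤ C * ((y - x) ⬝ᵥ (y - x))) :
    IsProximalNormal F x ξ := by
  have hA : 0 ≤ ∑ i, |ξ i| := Finset.sum_nonneg fun i _ => abs_nonneg _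
  refine ⟨hx, hξ, |C| + (∑ i, |ξ i|) / ρ, fun y hy => ?_⟩
  have h2 := norm_sq_le_dotProduct (y - x)
  have h3 : 0 ≤ (y - x) ⬝ᵥ (y - x) := (sq_nonneg _).trans h2
  rw [add_mul]
  rcases lt_or_ge (dist y x) ρ with hlt | hge
  · have h1 : 0 ≤ (∑ i, |ξ i|) / ρ * ((y - x) ⬝ᵥ (y - x)) := by positivity
    have := mul_le_mul_of_nonneg_right (le_abs_self C) h3
    linarith [h y hy hlt]
  · have h1 : 0 ≤ |C| * ((y - x) ⬝ᵥ (y - x)) := by positivity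
    rw [dist_eq_norm] at hge
    have h4 : ‖y - x‖ ≤ (y - x) ⬝ᵥ (y - x) / ρ := by
      rw [le_div_iff₀ hρ]
      nlinarith [norm_nonneg (y - x)]
    calc _ ≤ _ := dotProduct_le_sum_abs_mul_norm ξ (y - x)
      _ ≤ (∑ i, |ξ i|) * ((y - x) ⬝ᵥ (y - x) / ρ) := by gcongr
      _ = (∑ i, |ξ i|) / ρ * ((y - x) ⬝ᵥ (y - x)) := by ring
      _ ≤ _ := by linarith

lemma mem_extNormal_iff {n : ℕ} {Ω F : Set (Fin n → ℝ)} (hΩ : IsOpen Ω) (hFΩ : F ⊆ Ω)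
    {x ξ : Fin n → ℝ} : (x, ξ) ∈ extNormal Ω F ↔ IsProximalNormal F x ξ := by
  constructor
  · rintro ⟨hx, hξ, f, hf, hdf, hmax⟩
    simp only at hx hξ hdf hmax
    obtain ⟨ρ, hρ, L, hL, -, -, hrem⟩ :=
      exists_quadratic_remainder (hf.contDiffAt (hΩ.mem_nhds (hFΩ hx)))
    refine .of_local hx hξ hρ (C := L) fun y hy hyx => ?_
    have h1 := hrem x (Metric.mem_ball_self hρ) y hyx
    rw [hdf, Real.norm_eq_abs] at h1
    have h2 := mul_le_mul_of_nonneg_left (norm_sq_le_dotProduct (y - x)) hL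
    have h3 := hmax y hy
    have h4 := neg_abs_le (f y - f x - ∑ j, ξ j * (y - x) j)
    simp only [dotProduct] at *
    linarith
  · rintro ⟨hx, hξ, C, hC⟩
    set f : (Fin n → ℝ) → ℝ := fun y => ξ ⬝ᵥ (y - x) - C * ((y - x) ⬝ᵥ (y - x)) with hf
    have hsm : ContDiff ℝ 2 f := by
      simp only [hf, dotProduct, Pi.sub_apply]
      fun_prop
    refine ⟨hx, hξ, f, hsm.contDiffOn, fun v => ?_, fun y hy => ?_⟩
    · rw [← (hsm.differentiable (by simp) x).lineDeriv_eq_fderiv]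
      refine HasLineDerivAt.lineDeriv ?_
      have h1 : HasDerivAt (fun t : ℝ => t * (ξ ⬝ᵥ v) - C * (t ^ 2 * (v ⬝ᵥ v))) (ξ ⬝ᵥ v) 0 := by
        simpa using ((hasDerivAt_id (0 : ℝ)).mul_const (ξ ⬝ᵥ v)).fun_sub
          (((hasDerivAt_pow 2 (0 : ℝ)).mul_const (v ⬝ᵥ v)).const_mul C)
      refine h1.congr_of_eventuallyEq (Eventually.of_forall fun t => ?_)
      simp only [hf, add_sub_cancel_left, dotProduct_smul, smul_dotProduct, smul_eq_mul]
      ring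
    · have := hC y hy
      simp only [hf, sub_self, dotProduct_zero]
      linarith

lemma IsProximalNormal.forward {ι : Type*} [Fintype ι] {F : Set (ι → ℝ)}
    {P : (ι → ℝ) × (ι → ℝ) → ℝ} {x ξ x' ξ' : ℝ → ι → ℝ} {δ r₀ : ℝ}
    (h0 : IsProximalNormal F (x 0) (ξ 0)) (hr₀ : 0 < r₀)
    (hF : ∀ r ≤ r₀, IsCompact (F ∩ Metric.closedBall (x 0) r))
    (hP : ContDiffAt ℝ 2 P (x 0, ξ 0))
    (hvan : ∀ y η, IsProximalNormal F y η → P (y, η) = 0) (hδ : 0 < δ)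
    (hx : ∀ t, |t| < δ → HasDerivAt x (x' t) t)
    (hξ : ∀ t, |t| < δ → HasDerivAt ξ (ξ' t) t)
    (hx' : ∀ t, |t| < δ → ∀ v, x' t ⬝ᵥ v = fderiv ℝ P (x t, ξ t) (0, v))
    (hξ' : ∀ t, |t| < δ → ∀ v, ξ' t ⬝ᵥ v = -fderiv ℝ P (x t, ξ t) (v, 0)) :
    ∃ ε > 0, ∀ t, 0 ≤ t → t < ε → IsProximalNormal F (x t) (ξ t) := by
  obtain ⟨hx₀F, hξ₀, C, hC⟩ := h0
  obtain ⟨ρ₁, hρ₁, L, hL, hPd₁, hPc₁, hrem₁⟩ := exists_quadratic_remainder hP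
  obtain ⟨ρ, hρ, hρρ₁, hρξ⟩ : ∃ ρ > 0, ρ ≤ ρ₁ ∧ ρ ≤ ‖ξ 0‖ :=
    ⟨min ρ₁ ‖ξ 0‖, lt_min hρ₁ (norm_pos_iff.2 hξ₀), min_le_left _ _, min_le_right _ _⟩
  have hsub : Metric.ball (x 0, ξ 0) ρ ⊆ Metric.ball (x 0, ξ 0) ρ₁ := Metric.ball_subset_ball hρρ₁
  have hdot : ∀ w : ι → ℝ, 0 ≤ w ⬝ᵥ w := fun w => (sq_nonneg _).trans (norm_sq_le_dotProduct w)
  have hc₀ : 0 ≤ |C| := abs_nonneg C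
  obtain ⟨r, hr, hrr₀, hrρ⟩ : ∃ r > 0, r ≤ r₀ ∧ 16 * (|C| + 3) * r ≤ ρ := by
    refine ⟨min r₀ (ρ / (16 * (|C| + 3))), lt_min hr₀ (by positivity), min_le_left _ _, ?_⟩
    calc _ ≤ 16 * (|C| + 3) * (ρ / (16 * (|C| + 3))) := by gcongr; exact min_le_right _ _
      _ = ρ := by field_simp
  have hrρ' : 48 * r ≤ ρ := by nlinarith
  have hK := hF r hrr₀
  set K := F ∩ Metric.closedBall (x 0) r with hKdef
  have hx0K : x 0 ∈ K := ⟨hx₀F, Metric.mem_closedBall_self hr.le⟩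
  set A := L * (1 + 2 * (|C| + 3)) ^ 2 with hA
  have hA0 : 0 ≤ A := by positivity
  have hδ0 : |(0 : ℝ)| < δ := by simpa
  obtain ⟨τ, hτ, hτδ, hτx, hτξ⟩ : ∃ τ > 0, (∀ t, |t| < τ → |t| < δ) ∧
      (∀ t, |t| < τ → dist (x t) (x 0) < r) ∧ (∀ t, |t| < τ → dist (ξ t) (ξ 0) < ρ / 2) := by
    have h1 : ∀ᶠ t in 𝓝 (0 : ℝ), |t| < δ ∧ dist (x t) (x 0) < r ∧ dist (ξ t) (ξ 0) < ρ / 2 :=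
      ((continuous_abs.tendsto 0).eventually (gt_mem_nhds hδ0)).and
        (((hx 0 hδ0).continuousAt.eventually (Metric.ball_mem_nhds _ hr)).and
          ((hξ 0 hδ0).continuousAt.eventually (Metric.ball_mem_nhds _ (half_pos hρ))))
    obtain ⟨τ, hτ, h⟩ := Metric.eventually_nhds_iff.1 h1
    simp only [dist_zero_right, Real.norm_eq_abs] at h
    exact ⟨τ, hτ, fun t ht => (h ht).1, fun t ht => (h ht).2.1, fun t ht => (h ht).2.2⟩
  have hq : ∀ t, |t| < τ → (x t, ξ t) ∈ Metric.ball (x 0, ξ 0) ρ := fun t ht => by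
    rw [Metric.mem_ball, Prod.dist_eq]
    exact max_lt ((hτx t ht).trans (by linarith)) ((hτξ t ht).trans (by linarith))
  have hxc : ∀ t, |t| < τ → ContinuousAt x t := fun t ht => (hx t (hτδ t ht)).continuousAt
  have hξc : ∀ t, |t| < τ → ContinuousAt ξ t := fun t ht => (hξ t (hτδ t ht)).continuousAt
  -- the action along the curve
  obtain ⟨a, ha0, ha⟩ : ∃ a : ℝ → ℝ, a 0 = 0 ∧
      ∀ t, |t| < τ → HasDerivAt a (x' t ⬝ᵥ ξ t - P (x t, ξ t)) t := by
    set b : ℝ → ℝ := fun t => x' t ⬝ᵥ ξ t - P (x t, ξ t) with hb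
    have hbc : ContinuousOn b (Set.Ioo (-τ) τ) := by
      intro t ht
      have ht' : |t| < τ := abs_lt.2 ht
      have hqc : ContinuousAt (fun s => (x s, ξ s)) t := (hxc t ht').prodMk (hξc t ht')
      have h1 : ContinuousAt (fun s => fderiv ℝ P (x s, ξ s) (0, ξ s) - P (x s, ξ s)) t := by
        refine ContinuousAt.sub (ContinuousAt.clm_apply ?_ ?_) ?_
        · exact ContinuousAt.comp (f := fun s => (x s, ξ s)) (g := fderiv ℝ P)
            (hPc₁.continuousAt (Metric.isOpen_ball.mem_nhds (hsub (hq t ht')))) hqc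
        · exact continuousAt_const.prodMk (hξc t ht')
        · exact ContinuousAt.comp (f := fun s => (x s, ξ s)) (g := P)
            (hPd₁ _ (hsub (hq t ht'))).continuousAt hqc
      refine (h1.congr ?_).continuousWithinAt
      filter_upwards [Ioo_mem_nhds ht.1 ht.2] with s hs
      simp only [hb, hx' s (hτδ s (abs_lt.2 hs))]
    refine ⟨fun t => ∫ s in (0 : ℝ)..t, b s, by simp, fun t ht => ?_⟩
    have ht' := abs_lt.1 ht
    refine intervalIntegral.integral_hasDerivAt_right ?_
      (hbc.stronglyMeasurableAtFilter isOpen_Ioo t ht') (hbc.continuousAt (isOpen_Ioo.mem_nhds ht'))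
    refine (hbc.mono fun s hs => ?_).intervalIntegrable
    exact Set.ordConnected_Ioo.uIcc_subset ⟨by linarith, hτ⟩ ht' hs
  set f : ℝ → ℝ → ℝ → (ι → ℝ) → ℝ := fun κ c t y =>
    a t + ξ t ⬝ᵥ (y - x t) - (c + κ * t) * ((y - x t) ⬝ᵥ (y - x t)) with hf
  set f' : ℝ → ℝ → ℝ → (ι → ℝ) → ℝ := fun κ c t y =>
    -(P (x t, ξ t) - ξ' t ⬝ᵥ (y - x t) - 2 * (c + κ * t) * (x' t ⬝ᵥ (y - x t)))
      - κ * ((y - x t) ⬝ᵥ (y - x t)) with hf'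
  have hder : ∀ κ c t y, |t| < τ → HasDerivAt (fun s => f κ c s y) (f' κ c t y) t := by
    intro κ c t y ht
    have hw : HasDerivAt (fun s => y - x s) (-x' t) t := (hx t (hτδ t ht)).const_sub y
    have h1 := ((ha t ht).fun_add (hasDerivAt_dotProduct (hξ t (hτδ t ht)) hw)).fun_sub
      ((((hasDerivAt_id t).const_mul κ).const_add c).fun_mul (hasDerivAt_dotProduct hw hw))
    refine h1.congr_deriv ?_
    simp only [hf', dotProduct_neg, neg_dotProduct, id, dotProduct_comm (y - x t) (x' t),
      dotProduct_comm (ξ t) (x' t)]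
    ring
  have hcont : ∀ κ c t y, |t| < τ →
      ContinuousAt (fun q : ℝ × (ι → ℝ) => f κ c q.1 q.2) (t, y) := by
    intro κ c t y ht
    have hX : ContinuousAt (fun q : ℝ × (ι → ℝ) => x q.1) (t, y) :=
      ContinuousAt.comp (f := Prod.fst) (hxc t ht) continuousAt_fst
    have hΞ : ContinuousAt (fun q : ℝ × (ι → ℝ) => ξ q.1) (t, y) :=
      ContinuousAt.comp (f := Prod.fst) (hξc t ht) continuousAt_fst
    have hAc : ContinuousAt (fun q : ℝ × (ι → ℝ) => a q.1) (t, y) :=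
      ContinuousAt.comp (f := Prod.fst) (ha t ht).continuousAt continuousAt_fst
    have hD : Continuous fun q : (ι → ℝ) × (ι → ℝ) => q.1 ⬝ᵥ q.2 :=
      continuous_fst.dotProduct continuous_snd
    have hW := continuousAt_snd.sub hX
    refine (hAc.add (hD.continuousAt.comp (hΞ.prodMk hW))).sub
      (ContinuousAt.mul ?_ (hD.continuousAt.comp (hW.prodMk hW)))
    fun_prop
  -- the Hamilton-Jacobi defect at interior maximum points
  have hdefect : ∀ t, |t| < τ → ∀ κ c, 0 ≤ c + κ * t → c + κ * t ≤ |C| + 3 →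
      ∀ y ∈ K, dist y (x 0) < r → IsMaxOn (f κ c t) K y →
      |f' κ c t y + κ * ((y - x t) ⬝ᵥ (y - x t))| ≤ A * ((y - x t) ⬝ᵥ (y - x t)) := by
    intro t ht κ c hc1 hc2 y hy hyr hmax
    simp only [hf', sub_add_cancel, abs_neg]
    set e := c + κ * t with he
    set w := y - x t with hw
    have hwr : ‖w‖ < 2 * r := by
      rw [hw, ← dist_eq_norm]
      have := dist_triangle_right y (x t) (x 0)
      linarith [hτx t ht]
    set η := ξ t - (2 * e) • w with hη
    have hηξ : dist η (ξ 0) < ρ := by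
      have h1 : dist η (ξ t) = 2 * e * ‖w‖ := by
        rw [dist_eq_norm, hη, sub_sub_cancel_left, norm_neg, norm_smul, Real.norm_eq_abs,
          abs_of_nonneg (by positivity)]
      have h2 : 2 * e * ‖w‖ ≤ 2 * (|C| + 3) * (2 * r) := by gcongr
      linarith [dist_triangle η (ξ t) (ξ 0), hτξ t ht]
    have hη0 : η ≠ 0 := by
      rintro h
      rw [h, dist_zero_left] at hηξ
      linarith
    have hprox : IsProximalNormal F y η := by
      refine .of_local hy.1 hη0 (sub_pos.2 hyr) (C := e) fun z hz hzy => ?_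
      have hzK : z ∈ K := ⟨hz, by
        rw [Metric.mem_closedBall]
        linarith [dist_triangle z y (x 0)]⟩
      have h1 : f κ c t z ≤ f κ c t y := hmax hzK
      have h2 : z - x t = w + (z - y) := by rw [hw]; abel
      simp only [hf, h2, ← he, ← hw, dotProduct_add, add_dotProduct,
        dotProduct_comm (z - y) w] at h1
      rw [hη, sub_dotProduct, smul_dotProduct, smul_eq_mul]
      linarith
    have hyη : (y, η) ∈ Metric.ball (x 0, ξ 0) ρ := by
      rw [Metric.mem_ball, Prod.dist_eq]
      exact max_lt (hyr.trans (by linarith)) hηξ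
    have h1 := hrem₁ _ (hsub (hq t ht)) _ (hsub hyη)
    have h2 : (y, η) - (x t, ξ t) = (w, 0) + (-(2 * e)) • ((0 : ι → ℝ), w) := by
      ext i <;> simp [hη, hw]
    rw [hvan y η hprox, h2, map_add, map_smul, ← hx' t (hτδ t ht), smul_eq_mul,
      ← neg_neg (fderiv ℝ P (x t, ξ t) (w, 0)), ← hξ' t (hτδ t ht), Real.norm_eq_abs] at h1
    have h3 : ‖((w, 0) + (-(2 * e)) • ((0 : ι → ℝ), w) : (ι → ℝ) × (ι → ℝ))‖
        ≤ (1 + 2 * (|C| + 3)) * ‖w‖ := by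
      simp only [Prod.smul_mk, smul_zero, Prod.mk_add_mk, add_zero, zero_add, Prod.norm_mk,
        norm_smul, norm_neg, Real.norm_eq_abs]
      rw [abs_of_nonneg (by positivity : 0 ≤ 2 * e)]
      refine max_le ?_ ?_
      · nlinarith [norm_nonneg w]
      · gcongr
        linarith
    calc _ = |0 - P (x t, ξ t) - (-(ξ' t ⬝ᵥ w) + -(2 * e) * (x' t ⬝ᵥ w))| := by
          rw [← abs_neg]
          congr 1
          ring
      _ ≤ _ := h1
      _ ≤ L * ((1 + 2 * (|C| + 3)) * ‖w‖) ^ 2 := by gcongr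
      _ = A * ‖w‖ ^ 2 := by rw [hA]; ring
      _ ≤ _ := by gcongr; exact norm_sq_le_dotProduct w
  have hinit : ∀ κ c, |C| + 1 ≤ c → ∀ y ∈ K,
      f κ c 0 y ≤ -((y - x 0) ⬝ᵥ (y - x 0)) := by
    intro κ c hc y hy
    have h1 := hC y hy.1
    have h2 := mul_le_mul_of_nonneg_right (le_abs_self C) (hdot (y - x 0))
    have h3 := mul_le_mul_of_nonneg_right hc (hdot (y - x 0))
    simp only [hf, ha0, mul_zero, add_zero]
    linarith
  have hsphere : ∀ κ c, |C| + 1 ≤ c → ∀ᶠ t in 𝓝 (0 : ℝ), ∀ y ∈ K ∩ Metric.sphere (x 0) r,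
      f κ c t y < -(r ^ 2 / 2) := by
    intro κ c hc
    refine (hK.inter_right Metric.isClosed_sphere).eventually_forall_of_forall_eventually
      fun y hy => (hcont κ c 0 y (by simpa)).eventually (gt_mem_nhds ?_)
    have h1 := norm_sq_le_dotProduct (y - x 0)
    rw [← dist_eq_norm, Metric.mem_sphere.1 hy.2] at h1
    have := hinit κ c hc y hy.1
    simp only
    nlinarith
  obtain ⟨ε, hε, hετ, hεA, hε1, hε2⟩ : ∃ ε > 0, (∀ t, |t| < ε → |t| < τ) ∧
      (∀ t, |t| < ε → A * t < 1) ∧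
      (∀ t, |t| < ε → ∀ y ∈ K ∩ Metric.sphere (x 0) r, f A (|C| + 1) t y < -(r ^ 2 / 2)) ∧
      (∀ t, |t| < ε → ∀ y ∈ K ∩ Metric.sphere (x 0) r, f (-A) (|C| + 3) t y < -(r ^ 2 / 2)) := by
    have h1 : ∀ᶠ t in 𝓝 (0 : ℝ), |t| < τ :=
      (continuous_abs.tendsto 0).eventually (gt_mem_nhds (by simpa))
    have h2 : ∀ᶠ t in 𝓝 (0 : ℝ), A * t < 1 :=
      ((continuous_const_mul A).tendsto 0).eventually (gt_mem_nhds (by simp))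
    obtain ⟨ε, hε, h⟩ := Metric.eventually_nhds_iff.1 (h1.and (h2.and
      ((hsphere A (|C| + 1) le_rfl).and (hsphere (-A) (|C| + 3) (by linarith)))))
    simp only [dist_zero_right, Real.norm_eq_abs] at h
    exact ⟨ε, hε, fun t ht => (h ht).1, fun t ht => (h ht).2.1, fun t ht => (h ht).2.2.1,
      fun t ht => (h ht).2.2.2⟩
  refine ⟨ε, hε, fun T hT0 hTε => ?_⟩
  have hIcc : ∀ t ∈ Set.Icc 0 T, |t| < ε := fun t ht => by
    rw [abs_of_nonneg ht.1]
    exact ht.2.trans_lt hTε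
  have hT : T ∈ Set.Icc 0 T := ⟨hT0, le_rfl⟩
  have hrefl : ∀ s ∈ Set.Icc 0 T, T - s ∈ Set.Icc 0 T := fun s hs =>
    ⟨by linarith [hs.2], by linarith [hs.1]⟩
  have hAt : ∀ t ∈ Set.Icc 0 T, 0 ≤ A * t := fun t ht => mul_nonneg hA0 ht.1
  have hinterior : ∀ y ∈ K, y ∉ Metric.sphere (x 0) r → dist y (x 0) < r := fun y hy hys =>
    lt_of_le_of_ne hy.2 hys
  -- the maximum of the subsolution does not increase
  have hlower : ∀ y ∈ K, f A (|C| + 1) T y ≤ 0 := by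
    refine le_of_deriv_nonpos_at_max hK (T := T) (f' := f' A (|C| + 1)) ?_ ?_ ?_ ?_ T hT
    · rintro ⟨t, y⟩ ⟨ht, -⟩
      exact (hcont _ _ t y (hετ t (hIcc t ht))).continuousWithinAt
    · exact fun y hy => (hinit _ _ le_rfl y hy).trans (neg_nonpos.2 (hdot _))
    · exact fun t ht y _ => hder _ _ t y (hετ t (hIcc t ht))
    · intro t ht y hy hpos hmax
      have hys : dist y (x 0) < r := hinterior y hy fun hys => by
        have := hε1 t (hIcc t ht) y ⟨hy, hys⟩
        nlinarith
      have h1 := hAt t ht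
      have h2 := hεA t (hIcc t ht)
      have := (abs_le.1 (hdefect t (hετ t (hIcc t ht)) A (|C| + 1) (by linarith) (by linarith)
        y hy hys hmax)).2
      linarith
  -- the maximum of the supersolution does not decrease
  obtain ⟨y, hy, hfy⟩ : ∃ y ∈ K, 0 ≤ f (-A) (|C| + 3) T y := by
    obtain ⟨y, hy, hmaxy⟩ := hK.exists_isMaxOn ⟨x 0, hx0K⟩ (f := f (-A) (|C| + 3) T) (by
      intro y hy
      exact (ContinuousAt.comp (f := fun y : ι → ℝ => (T, y))
        (hcont (-A) (|C| + 3) T y (hετ T (hIcc T hT))) (by fun_prop)).continuousWithinAt)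
    refine ⟨y, hy, ?_⟩
    by_contra! hneg
    have h1 := le_of_deriv_nonpos_at_max hK (T := T)
      (B := max (f (-A) (|C| + 3) T y) (-(r ^ 2 / 2)))
      (f := fun s z => f (-A) (|C| + 3) (T - s) z)
      (f' := fun s z => -f' (-A) (|C| + 3) (T - s) z) ?_ ?_ ?_ ?_ T hT (x 0) hx0K
    · simp only [sub_self] at h1
      have h2 : f (-A) (|C| + 3) 0 (x 0) = 0 := by simp [hf, ha0]
      rw [h2] at h1
      have h3 : max (f (-A) (|C| + 3) T y) (-(r ^ 2 / 2)) < 0 :=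
        max_lt hneg (neg_lt_zero.2 (by positivity))
      linarith
    · rintro ⟨s, z⟩ ⟨hs, -⟩
      exact (ContinuousAt.comp (x := (s, z)) (f := fun q : ℝ × (ι → ℝ) => (T - q.1, q.2))
        (g := fun q : ℝ × (ι → ℝ) => f (-A) (|C| + 3) q.1 q.2)
        (hcont (-A) (|C| + 3) (T - s) z (hετ _ (hIcc _ (hrefl s hs))))
        (by fun_prop)).continuousWithinAt
    · intro z hz
      rw [sub_zero]
      exact le_max_of_le_left (hmaxy hz)
    · intro s hs z _
      exact (hder (-A) (|C| + 3) (T - s) z (hετ _ (hIcc _ (hrefl s hs)))).comp_const_sub T s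
    · intro s hs z hz hB hmax
      have hs' := hrefl s hs
      have hzs : dist z (x 0) < r := hinterior z hz fun hzs => by
        have := hε2 _ (hIcc _ hs') z ⟨hz, hzs⟩
        exact absurd hB (not_lt.2 (le_max_of_le_right this.le))
      have h1 := hAt _ hs'
      have h2 := hεA _ (hIcc _ hs')
      have := (abs_le.1 (hdefect _ (hετ _ (hIcc _ hs')) (-A) (|C| + 3) (by linarith) (by linarith)
        z hz hzs hmax)).1
      linarith
  have hyT : y = x T := by
    have h1 := hlower y hy
    have h2 := hεA T (hIcc T hT)
    simp only [hf] at h1 hfy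
    have h3 := hdot (y - x T)
    have h4 : (y - x T) ⬝ᵥ (y - x T) = 0 := by nlinarith
    have h5 := norm_sq_le_dotProduct (y - x T)
    rw [h4] at h5
    exact sub_eq_zero.1 (norm_eq_zero.1 (pow_eq_zero_iff two_ne_zero |>.1
      (le_antisymm h5 (sq_nonneg _))))
  subst hyT
  have haT : 0 ≤ a T := by simpa [hf] using hfy
  have hTτ := hετ T (hIcc T hT)
  refine .of_local hy.1 ?_ (sub_pos.2 (hτx T hTτ)) (C := |C| + 1 + A * T) fun z hz hzx => ?_
  · intro h
    have := hτξ T hTτ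
    rw [h, dist_zero_left] at this
    linarith
  · have hzK : z ∈ K := ⟨hz, by
      rw [Metric.mem_closedBall]
      linarith [dist_triangle z (x T) (x 0)]⟩
    have := hlower z hzK
    simp only [hf] at this
    linarith

/-- Sjöstrand's theorem: a bicharacteristic of a smooth real function `p` vanishing on
`N_e(F)` which starts in `N_e(F)` stays in `N_e(F)` for small times. -/
theorem stmt_19 {n : ℕ} (Ω F : Set (Fin n → ℝ)) (hΩ : IsOpen Ω)
    (hFΩ : F ⊆ Ω) (hFcl : ∀ x ∈ Ω, x ∈ closure F → x ∈ F)
    (p : (Fin n → ℝ) → (Fin n → ℝ) → ℝ)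
    (hp : ContDiffOn ℝ (⊤ : ℕ∞)
      (fun q : (Fin n → ℝ) × (Fin n → ℝ) => p q.1 q.2)
      (Ω ×ˢ {ξ : Fin n → ℝ | ξ ≠ 0}))
    (hvan : ∀ q ∈ extNormal Ω F, p q.1 q.2 = 0)
    (x₀ ξ₀ : Fin n → ℝ) (h0 : (x₀, ξ₀) ∈ extNormal Ω F)
    (x ξ : ℝ → (Fin n → ℝ)) (δ : ℝ) (hδ : 0 < δ)
    (hx0 : x 0 = x₀) (hξ0 : ξ 0 = ξ₀)
    (hdom : ∀ t : ℝ, |t| < δ → x t ∈ Ω ∧ ξ t ≠ 0)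
    (hham : ∀ t : ℝ, |t| < δ →
      HasDerivAt x
        (fun j => fderiv ℝ (fun η => p (x t) η) (ξ t) (Pi.single j 1)) t ∧
      HasDerivAt ξ
        (fun j => -(fderiv ℝ (fun y => p y (ξ t)) (x t) (Pi.single j 1))) t) :
    ∃ ε : ℝ, 0 < ε ∧ ε ≤ δ ∧ ∀ t : ℝ, |t| < ε → (x t, ξ t) ∈ extNormal Ω F := by
  subst hx0 hξ0
  simp only [mem_extNormal_iff hΩ hFΩ] at h0 ⊢
  set P : (Fin n → ℝ) × (Fin n → ℝ) → ℝ := fun q => p q.1 q.2 with hPdef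
  have hvan' : ∀ y η, IsProximalNormal F y η → P (y, η) = 0 := fun y η h =>
    hvan _ ((mem_extNormal_iff hΩ hFΩ).2 h)
  have hopen : IsOpen (Ω ×ˢ {ξ : Fin n → ℝ | ξ ≠ 0}) := hΩ.prod isOpen_ne
  have hP : ∀ t, |t| < δ → ContDiffAt ℝ (⊤ : ℕ∞) P (x t, ξ t) := fun t ht =>
    hp.contDiffAt (hopen.mem_nhds (Set.mk_mem_prod (hdom t ht).1 (hdom t ht).2))
  have hδ0 : |(0 : ℝ)| < δ := by simpa
  have hP2 : ContDiffAt ℝ 2 P (x 0, ξ 0) := contDiffAt_infty.1 (hP 0 hδ0) 2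
  have hPd : ∀ t, |t| < δ → HasFDerivAt P (fderiv ℝ P (x t, ξ t)) (x t, ξ t) := fun t ht =>
    ((hP t ht).differentiableAt (by simp)).hasFDerivAt
  have hsum : ∀ (ℓ : (Fin n → ℝ) →L[ℝ] ℝ) v, (fun j => ℓ (Pi.single j 1)) ⬝ᵥ v = ℓ v := by
    intro ℓ v
    conv_rhs => rw [pi_eq_sum_univ' v]
    simp only [map_sum, map_smul, smul_eq_mul, dotProduct, mul_comm]
  have hx' : ∀ t, |t| < δ → ∀ v,
      (fun j => fderiv ℝ (fun η => p (x t) η) (ξ t) (Pi.single j 1)) ⬝ᵥ v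
        = fderiv ℝ P (x t, ξ t) (0, v) := by
    intro t ht v
    have h1 : HasFDerivAt (fun η => p (x t) η) _ (ξ t) :=
      HasFDerivAt.comp (g := P) (ξ t) (hPd t ht) (hasFDerivAt_prodMk_right (x t) (ξ t))
    rw [hsum, h1.fderiv]
    simp
  have hξ' : ∀ t, |t| < δ → ∀ v,
      (fun j => -(fderiv ℝ (fun y => p y (ξ t)) (x t) (Pi.single j 1))) ⬝ᵥ v
        = -fderiv ℝ P (x t, ξ t) (v, 0) := by
    intro t ht v
    have h1 := hsum (-fderiv ℝ (fun y => p y (ξ t)) (x t)) v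
    have h2 : HasFDerivAt (fun y => p y (ξ t)) _ (x t) :=
      HasFDerivAt.comp (g := P) (f := fun y => (y, ξ t)) (x t) (hPd t ht)
        (hasFDerivAt_prodMk_left (x t) (ξ t))
    simp only [neg_apply] at h1
    rw [h1, h2.fderiv]
    simp
  obtain ⟨r₀, hr₀, hball⟩ := Metric.nhds_basis_closedBall.mem_iff.1 (hΩ.mem_nhds (hFΩ h0.1))
  have hF : ∀ r ≤ r₀, IsCompact (F ∩ Metric.closedBall (x 0) r) := by
    intro r hr
    have : F ∩ Metric.closedBall (x 0) r = closure F ∩ Metric.closedBall (x 0) r :=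
      Set.Subset.antisymm (Set.inter_subset_inter_left _ subset_closure) fun y hy =>
        ⟨hFcl y (hball (Metric.closedBall_subset_closedBall hr hy.2)) hy.1, hy.2⟩
    rw [this]
    exact (isCompact_closedBall _ _).inter_left isClosed_closure
  obtain ⟨ε₁, hε₁, h₁⟩ := h0.forward hr₀ hF hP2 hvan' hδ (fun t ht => (hham t ht).1)
    (fun t ht => (hham t ht).2) hx' hξ'
  obtain ⟨ε₂, hε₂, h₂⟩ := IsProximalNormal.forward (P := fun q => -P q) (x := fun t => x (-t))
    (ξ := fun t => ξ (-t)) (F := F) (δ := δ)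
    (x' := fun t => -fun j => fderiv ℝ (fun η => p (x (-t)) η) (ξ (-t)) (Pi.single j 1))
    (ξ' := fun t => -fun j => -(fderiv ℝ (fun y => p y (ξ (-t))) (x (-t)) (Pi.single j 1)))
    (by simpa using h0) hr₀ (by simpa using hF) (by simpa using hP2.neg)
    (fun y η h => by simp [hvan' y η h]) hδ
    (fun t ht => by
      have h := (hham (-t) (by rwa [abs_neg])).1.scomp t (hasDerivAt_neg t)
      rwa [neg_one_smul] at h)
    (fun t ht => by
      have h := (hham (-t) (by rwa [abs_neg])).2.scomp t (hasDerivAt_neg t)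
      rwa [neg_one_smul] at h)
    (fun t ht v => by
      rw [neg_dotProduct, hx' (-t) (by rwa [abs_neg]), fderiv_fun_neg]
      rfl)
    (fun t ht v => by
      rw [neg_dotProduct, hξ' (-t) (by rwa [abs_neg]), fderiv_fun_neg]
      rfl)
  refine ⟨min δ (min ε₁ ε₂), lt_min hδ (lt_min hε₁ hε₂), min_le_left _ _, fun t ht => ?_⟩
  simp only [lt_min_iff] at ht
  rcases le_total 0 t with h | h
  · exact h₁ t h (abs_of_nonneg h ▸ ht.2.1)
  · simpa using h₂ (-t) (neg_nonneg.2 h) (abs_of_nonpos h ▸ ht.2.2)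
end
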